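/- (Shannon–McMillan–Breiman theorem for amenable group actions, non-ergodic version.) Let G be a countable discrete infinite amenable group acting measurably and measure-preservingly on a probability space (X,B,μ), let {F_n} be a tempered Følner sequence in G with lim_{n→∞} |F_n|/log n = ∞, and let P be a finite measurable partition of X. Then for μ-almost every x ∈ X the limit h(x,P) = lim_{n→∞} −(1/|F_n|) log μ(P^{F_n}(x)) exists, where P^{F_n} = ⋁_{g∈F_n} g^{-1}P and P^{F_n}(x) is the atom of P^{F_n} containing x; moreover h(·,P) is G-invariant, h(x,P) equals the conditional entropy h_{μ_y}(G,P) of P on the ergodic component p^{-1}(y) containing x (where μ = ∫ μ_y dπ(y) is the ergodic decomposition of μ), and ∫_X h(x,P) dμ(x) = h_μ(G,P). -/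

import Mathlib

open MeasureTheory Filter Set
open scoped Pointwise ENNReal NNReal Topology

section Defs

variable {G : Type*} [Group G] [DecidableEq G] {X : Type*}

/-- A Følner sequence: a sequence of nonempty finite subsets of `G` that is asymptotically
invariant: `|Fₙ △ gFₙ|/|Fₙ| → 0` for every `g ∈ G`. -/
def IsFolnerSeq (F : ℕ → Finset G) : Prop :=
  (∀ n, (F n).Nonempty) ∧
    ∀ g : G, Tendsto (fun n => ((symmDiff (F n) ((F n).image (g * ·))).card : ℝ) / (F n).card)
      atTop (𝓝 0)

/-- A sequence of finite subsets is tempered if `|⋃_{k<n} Fₖ⁻¹ Fₙ| ≤ C |Fₙ|` for a constant `C`. -/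
def IsTemperedSeq (F : ℕ → Finset G) : Prop :=
  ∃ C : ℝ, ∀ n : ℕ, (((Finset.range n).biUnion fun k => (F k)⁻¹ * F n).card : ℝ) ≤ C * (F n).card

/-- The growth condition `|Fₙ|/log n → ∞`. -/
def GrowthCond (F : ℕ → Finset G) : Prop :=
  Tendsto (fun n => ((F n).card : ℝ) / Real.log n) atTop atTop

variable [MetricSpace X] [MulAction G X]

/-- The Bowen ball `B_F(x,ε) = {y : d(gx, gy) < ε for all g ∈ F}`. -/
def bowenBall (F : Finset G) (x : X) (ε : ℝ) : Set X :=
  {y | ∀ g ∈ F, dist (g • x) (g • y) < ε}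

/-- `M(Z,N,ε,s,{Fₙ})`: infimum of `Σᵢ exp(-s |F_{nᵢ}|)` over countable families of Bowen balls
`B_{F_{nᵢ}}(xᵢ,ε)` with `nᵢ ≥ N` covering `Z`. -/
noncomputable def bowenMpre (F : ℕ → Finset G) (Z : Set X) (N : ℕ) (ε s : ℝ) : ℝ≥0∞ :=
  ⨅ (C : Set (X × ℕ)) (_ : C.Countable ∧ (∀ p ∈ C, N ≤ p.2) ∧
      Z ⊆ ⋃ p ∈ C, bowenBall (F p.2) p.1 ε),
    ∑' p : C, ENNReal.ofReal (Real.exp (-s * ((F (p : X × ℕ).2).card : ℝ)))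

/-- `M(Z,s,{Fₙ}) = lim_{ε→0} lim_{N→∞} M(Z,N,ε,s,{Fₙ})`; since the quantity is monotone
(nondecreasing as `N` increases and as `ε` decreases), the limits are suprema. -/
noncomputable def bowenMeasure (F : ℕ → Finset G) (Z : Set X) (s : ℝ) : ℝ≥0∞ :=
  ⨆ (ε : ℝ) (_ : 0 < ε), ⨆ N : ℕ, bowenMpre F Z N ε s

/-- The Bowen topological entropy of `Z` along `{Fₙ}`: the critical value of `s` at which
`M(Z,s,{Fₙ})` jumps from `+∞` to `0`. -/
noncomputable def bowenEntropy (F : ℕ → Finset G) (Z : Set X) : ℝ≥0∞ :=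
  ⨆ (s : ℝ) (_ : bowenMeasure F Z s = ⊤), ENNReal.ofReal s

/-- The minimal cardinality of a subcover of `⋁_{g ∈ F} g⁻¹ U` for a cover `U`. -/
noncomputable def coverNumber (U : Finset (Set X)) (F : Finset G) : ℕ :=
  sInf {k : ℕ | ∃ f : Fin k → G → Set X, (∀ i, ∀ g ∈ F, f i g ∈ U) ∧
    (univ : Set X) ⊆ ⋃ i, ⋂ g ∈ F, (fun x => g • x) ⁻¹' f i g}

/-- The topological entropy of the `G`-action on `X` (computed along `{Fₙ}`; it is independent
of the Følner sequence). -/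
noncomputable def topEntropy (X : Type*) [MetricSpace X] {G : Type*} [Group G] [MulAction G X]
    (F : ℕ → Finset G) : ℝ≥0∞ :=
  ⨆ (U : Finset (Set X)) (_ : (∀ V ∈ U, IsOpen V) ∧ ⋃₀ (U : Set (Set X)) = univ),
    limsup (fun n => ENNReal.ofReal (Real.log (coverNumber U (F n)) / (F n).card)) atTop

end Defs

section MeasDefs

variable {G : Type*} [Group G] [DecidableEq G] {X : Type*} [MeasurableSpace X] [MulAction G X]

/-- The Shannon entropy `H_μ(⋁_{g∈F} g⁻¹ P)` of the join over `F` of the finite measurable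
partition `P` given by the fibers of `α`. -/
noncomputable def partitionEntropy (μ : Measure X) {ι : Type*} [Fintype ι] (α : X → ι)
    (F : Finset G) : ℝ :=
  ∑ f : ↥F → ι, Real.negMulLog ((μ {x | ∀ g : ↥F, α ((g : G) • x) = f g}).toReal)

/-- The entropy `h_μ(G,P) = lim_n H_μ(P^{Fₙ})/|Fₙ|` of the partition given by the fibers
of `α` (the limit existing, it is the `limsup`). -/
noncomputable def partitionDynEntropy (F : ℕ → Finset G) (μ : Measure X) {ι : Type*} [Fintype ι]
    (α : X → ι) : ℝ :=
  limsup (fun n => partitionEntropy μ α (F n) / (F n).card) atTop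

/-- The measure-theoretic entropy `h_μ(X,G)`: the supremum over finite measurable partitions
(encoded as measurable maps `X → Fin k`) of `lim_n H_μ(P^{Fₙ})/|Fₙ|`. -/
noncomputable def measEntropy (F : ℕ → Finset G) (μ : Measure X) : ℝ≥0∞ :=
  ⨆ (k : ℕ) (α : X → Fin k) (_ : Measurable α),
    limsup (fun n => ENNReal.ofReal (partitionEntropy μ α (F n) / (F n).card)) atTop

/-- `μ` is `G`-invariant. -/
def InvariantMeasure (G : Type*) [Group G] [MulAction G X] (μ : Measure X) : Prop :=
  ∀ g : G, Measure.map (fun x => g • x) μ = μ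

/-- `μ` is ergodic: every Borel set `A` with `μ(A △ g⁻¹A) = 0` for all `g` is trivial. -/
def ErgodicMeasure (G : Type*) [Group G] [MulAction G X] (μ : Measure X) : Prop :=
  ∀ A : Set X, MeasurableSet A →
    (∀ g : G, μ (symmDiff A ((fun x => g • x) ⁻¹' A)) = 0) → μ A = 0 ∨ μ A = 1

end MeasDefs

section LocalDefs

variable {G : Type*} [Group G] [DecidableEq G] {X : Type*} [MetricSpace X] [MulAction G X]
  [MeasurableSpace X]

/-- The set of generic points of `μ` with respect to `{Fₙ}`. -/
def genericPointSet (F : ℕ → Finset G) (μ : Measure X) : Set X :=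
  {x | ∀ f : C(X, ℝ),
    Tendsto (fun n => (∑ g ∈ F n, f (g • x)) / (F n).card) atTop (𝓝 (∫ y, f y ∂μ))}

/-- The lower local entropy of `μ` at `x` along `{Fₙ}`:
`lim_{δ→0} liminf_n -(1/|Fₙ|) log μ(B_{Fₙ}(x,δ))` (the limit in `δ` being a supremum
by monotonicity). -/
noncomputable def localLowerEntropy (F : ℕ → Finset G) (μ : Measure X) (x : X) : ℝ≥0∞ :=
  ⨆ (δ : ℝ) (_ : 0 < δ),
    liminf (fun n =>
      ENNReal.ofReal (-(Real.log ((μ (bowenBall (F n) x δ)).toReal)) / (F n).card)) atTop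

end LocalDefs


section Maximal

variable {G : Type*} [Group G] [DecidableEq G] {X : Type*} [MeasurableSpace X] [MulAction G X]

open Classical in
/-- The weight put on a centre `x` at a level with tile `B`, set of centres `D`, given the
multiplicity function `L` of the earlier levels. -/
noncomputable def wtStep (B : Finset G) (D : Set X) (L : X → ℝ≥0∞) (x : X) : ℝ≥0∞ :=
  if x ∈ D ∧ ∀ g ∈ B, L (g • x) < 1 then ((B.card : ℝ≥0∞))⁻¹ else 0

/-- The multiplicity function. -/
noncomputable def lamSeq (B : ℕ → Finset G) (D : ℕ → Set X) : ℕ → X → ℝ≥0∞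
  | 0 => fun _ => 0
  | i + 1 => fun x => lamSeq B D i x + ∑ h ∈ B i, wtStep (B i) (D i) (lamSeq B D i) (h⁻¹ • x)

/-- The weights. -/
noncomputable def wtSeq (B : ℕ → Finset G) (D : ℕ → Set X) (i : ℕ) : X → ℝ≥0∞ :=
  wtStep (B i) (D i) (lamSeq B D i)

lemma lamSeq_eq_sum (B : ℕ → Finset G) (D : ℕ → Set X) (i : ℕ) (x : X) :
    lamSeq B D i x = ∑ j ∈ Finset.range i, ∑ h ∈ B j, wtSeq B D j (h⁻¹ • x) := by
  induction i with
  | zero => simp [lamSeq]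
  | succ i ih => rw [Finset.sum_range_succ, ← ih]; rfl

lemma wtStep_le (B : Finset G) (D : Set X) (L : X → ℝ≥0∞) (x : X) :
    wtStep B D L x ≤ ((B.card : ℝ≥0∞))⁻¹ := by
  unfold wtStep; split_ifs <;> simp

lemma lamSeq_le_two (B : ℕ → Finset G) (D : ℕ → Set X) (i : ℕ) (x : X) :
    lamSeq B D i x ≤ 2 := by
  induction i with
  | zero => simp [lamSeq]
  | succ i ih =>
    show lamSeq B D i x + ∑ h ∈ B i, wtStep (B i) (D i) (lamSeq B D i) (h⁻¹ • x) ≤ 2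
    by_cases h1 : lamSeq B D i x < 1
    · have : ∑ h ∈ B i, wtStep (B i) (D i) (lamSeq B D i) (h⁻¹ • x) ≤ 1 := by
        calc _ ≤ ∑ h ∈ B i, (((B i).card : ℝ≥0∞))⁻¹ := Finset.sum_le_sum fun h _ => wtStep_le _ _ _ _
          _ ≤ 1 := by
            rw [Finset.sum_const, nsmul_eq_mul]; exact ENNReal.mul_inv_le_one _
      calc _ ≤ (1 : ℝ≥0∞) + 1 := add_le_add h1.le this
        _ = 2 := one_add_one_eq_two
    · have : ∑ h ∈ B i, wtStep (B i) (D i) (lamSeq B D i) (h⁻¹ • x) = 0 := by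
        apply Finset.sum_eq_zero
        intro h hh
        unfold wtStep
        rw [if_neg]
        rintro ⟨_, h2⟩
        have := h2 h hh
        rw [smul_inv_smul] at this
        exact h1 this
      rw [this, add_zero]; exact ih

lemma measurable_lam_wt (hmeas : ∀ g : G, Measurable (fun x : X => g • x))
    (B : ℕ → Finset G) (D : ℕ → Set X) (hD : ∀ i, MeasurableSet (D i)) (i : ℕ) :
    Measurable (lamSeq B D i) ∧ Measurable (wtSeq B D i) := by
  have key : ∀ i, Measurable (lamSeq B D i) → Measurable (wtSeq B D i) := by
    intro i hi
    unfold wtSeq wtStep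
    refine Measurable.ite ?_ measurable_const measurable_const
    have : {x | x ∈ D i ∧ ∀ g ∈ B i, lamSeq B D i (g • x) < 1}
        = D i ∩ ⋂ g ∈ B i, {x | lamSeq B D i (g • x) < 1} := by
      ext x; simp
    rw [this]
    refine (hD i).inter (Finset.measurableSet_biInter _ fun g _ => ?_)
    exact measurableSet_lt (hi.comp (hmeas g)) measurable_const
  have h1 : ∀ i, Measurable (lamSeq B D i) := by
    intro i
    induction i with
    | zero => exact measurable_const
    | succ i ih =>
      refine ih.add (Finset.measurable_sum _ fun h _ => ?_)
      exact (key i ih).comp (hmeas h⁻¹)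
  exact ⟨h1 i, key i (h1 i)⟩

lemma indicator_le_wt (B : ℕ → Finset G) (hB : ∀ i, (B i).Nonempty) (D : ℕ → Set X) (i : ℕ) (x : X) :
    (D i).indicator 1 x ≤ ((B i).card : ℝ≥0∞) * wtSeq B D i x +
      ∑ j ∈ Finset.range i, ∑ b ∈ (B j)⁻¹ * B i, wtSeq B D j (b • x) * (D i).indicator 1 x := by
  by_cases hx : x ∈ D i
  swap
  · simp [hx]
  by_cases hb : ∀ g ∈ B i, lamSeq B D i (g • x) < 1
  · have : wtSeq B D i x = (((B i).card : ℝ≥0∞))⁻¹ := by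
      unfold wtSeq wtStep; rw [if_pos ⟨hx, hb⟩]
    rw [this, ENNReal.mul_inv_cancel]
    · simp [hx]
    · simpa using (hB i).ne_empty
    · simp
  · push Not at hb
    obtain ⟨g, hg, h1⟩ := hb
    simp only [hx, indicator_of_mem, Pi.one_apply, mul_one]
    refine h1.trans ?_
    rw [lamSeq_eq_sum]
    refine le_trans ?_ le_add_self
    refine Finset.sum_le_sum fun j _ => ?_
    have : ∑ h ∈ B j, wtSeq B D j (h⁻¹ • g • x) =
        ∑ b ∈ (B j).image (fun h => h⁻¹ * g), wtSeq B D j (b • x) := by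
      rw [Finset.sum_image]
      · simp [mul_smul]
      · intro a _ b _ hab; simpa using hab
    rw [this]
    refine Finset.sum_le_sum_of_subset ?_
    intro b hb
    obtain ⟨h, hh, rfl⟩ := Finset.mem_image.1 hb
    exact Finset.mul_mem_mul (Finset.inv_mem_inv hh) hg

lemma maximal_aux (μ : Measure X)
    (hmp : ∀ g : G, MeasurePreserving (fun x : X => g • x) μ μ)
    (B : ℕ → Finset G) (hB : ∀ i, (B i).Nonempty) (D : ℕ → Set X) (hD : ∀ i, MeasurableSet (D i))
    (hdisj : Pairwise (fun i j => Disjoint (D i) (D j))) (N : ℕ) (C : ℝ≥0∞)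
    (hC : ∀ j < N, ((((Finset.Ioo j N).biUnion fun i => (B i)⁻¹ * B j).card : ℕ) : ℝ≥0∞)
      ≤ C * (B j).card)
    (φ : X → ℝ≥0∞) (hφ : Measurable φ) (l : ℝ≥0∞)
    (hl : ∀ i < N, ∀ x ∈ D i, l * (B i).card ≤ ∑ g ∈ B i, φ (g • x)) :
    l * ∑ i ∈ Finset.range N, μ (D i) ≤ 2 * (1 + C) * ∫⁻ x, φ x ∂μ := by
  have hmeas : ∀ g : G, Measurable (fun x : X => g • x) := fun g => (hmp g).measurable
  have hw : ∀ i, Measurable (wtSeq B D i) := fun i => (measurable_lam_wt hmeas B D hD i).2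
  have hind : ∀ i, Measurable ((D i).indicator (1 : X → ℝ≥0∞)) := fun i =>
    measurable_one.indicator (hD i)
  -- change of variables
  have cov : ∀ (g : G) (u v : X → ℝ≥0∞), Measurable u → Measurable v →
      ∫⁻ x, u (g • x) * v x ∂μ = ∫⁻ x, u x * v (g⁻¹ • x) ∂μ := by
    intro g u v hu hv
    have := (hmp g).lintegral_comp (f := fun x => u x * v (g⁻¹ • x))
      (hu.mul (hv.comp (hmeas _)))
    simpa using this
  set T : ℝ≥0∞ := ∑ i ∈ Finset.range N, ((B i).card : ℝ≥0∞) * ∫⁻ x, wtSeq B D i x ∂μ with hT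
  have h1 : ∑ i ∈ Finset.range N, μ (D i) ≤ T + C * T := by
    have e1 : ∀ i, μ (D i) ≤ ((B i).card : ℝ≥0∞) * ∫⁻ x, wtSeq B D i x ∂μ +
        ∑ j ∈ Finset.range i, ∑ b ∈ (B j)⁻¹ * B i,
          ∫⁻ x, wtSeq B D j x * (D i).indicator 1 (b⁻¹ • x) ∂μ := by
      intro i
      calc μ (D i) = ∫⁻ x, (D i).indicator 1 x ∂μ := (lintegral_indicator_one (hD i)).symm
        _ ≤ ∫⁻ x, (((B i).card : ℝ≥0∞) * wtSeq B D i x +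
          ∑ j ∈ Finset.range i, ∑ b ∈ (B j)⁻¹ * B i, wtSeq B D j (b • x) * (D i).indicator 1 x) ∂μ :=
          lintegral_mono fun x => indicator_le_wt B hB D i x
        _ = _ := by
          rw [lintegral_add_left ((hw i).const_mul _), lintegral_const_mul _ (hw i),
            lintegral_finsetSum']
          · congr 1
            refine Finset.sum_congr rfl fun j _ => ?_
            rw [lintegral_finsetSum']
            · refine Finset.sum_congr rfl fun b _ => ?_
              exact cov b _ _ (hw j) (hind i)
            · intro b _
              exact (((hw j).comp (hmeas b)).mul (hind i)).aemeasurable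
          · intro j _
            exact (Finset.measurable_sum _ fun b _ =>
              (((hw j).comp (hmeas b)).mul (hind i))).aemeasurable
    have e2 : ∑ i ∈ Finset.range N, ∑ j ∈ Finset.range i, ∑ b ∈ (B j)⁻¹ * B i,
          ∫⁻ x, wtSeq B D j x * (D i).indicator 1 (b⁻¹ • x) ∂μ ≤ C * T := by
      have : ∑ i ∈ Finset.range N, ∑ j ∈ Finset.range i, ∑ b ∈ (B j)⁻¹ * B i,
          ∫⁻ x, wtSeq B D j x * (D i).indicator 1 (b⁻¹ • x) ∂μ
          = ∑ j ∈ Finset.range N, ∑ i ∈ Finset.Ioo j N, ∑ b ∈ (B j)⁻¹ * B i,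
          ∫⁻ x, wtSeq B D j x * (D i).indicator 1 (b⁻¹ • x) ∂μ := by
        apply Finset.sum_comm'
        intro i j
        simp only [Finset.mem_range, Finset.mem_Ioo]; omega
      rw [this, hT, Finset.mul_sum]
      refine Finset.sum_le_sum fun j hj => ?_
      have hj := Finset.mem_range.1 hj
      calc ∑ i ∈ Finset.Ioo j N, ∑ b ∈ (B j)⁻¹ * B i,
            ∫⁻ x, wtSeq B D j x * (D i).indicator 1 (b⁻¹ • x) ∂μ
          = ∫⁻ x, wtSeq B D j x * ∑ i ∈ Finset.Ioo j N, ∑ b ∈ (B j)⁻¹ * B i,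
              (D i).indicator 1 (b⁻¹ • x) ∂μ := by
            simp_rw [Finset.mul_sum]
            rw [lintegral_finsetSum']
            · refine Finset.sum_congr rfl fun i _ => ?_
              rw [lintegral_finsetSum']
              intro b _
              exact ((hw j).mul ((hind i).comp (hmeas _))).aemeasurable
            · intro i _
              exact (Finset.measurable_sum _ fun b _ =>
                ((hw j).mul ((hind i).comp (hmeas _)))).aemeasurable
        _ ≤ ∫⁻ x, wtSeq B D j x * (C * (B j).card) ∂μ := by
            refine lintegral_mono fun x => ?_
            refine mul_le_mul_right ?_ _
            refine le_trans ?_ (hC j hj)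
            calc ∑ i ∈ Finset.Ioo j N, ∑ b ∈ (B j)⁻¹ * B i, (D i).indicator (1 : X → ℝ≥0∞) (b⁻¹ • x)
                = ∑ i ∈ Finset.Ioo j N, ∑ c ∈ (B i)⁻¹ * B j, (D i).indicator 1 (c • x) := by
                  refine Finset.sum_congr rfl fun i _ => ?_
                  refine Finset.sum_bij' (fun b _ => b⁻¹) (fun b _ => b⁻¹) ?_ ?_ ?_ ?_ ?_
                  · intro b hb
                    have := Finset.inv_mem_inv hb
                    simpa [mul_inv_rev] using this
                  · intro b hb
                    have := Finset.inv_mem_inv hb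
                    simpa [mul_inv_rev] using this
                  · simp
                  · simp
                  · simp
              _ ≤ ∑ i ∈ Finset.Ioo j N, ∑ c ∈ (Finset.Ioo j N).biUnion fun i => (B i)⁻¹ * B j,
                    (D i).indicator 1 (c • x) := by
                  refine Finset.sum_le_sum fun i hi => ?_
                  refine Finset.sum_le_sum_of_subset ?_
                  exact Finset.subset_biUnion_of_mem (fun i => (B i)⁻¹ * B j) hi
              _ = ∑ c ∈ (Finset.Ioo j N).biUnion fun i => (B i)⁻¹ * B j, ∑ i ∈ Finset.Ioo j N,
                    (D i).indicator 1 (c • x) := Finset.sum_comm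
              _ ≤ ∑ c ∈ (Finset.Ioo j N).biUnion fun i => (B i)⁻¹ * B j, 1 := by
                  refine Finset.sum_le_sum fun c _ => ?_
                  by_cases hc : ∃ i ∈ Finset.Ioo j N, c • x ∈ D i
                  · obtain ⟨i, hi, hci⟩ := hc
                    rw [Finset.sum_eq_single i]
                    · simp [hci]
                    · intro i' _ hne
                      have : c • x ∉ D i' := fun h => Set.disjoint_left.1 (hdisj hne) h hci
                      simp [this]
                    · intro h; exact absurd hi h
                  · push Not at hc
                    rw [Finset.sum_eq_zero]
                    · simp
                    · intro i hi; simp [hc i hi]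
              _ = _ := by simp
        _ = _ := by
            rw [lintegral_mul_const _ (hw j)]; ring
    calc _ ≤ ∑ i ∈ Finset.range N, _ := Finset.sum_le_sum fun i _ => e1 i
      _ = T + _ := Finset.sum_add_distrib
      _ ≤ _ := by gcongr
  have h2 : l * T ≤ 2 * ∫⁻ x, φ x ∂μ := by
    rw [hT, Finset.mul_sum]
    calc ∑ i ∈ Finset.range N, l * (((B i).card : ℝ≥0∞) * ∫⁻ x, wtSeq B D i x ∂μ)
        = ∑ i ∈ Finset.range N, ∫⁻ x, (l * (B i).card) * wtSeq B D i x ∂μ := by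
          refine Finset.sum_congr rfl fun i _ => ?_
          rw [lintegral_const_mul _ (hw i), mul_assoc]
      _ ≤ ∑ i ∈ Finset.range N, ∫⁻ x, ∑ g ∈ B i, φ (g • x) * wtSeq B D i x ∂μ := by
          refine Finset.sum_le_sum fun i hi => lintegral_mono fun x => ?_
          by_cases hx : x ∈ D i
          · show _ ≤ ∑ g ∈ B i, φ (g • x) * wtSeq B D i x
            rw [← Finset.sum_mul]
            exact mul_le_mul_left (hl i (Finset.mem_range.1 hi) x hx) _
          · have : wtSeq B D i x = 0 := by
              unfold wtSeq wtStep; rw [if_neg]; exact fun h => hx h.1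
            simp [this]
      _ = ∫⁻ x, φ x * lamSeq B D N x ∂μ := by
          simp_rw [lamSeq_eq_sum, Finset.mul_sum]
          rw [lintegral_finsetSum']
          · refine Finset.sum_congr rfl fun i _ => ?_
            rw [lintegral_finsetSum', lintegral_finsetSum']
            · refine Finset.sum_congr rfl fun g _ => ?_
              exact cov g _ _ hφ (hw i)
            · intro b _
              exact (hφ.mul ((hw i).comp (hmeas _))).aemeasurable
            · intro b _
              exact ((hφ.comp (hmeas _)).mul (hw i)).aemeasurable
          · intro j _
            exact (Finset.measurable_sum _ fun b _ =>
              (hφ.mul ((hw j).comp (hmeas _)))).aemeasurable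
      _ ≤ ∫⁻ x, φ x * 2 ∂μ := lintegral_mono fun x => mul_le_mul_right (lamSeq_le_two _ _ _ _) _
      _ = _ := by rw [lintegral_mul_const _ hφ, mul_comm]
  calc _ ≤ l * (T + C * T) := by gcongr
    _ = (1 + C) * (l * T) := by ring
    _ ≤ (1 + C) * (2 * ∫⁻ x, φ x ∂μ) := by gcongr
    _ = _ := by ring

/-- Weak type (1,1) maximal inequality for tempered sequences. -/
lemma maximal_ineq (μ : Measure X)
    (hmp : ∀ g : G, MeasurePreserving (fun x : X => g • x) μ μ)
    (F : ℕ → Finset G) (hF : ∀ i, (F i).Nonempty) (C : ℝ≥0∞)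
    (hC : ∀ n, ((((Finset.range n).biUnion fun k => (F k)⁻¹ * F n).card : ℕ) : ℝ≥0∞)
      ≤ C * (F n).card)
    (φ : X → ℝ≥0∞) (hφ : Measurable φ) (l : ℝ≥0∞) :
    l * μ {x | ∃ n, l * (F n).card ≤ ∑ g ∈ F n, φ (g • x)} ≤ 2 * (1 + C) * ∫⁻ x, φ x ∂μ := by
  have hmeas : ∀ g : G, Measurable (fun x : X => g • x) := fun g => (hmp g).measurable
  set A : ℕ → Set X := fun n => {x | l * (F n).card ≤ ∑ g ∈ F n, φ (g • x)} with hA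
  have hAm : ∀ n, MeasurableSet (A n) := fun n =>
    measurableSet_le measurable_const (Finset.measurable_sum _ fun g _ => hφ.comp (hmeas g))
  have fin : ∀ N, l * μ (⋃ n ∈ Finset.range N, A n) ≤ 2 * (1 + C) * ∫⁻ x, φ x ∂μ := by
    intro N
    set B : ℕ → Finset G := fun i => F (N - 1 - i)
    set A' : ℕ → Set X := fun i => if i < N then A (N - 1 - i) else ∅ with hA'
    have hA'm : ∀ i, MeasurableSet (A' i) := by
      intro i; simp only [hA']; split_ifs
      · exact hAm _
      · exact MeasurableSet.empty
    have key := maximal_aux μ hmp B (fun i => hF _) (disjointed A')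
      (fun i => MeasurableSet.disjointed hA'm i)
      (disjoint_disjointed A') N C (by
        intro j hj
        refine le_trans ?_ (hC _)
        norm_cast
        refine Finset.card_le_card ?_
        intro c hc
        simp only [Finset.mem_biUnion, Finset.mem_Ioo, Finset.mem_range] at hc ⊢
        obtain ⟨i, hi, hci⟩ := hc
        exact ⟨N - 1 - i, by omega, hci⟩) φ hφ l (by
        intro i hi x hx
        have := disjointed_subset A' i hx
        simp only [hA', if_pos hi] at this
        exact this)
    refine le_trans ?_ key
    refine mul_le_mul_right ?_ _
    have : (⋃ n ∈ Finset.range N, A n) ⊆ ⋃ i ∈ Finset.range N, disjointed A' i := by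
      intro x hx
      simp only [mem_iUnion, Finset.mem_range] at hx ⊢
      obtain ⟨n, hn, hx⟩ := hx
      have hx' : x ∈ ⋃ i, A' i := by
        refine mem_iUnion.2 ⟨N - 1 - n, ?_⟩
        simp only [hA', if_pos (show N - 1 - n < N by omega)]
        rwa [show N - 1 - (N - 1 - n) = n by omega]
      rw [← iUnion_disjointed] at hx'
      obtain ⟨i, hi⟩ := mem_iUnion.1 hx'
      refine ⟨i, ?_, hi⟩
      by_contra hiN
      have := disjointed_subset A' i hi
      simp only [hA', if_neg hiN] at this
      exact this
    exact (measure_mono this).trans (measure_biUnion_finset_le _ _)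
  have hU : {x | ∃ n, l * (F n).card ≤ ∑ g ∈ F n, φ (g • x)} = ⋃ N, ⋃ n ∈ Finset.range N, A n := by
    ext x
    simp only [mem_setOf_eq, mem_iUnion, Finset.mem_range]
    constructor
    · rintro ⟨n, hn⟩; exact ⟨n + 1, n, by omega, hn⟩
    · rintro ⟨_, n, _, hn⟩; exact ⟨n, hn⟩
  rw [hU, Monotone.measure_iUnion, ENNReal.mul_iSup]
  · exact iSup_le fin
  · intro a b hab
    refine biUnion_subset_biUnion_left ?_
    intro n hn
    simp only [Finset.coe_range, mem_Iio, Finset.mem_range, Finset.mem_coe] at hn ⊢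
    exact lt_of_lt_of_le hn hab

end Maximal

section Ergodic

variable {G : Type*} [Group G] [DecidableEq G] {X : Type*} [MeasurableSpace X] [MulAction G X]

/-- Ergodic average. -/
noncomputable def ergAvg (F : Finset G) (f : X → ℝ) (x : X) : ℝ := (∑ g ∈ F, f (g • x)) / F.card

lemma ergAvg_cobound (F : Finset G) (f : X → ℝ) (M : ℝ) (hf : ∀ x, |f x| ≤ M) (h : G) (x : X) :
    |ergAvg F (fun z => f z - f (h • z)) x| ≤
      M * (((symmDiff F (F.image (h * ·))).card : ℝ) / F.card) := by
  unfold ergAvg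
  rw [abs_div, Nat.abs_cast, ← mul_div_assoc]
  refine div_le_div_of_nonneg_right ?_ (Nat.cast_nonneg _)
  have e : ∑ g ∈ F, f (h • g • x) = ∑ g ∈ F.image (h * ·), f (g • x) := by
    rw [Finset.sum_image]
    · simp [mul_smul]
    · intro a _ b _ hab; simpa using hab
  rw [Finset.sum_sub_distrib, e]
  set F' := F.image (h * ·)
  have e1 : ∑ g ∈ F, f (g • x) - ∑ g ∈ F', f (g • x)
      = ∑ g ∈ F \ F', f (g • x) - ∑ g ∈ F' \ F, f (g • x) := by
    rw [← Finset.sum_inter_add_sum_sdiff F F' , ← Finset.sum_inter_add_sum_sdiff F' F,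
      Finset.inter_comm F' F]; ring
  rw [e1]
  have hb : ∀ S : Finset G, |∑ g ∈ S, f (g • x)| ≤ M * S.card := by
    intro S
    refine (Finset.abs_sum_le_sum_abs _ _).trans ?_
    refine (Finset.sum_le_sum fun g _ => hf _).trans ?_
    simp [mul_comm]
  refine (abs_sub _ _).trans ((add_le_add (hb _) (hb _)).trans ?_)
  rw [← mul_add, ← Nat.cast_add, ← Finset.card_union_of_disjoint (disjoint_sdiff_sdiff)]
  exact le_of_eq rfl

set_option maxHeartbeats 1000000 in
theorem pointwise_ergodic [Countable G] (μ : Measure X) [IsProbabilityMeasure μ]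
    (hmp : ∀ g : G, MeasurePreserving (fun x : X => g • x) μ μ)
    (F : ℕ → Finset G) (hFol : IsFolnerSeq F) (hTemp : IsTemperedSeq F)
    (f : X → ℝ) (hf : Measurable f) (M : ℝ) (hM : ∀ x, |f x| ≤ M) :
    ∃ v : X → ℝ, Measurable v ∧ Integrable v μ ∧ (∀ g : G, (fun x => v (g • x)) =ᵐ[μ] v) ∧
      (∀ᵐ x ∂μ, Tendsto (fun n => ergAvg (F n) f x) atTop (𝓝 (v x))) ∧
      ∫ x, v x ∂μ = ∫ x, f x ∂μ := by
  have hmeas : ∀ g : G, Measurable (fun x : X => g • x) := fun g => (hmp g).measurable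
  have hfm : MemLp f 2 μ := MemLp.of_bound hf.aestronglyMeasurable M (ae_of_all _ hM)
  set f' : Lp ℝ 2 μ := hfm.toLp f
  -- generators
  set gen : Set (Lp ℝ 2 μ) := {u | ∃ (A : Set X) (hA : MeasurableSet A) (g : G),
    u = indicatorConstLp 2 hA (measure_ne_top μ A) (1 : ℝ) -
      indicatorConstLp 2 (hmeas g hA) (measure_ne_top μ _) (1 : ℝ)} with hgen
  set S := Submodule.span ℝ gen
  set K := S.topologicalClosure
  haveI : CompleteSpace K := (Submodule.isClosed_topologicalClosure S).completeSpace_coe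
  set pf : Lp ℝ 2 μ := K.starProjection f'
  set v' : Lp ℝ 2 μ := f' - pf
  have hv'K : v' ∈ Kᗮ := K.sub_starProjection_mem_orthogonal f'
  have hpfK : pf ∈ K := K.starProjection_apply_mem f'
  have hv'sm := Lp.stronglyMeasurable v'
  have hv'mem := Lp.memLp v'
  have hv'int : Integrable v' μ := hv'mem.integrable (by norm_num)
  -- invariance
  have hinv : ∀ g : G, (fun x => v' (g⁻¹ • x)) =ᵐ[μ] v' := by
    intro g
    refine Integrable.ae_eq_of_forall_setIntegral_eq _ _ ?_ hv'int ?_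
    · exact (hmp g⁻¹).integrable_comp_of_integrable hv'int
    · intro A hA _
      have hmem : (indicatorConstLp 2 hA (measure_ne_top μ A) (1 : ℝ) -
        indicatorConstLp 2 (hmeas g hA) (measure_ne_top μ _) (1 : ℝ) : Lp ℝ 2 μ) ∈ K :=
        Submodule.le_topologicalClosure _ (Submodule.subset_span ⟨A, hA, g, rfl⟩)
      have h0 := (Submodule.mem_orthogonal _ _).1 hv'K _ hmem
      rw [inner_sub_left, L2.inner_indicatorConstLp_one, L2.inner_indicatorConstLp_one] at h0
      have h1 : ∫ x in A, v' x ∂μ = ∫ x in (fun x => g • x) ⁻¹' A, v' x ∂μ := by linarith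
      rw [h1]
      have h2 := (hmp g⁻¹).setIntegral_preimage_emb
        (MeasurableEquiv.measurableEmbedding
          ({ toFun := fun x => g⁻¹ • x, invFun := fun x => g • x,
             left_inv := fun x => by simp, right_inv := fun x => by simp,
             measurable_toFun := hmeas _, measurable_invFun := hmeas _ } : X ≃ᵐ X))
        v' ((fun x => g • x) ⁻¹' A)
      rw [← h2]
      congr 2
      ext x; simp
  obtain ⟨C0, hC0⟩ := hTemp
  set C : ℝ≥0∞ := ENNReal.ofReal C0
  have hC : ∀ n, ((((Finset.range n).biUnion fun k => (F k)⁻¹ * F n).card : ℕ) : ℝ≥0∞)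
      ≤ C * (F n).card := by
    intro n
    have h := hC0 n
    have := ENNReal.ofReal_le_ofReal h
    rwa [ENNReal.ofReal_mul' (Nat.cast_nonneg _), ENNReal.ofReal_natCast,
      ENNReal.ofReal_natCast] at this
  have hall : ∀ {P : X → Prop}, (∀ᵐ x ∂μ, P x) → ∀ᵐ x ∂μ, ∀ g : G, P (g • x) := by
    intro P hP
    rw [ae_all_iff]
    intro g
    exact (hmp g).quasiMeasurePreserving.ae hP
  have hFol0 : ∀ g : G, Tendsto (fun n => 1 * (((symmDiff (F n) ((F n).image (g * ·))).card : ℝ)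
      / (F n).card)) atTop (𝓝 0) := by
    intro g
    have := (hFol.2 g).const_mul 1
    rwa [mul_zero] at this
  -- coboundaries
  have hcob : ∀ s ∈ S, ∀ᵐ x ∂μ, Tendsto (fun n => ergAvg (F n) s x) atTop (𝓝 0) := by
    intro s hs
    induction hs using Submodule.span_induction with
    | mem u hu =>
      obtain ⟨A, hA, g, rfl⟩ := hu
      have h1 := Lp.coeFn_sub (indicatorConstLp 2 hA (measure_ne_top μ A) (1 : ℝ))
        (indicatorConstLp 2 (hmeas g hA) (measure_ne_top μ _) (1 : ℝ))
      have h2 := indicatorConstLp_coeFn (p := 2) (hs := hA) (hμs := measure_ne_top μ A) (c := (1 : ℝ))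
      have h3 := indicatorConstLp_coeFn (p := 2) (hs := hmeas g hA)
        (hμs := measure_ne_top μ _) (c := (1 : ℝ))
      filter_upwards [hall h1, hall h2, hall h3] with x e1 e2 e3
      have e : ∀ n, ergAvg (F n) (↑↑(indicatorConstLp 2 hA (measure_ne_top μ A) (1 : ℝ) -
        indicatorConstLp 2 (hmeas g hA) (measure_ne_top μ _) (1 : ℝ) : Lp ℝ 2 μ) : X → ℝ) x
          = ergAvg (F n) (fun z => A.indicator (fun _ => (1:ℝ)) z -
              A.indicator (fun _ => (1:ℝ)) (g • z)) x := by
        intro n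
        unfold ergAvg
        congr 1
        refine Finset.sum_congr rfl fun h _ => ?_
        rw [e1 h, Pi.sub_apply, e2 h, e3 h]
        rfl
      simp_rw [e]
      refine squeeze_zero_norm (fun n => ?_) (hFol0 g)
      refine ergAvg_cobound (F n) _ 1 ?_ g x
      intro x
      by_cases hx : x ∈ A <;> simp [hx]
    | zero =>
      have := Lp.coeFn_zero ℝ 2 μ
      filter_upwards [hall this] with x hx
      have : ∀ n, ergAvg (F n) (↑↑(0 : Lp ℝ 2 μ) : X → ℝ) x = 0 := by
        intro n
        unfold ergAvg
        rw [Finset.sum_eq_zero, zero_div]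
        intro g _; rw [hx g]; rfl
      simp_rw [this]
      exact tendsto_const_nhds
    | add a b _ _ ha hb =>
      filter_upwards [hall (Lp.coeFn_add a b), ha, hb] with x hx ha hb
      have : ∀ n, ergAvg (F n) (↑↑(a + b) : X → ℝ) x = ergAvg (F n) a x + ergAvg (F n) b x := by
        intro n
        unfold ergAvg
        rw [← add_div, ← Finset.sum_add_distrib]
        congr 1
        refine Finset.sum_congr rfl fun h _ => ?_
        rw [hx h]; rfl
      simp_rw [this]
      simpa using ha.add hb
    | smul c a _ ha =>
      filter_upwards [hall (Lp.coeFn_smul c a), ha] with x hx ha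
      have : ∀ n, ergAvg (F n) (↑↑(c • a) : X → ℝ) x = c * ergAvg (F n) a x := by
        intro n
        unfold ergAvg
        rw [← mul_div_assoc, Finset.mul_sum]
        congr 1
        refine Finset.sum_congr rfl fun h _ => ?_
        rw [hx h]; rfl
      simp_rw [this]
      simpa using ha.const_mul c
  have hinv2 : ∀ g : G, (fun x => v' (g • x)) =ᵐ[μ] v' := fun g => by simpa using hinv g⁻¹
  -- main estimate
  have hmain : ∀ l : ℝ, 0 < l →
      ∀ᵐ x ∂μ, ∀ᶠ n in atTop, |ergAvg (F n) f x - v' x| < 2 * l := by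
    intro l hl
    have hbound : ∀ ε : ℝ, 0 < ε →
        ENNReal.ofReal l * μ {x | ¬ ∀ᶠ n in atTop, |ergAvg (F n) f x - v' x| < 2 * l}
          ≤ 2 * (1 + C) * ENNReal.ofReal ε := by
      intro ε hε
      obtain ⟨s, hsS, hs⟩ := Metric.mem_closure_iff.1
        (show pf ∈ closure (S : Set (Lp ℝ 2 μ)) from hpfK) ε hε
      set r : Lp ℝ 2 μ := pf - s
      have hr : ‖r‖ < ε := by rwa [dist_eq_norm] at hs
      have hrm : StronglyMeasurable (r : X → ℝ) := Lp.stronglyMeasurable r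
      have hmax := maximal_ineq μ hmp F hFol.1 C hC (fun x => ENNReal.ofReal |r x|)
        (hrm.measurable.abs.ennreal_ofReal) (ENNReal.ofReal l)
      have hL1 : ∫⁻ x, ENNReal.ofReal |r x| ∂μ ≤ ENNReal.ofReal ε := by
        have h1 : ∫⁻ x, ENNReal.ofReal |r x| ∂μ = eLpNorm r 1 μ := by
          rw [eLpNorm_one_eq_lintegral_enorm]
          refine lintegral_congr fun x => ?_
          rw [← Real.norm_eq_abs, ofReal_norm]
        rw [h1]
        refine (eLpNorm_le_eLpNorm_of_exponent_le (q := 2) (by norm_num)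
          hrm.aestronglyMeasurable).trans ?_
        rw [← ENNReal.ofReal_toReal (Lp.eLpNorm_ne_top r)]
        exact ENNReal.ofReal_le_ofReal (by rw [← Lp.norm_def]; exact hr.le)
      refine le_trans ?_ (hmax.trans (by gcongr))
      refine mul_le_mul_right (measure_mono_ae ?_) _
      have c1 : ∀ᵐ x ∂μ, f x = v' x + s x + r x := by
        have a1 := hfm.coeFn_toLp
        have a2 : f' = v' + s + r := by simp [v', r]
        have a3 := Lp.coeFn_add (v' + s) r
        have a4 := Lp.coeFn_add v' s
        rw [← a2] at a3
        filter_upwards [a1, a3, a4] with x b1 b3 b4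
        rw [← b1]
        show (f' : X → ℝ) x = _
        rw [b3, Pi.add_apply, b4, Pi.add_apply]
      have c2 : ∀ᵐ x ∂μ, ∀ g : G, v' (g • x) = v' x := by
        rw [ae_all_iff]; exact hinv2
      filter_upwards [hall c1, c2, hcob s hsS] with x d1 d2 d3 hx
      by_contra hnot
      apply hx
      have hnot' : ∀ n, |ergAvg (F n) r x| < l := by
        intro n
        by_contra hcon
        push Not at hcon
        apply hnot
        refine ⟨n, ?_⟩
        have hpos : (0:ℝ) < (F n).card := by exact_mod_cast (hFol.1 n).card_pos
        have h5 : l * (F n).card ≤ ∑ g ∈ F n, |r (g • x)| := by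
          unfold ergAvg at hcon
          rw [abs_div, Nat.abs_cast, le_div_iff₀ hpos] at hcon
          exact hcon.trans (Finset.abs_sum_le_sum_abs _ _)
        have h6 := ENNReal.ofReal_le_ofReal h5
        rw [ENNReal.ofReal_mul hl.le, ENNReal.ofReal_natCast,
          ENNReal.ofReal_sum_of_nonneg (fun g _ => abs_nonneg _)] at h6
        exact h6
      have h7 : ∀ᶠ n in atTop, |ergAvg (F n) s x| < l := by
        have := (tendsto_order.1 d3.abs).2 l (by simpa using hl)
        exact this
      filter_upwards [h7] with n h7
      have hpos : (0:ℝ) < (F n).card := by exact_mod_cast (hFol.1 n).card_pos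
      have h8 : ergAvg (F n) f x - v' x = ergAvg (F n) s x + ergAvg (F n) r x := by
        unfold ergAvg
        rw [Finset.sum_congr rfl (fun g _ => d1 g), Finset.sum_add_distrib, Finset.sum_add_distrib,
          Finset.sum_congr rfl (fun g _ => d2 g)]
        rw [Finset.sum_const, nsmul_eq_mul]
        rw [add_div, add_div, mul_div_cancel_left₀ _ hpos.ne']
        ring
      rw [h8]
      refine (abs_add_le _ _).trans_lt ?_
      linarith [hnot' n]
    have hz : ENNReal.ofReal l * μ {x | ¬ ∀ᶠ n in atTop, |ergAvg (F n) f x - v' x| < 2 * l} = 0 := by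
      refine le_antisymm ?_ bot_le
      have ht : Tendsto (fun ε : ℝ => 2 * (1 + C) * ENNReal.ofReal ε) (𝓝[>] 0) (𝓝 0) := by
        have h1 : Tendsto (fun ε : ℝ => ENNReal.ofReal ε) (𝓝[>] 0) (𝓝 0) := by
          have := (ENNReal.continuous_ofReal.tendsto 0).mono_left
            (nhdsWithin_le_nhds (s := Ioi (0:ℝ)))
          simpa using this
        have := ENNReal.Tendsto.const_mul h1 (a := 2 * (1 + C)) (Or.inr (by
          simp [C, ENNReal.mul_eq_top]))
        simpa using this
      refine ge_of_tendsto ht ?_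
      filter_upwards [self_mem_nhdsWithin] with ε hε
      exact hbound ε hε
    have hl0 : ENNReal.ofReal l ≠ 0 := by simpa using hl
    exact (mul_eq_zero.1 hz).resolve_left hl0
  have hconv : ∀ᵐ x ∂μ, Tendsto (fun n => ergAvg (F n) f x) atTop (𝓝 (v' x)) := by
    have : ∀ᵐ x ∂μ, ∀ j : ℕ, ∀ᶠ n in atTop,
        |ergAvg (F n) f x - v' x| < 2 * (1 / ((j : ℝ) + 1)) := by
      rw [ae_all_iff]
      intro j
      exact hmain _ (by positivity)
    filter_upwards [this] with x hx
    rw [Metric.tendsto_atTop']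
    intro ε hε
    obtain ⟨j, hj⟩ := exists_nat_one_div_lt (show (0:ℝ) < ε / 2 by positivity)
    obtain ⟨N, hN⟩ := eventually_atTop.1 (hx j)
    refine ⟨N, fun n hn => ?_⟩
    rw [Real.dist_eq]
    have := hN n hn.le
    linarith
  refine ⟨v', hv'sm.measurable, hv'int, hinv2, hconv, ?_⟩
  -- the integral
  have hMnn : 0 ≤ M := by
    obtain ⟨x⟩ : Nonempty X := by
      by_contra h
      rw [not_nonempty_iff] at h
      have := measure_univ (μ := μ)
      rw [Set.univ_eq_empty_iff.2 h] at this
      simp at this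
    exact (abs_nonneg _).trans (hM x)
  have hmA : ∀ n, Measurable (ergAvg (F n) f) := fun n =>
    (Finset.measurable_sum _ fun g _ => hf.comp (hmeas g)).div_const _
  have hfint : Integrable f μ := hfm.integrable (by norm_num)
  have hlim := tendsto_integral_of_dominated_convergence (μ := μ) (fun _ => M)
    (F := fun n => ergAvg (F n) f) (f := v')
    (fun n => (hmA n).aestronglyMeasurable) (integrable_const _) (fun n => ae_of_all _ fun x => by
      have hpos : (0:ℝ) < (F n).card := by exact_mod_cast (hFol.1 n).card_pos
      unfold ergAvg
      rw [Real.norm_eq_abs, abs_div, Nat.abs_cast, div_le_iff₀ hpos]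
      refine (Finset.abs_sum_le_sum_abs _ _).trans ?_
      refine (Finset.sum_le_sum fun g _ => hM _).trans ?_
      simp [mul_comm]) hconv
  have hconst : ∀ n, ∫ x, ergAvg (F n) f x ∂μ = ∫ x, f x ∂μ := by
    intro n
    have hpos : (0:ℝ) < (F n).card := by exact_mod_cast (hFol.1 n).card_pos
    unfold ergAvg
    rw [integral_div, integral_finsetSum]
    · have : ∀ g : G, ∫ x, f (g • x) ∂μ = ∫ x, f x ∂μ := by
        intro g
        have h1 := integral_map (μ := μ) (hmeas g).aemeasurable (f := f) hf.aestronglyMeasurable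
        rw [(hmp g).map_eq] at h1
        exact h1.symm
      simp_rw [this]
      rw [Finset.sum_const, nsmul_eq_mul]
      field_simp
    · intro g _
      exact (hmp g).integrable_comp_of_integrable hfint
  simp_rw [hconst] at hlim
  exact tendsto_nhds_unique hlim tendsto_const_nhds

theorem pointwise_ergodic_const [Countable G] (μ : Measure X) [IsProbabilityMeasure μ]
    (hmp : ∀ g : G, MeasurePreserving (fun x : X => g • x) μ μ) (herg : ErgodicMeasure G μ)
    (F : ℕ → Finset G) (hFol : IsFolnerSeq F) (hTemp : IsTemperedSeq F)
    (f : X → ℝ) (hf : Measurable f) (M : ℝ) (hM : ∀ x, |f x| ≤ M) :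
    ∀ᵐ x ∂μ, Tendsto (fun n => ergAvg (F n) f x) atTop (𝓝 (∫ x, f x ∂μ)) := by
  obtain ⟨v, hvm, hvi, hinv, hconv, hIntEq⟩ := pointwise_ergodic μ hmp F hFol hTemp f hf M hM
  have htriv : ∀ A : Set ℝ, MeasurableSet A → μ (v ⁻¹' A) = 0 ∨ μ (v ⁻¹' A) = 1 := by
    intro A hA
    refine herg _ (hvm hA) fun g => ?_
    rw [measure_symmDiff_eq_zero_iff]
    filter_upwards [hinv g] with x hx
    refine propext ?_
    show v x ∈ A ↔ v (g • x) ∈ A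
    rw [hx]
  have hle : ∀ᵐ x ∂μ, v x = ∫ z, v z ∂μ := by
    set c := ∫ z, v z ∂μ
    -- if `{v < c}` has full measure then the integral is less than `c`
    have h1 : μ (v ⁻¹' (Iio c)) = 0 := by
      rcases htriv _ measurableSet_Iio with h | h
      · exact h
      · exfalso
        have hae : ∀ᵐ x ∂μ, v x < c :=
          (prob_compl_eq_zero_iff (hvm measurableSet_Iio)).2 h
        have h0 : ∫ x, (c - v x) ∂μ = 0 := by
          rw [integral_sub (integrable_const _) hvi]; simp [c]
        have h2 := (integral_eq_zero_iff_of_nonneg_ae (by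
          filter_upwards [hae] with x hx
          simpa using hx.le) ((integrable_const _).sub hvi)).1 h0
        have : ∀ᵐ x ∂μ, False := by
          filter_upwards [hae, h2] with x a b
          simp only [Pi.zero_apply, Pi.sub_apply] at b
          linarith
        exact this.exists.elim fun _ h => h
    have h1' : μ (v ⁻¹' (Ioi c)) = 0 := by
      rcases htriv _ measurableSet_Ioi with h | h
      · exact h
      · exfalso
        have hae : ∀ᵐ x ∂μ, c < v x :=
          (prob_compl_eq_zero_iff (hvm measurableSet_Ioi)).2 h
        have h0 : ∫ x, (v x - c) ∂μ = 0 := by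
          rw [integral_sub hvi (integrable_const _)]; simp [c]
        have h2 := (integral_eq_zero_iff_of_nonneg_ae (by
          filter_upwards [hae] with x hx
          simpa using hx.le) (hvi.sub (integrable_const _))).1 h0
        have : ∀ᵐ x ∂μ, False := by
          filter_upwards [hae, h2] with x a b
          simp only [Pi.zero_apply, Pi.sub_apply] at b
          linarith
        exact this.exists.elim fun _ h => h
    have a1 : ∀ᵐ x ∂μ, ¬ v x < c := by
      rw [ae_iff]; simp only [not_not]; exact h1
    have a2 : ∀ᵐ x ∂μ, ¬ c < v x := by
      rw [ae_iff]; simp only [not_not]; exact h1'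
    filter_upwards [a1, a2] with x b1 b2
    exact le_antisymm (not_lt.1 b2) (not_lt.1 b1)
  filter_upwards [hle, hconv] with x h1 h2
  rwa [h1, hIntEq] at h2

end Ergodic

section Cyl

variable {G : Type*} [Group G] [DecidableEq G] {X : Type*} [MeasurableSpace X] [MulAction G X]
  {k : ℕ}

/-- The name (configuration) of a point. -/
def cfg (α : X → Fin k) (x : X) : G → Fin k := fun g => α (g • x)

/-- Measure of the cylinder given by `c` over `S`. -/
noncomputable def cylM (μ : Measure X) (α : X → Fin k) (S : Finset G) (c : G → Fin k) : ℝ≥0∞ :=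
  μ {z | ∀ g ∈ S, α (g • z) = c g}

/-- Extension of a finite pattern. -/
def extPat (c₀ : G → Fin k) (T : Finset G) (w : T → Fin k) : G → Fin k :=
  fun g => if h : g ∈ T then w ⟨g, h⟩ else c₀ g

lemma cylM_congr (μ : Measure X) (α : X → Fin k) (S : Finset G) {c c' : G → Fin k}
    (h : ∀ g ∈ S, c g = c' g) : cylM μ α S c = cylM μ α S c' := by
  unfold cylM
  congr 1
  ext z
  exact forall₂_congr fun g hg => by rw [h g hg]

lemma cylM_le_one (μ : Measure X) [IsProbabilityMeasure μ] (α : X → Fin k) (S : Finset G)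
    (c : G → Fin k) : cylM μ α S c ≤ 1 := prob_le_one

lemma cylM_ne_top (μ : Measure X) [IsProbabilityMeasure μ] (α : X → Fin k) (S : Finset G)
    (c : G → Fin k) : cylM μ α S c ≠ ⊤ := measure_ne_top _ _

lemma cylM_empty (μ : Measure X) [IsProbabilityMeasure μ] (α : X → Fin k)
    (c : G → Fin k) : cylM μ α ∅ c = 1 := by
  simp [cylM]

lemma cylM_anti (μ : Measure X) (α : X → Fin k) {S S' : Finset G} (h : S ⊆ S')
    (c : G → Fin k) : cylM μ α S' c ≤ cylM μ α S c :=
  measure_mono fun _ hz g hg => hz g (h hg)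

lemma measurableSet_cyl (hmeas : ∀ g : G, Measurable (fun x : X => g • x)) {α : X → Fin k}
    (hα : Measurable α) (S : Finset G) (c : G → Fin k) :
    MeasurableSet {z : X | ∀ g ∈ S, α (g • z) = c g} := by
  have : {z : X | ∀ g ∈ S, α (g • z) = c g} = ⋂ g ∈ S, (fun z => α (g • z)) ⁻¹' {c g} := by
    ext z; simp
  rw [this]
  exact Finset.measurableSet_biInter _ fun g _ => (hα.comp (hmeas g)) (measurableSet_singleton _)

lemma cyl_insert {α : X → Fin k} (T : Finset G) (g : G) (hg : g ∉ T) (c : G → Fin k) (a : Fin k) :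
    {z : X | ∀ h ∈ insert g T, α (h • z) = Function.update c g a h} =
      {z | ∀ h ∈ T, α (h • z) = c h} ∩ {z | α (g • z) = a} := by
  ext z
  simp only [Finset.mem_insert, forall_eq_or_imp, Function.update_self]
  show (α (g • z) = a ∧ _) ↔ (_ ∧ α (g • z) = a)
  rw [and_comm]
  refine and_congr_left fun _ => forall₂_congr fun h hh => ?_
  rw [Function.update_of_ne]
  rintro rfl; exact hg hh

lemma cylM_sum (hmeas : ∀ g : G, Measurable (fun x : X => g • x)) {α : X → Fin k}
    (hα : Measurable α) (μ : Measure X) (T : Finset G) (g : G) (hg : g ∉ T) (c : G → Fin k) :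
    ∑ a, cylM μ α (insert g T) (Function.update c g a) = cylM μ α T c := by
  unfold cylM
  simp_rw [cyl_insert T g hg c]
  rw [← measure_biUnion_finset]
  · congr 1
    ext z; simp
  · intro a _ b _ hab
    refine Set.disjoint_left.2 fun z hz hz' => hab ?_
    exact hz.2.symm.trans hz'.2
  · intro a _
    exact (measurableSet_cyl hmeas hα T c).inter ((hα.comp (hmeas g)) (measurableSet_singleton a))

lemma measurable_dep {β : Type*} [MeasurableSpace β]
    (hmeas : ∀ g : G, Measurable (fun x : X => g • x)) {α : X → Fin k}
    (hα : Measurable α) (T : Finset G) {ψ : (G → Fin k) → β} (hψ : DependsOn ψ (T : Set G)) :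
    Measurable (fun x : X => ψ (cfg α x)) := by
  rcases isEmpty_or_nonempty X with hX | ⟨⟨x0⟩⟩
  · exact measurable_of_empty _
  have h1 : (fun x : X => ψ (cfg α x)) =
      (fun w : T → Fin k => ψ (extPat (cfg α x0) T w)) ∘ (fun x : X => fun g : T => α ((g : G) • x)) := by
    ext x
    refine hψ fun g hg => ?_
    have hg' : g ∈ T := hg
    simp [extPat, hg', cfg]
  rw [h1]
  refine (measurable_of_countable _).comp ?_
  rw [measurable_pi_iff]
  exact fun g => hα.comp (hmeas _)

lemma lintegral_dep (hmeas : ∀ g : G, Measurable (fun x : X => g • x)) {α : X → Fin k}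
    (hα : Measurable α) (ν : Measure X) (c₀ : G → Fin k) (T : Finset G)
    {ψ : (G → Fin k) → ℝ≥0∞} (hψ : DependsOn ψ (T : Set G)) :
    ∫⁻ x, ψ (cfg α x) ∂ν = ∑ w : T → Fin k, ψ (extPat c₀ T w) * cylM ν α T (extPat c₀ T w) := by
  set Φ : X → (T → Fin k) := fun x g => α ((g : G) • x)
  have hΦ : Measurable Φ := by
    rw [measurable_pi_iff]
    exact fun g => hα.comp (hmeas _)
  have h1 : ∀ x : X, ψ (cfg α x) = (fun w : T → Fin k => ψ (extPat c₀ T w)) (Φ x) := by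
    intro x
    refine hψ fun g hg => ?_
    have hg' : g ∈ T := hg
    simp [extPat, hg', cfg, Φ]
  simp_rw [h1]
  rw [← lintegral_map (μ := ν) (f := fun w : T → Fin k => ψ (extPat c₀ T w)) (g := Φ)
    (measurable_of_countable _) hΦ, lintegral_fintype]
  refine Finset.sum_congr rfl fun w _ => ?_
  rw [Measure.map_apply hΦ (measurableSet_singleton _)]
  congr 1
  unfold cylM
  congr 1
  ext z
  simp only [mem_preimage, mem_singleton_iff, funext_iff, Subtype.forall, Φ]
  refine forall₂_congr fun g hg => ?_
  simp [extPat, hg]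

lemma ae_cylM_ne_zero [Countable G] (hmeas : ∀ g : G, Measurable (fun x : X => g • x))
    {α : X → Fin k} (hα : Measurable α) (μ : Measure X) [IsProbabilityMeasure μ] :
    ∀ᵐ x ∂μ, ∀ S : Finset G, cylM μ α S (cfg α x) ≠ 0 := by
  rw [ae_all_iff]
  intro S
  obtain ⟨x0⟩ : Nonempty X := nonempty_of_isProbabilityMeasure μ
  have hd : DependsOn (fun c : G → Fin k => if cylM μ α S c = 0 then (1 : ℝ≥0∞) else 0)
      (S : Set G) := by
    intro c c' h
    simp only []
    rw [cylM_congr μ α S h]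
  have h0 := lintegral_dep hmeas hα μ (cfg α x0) S hd
  rw [Finset.sum_eq_zero] at h0
  · rw [lintegral_eq_zero_iff (measurable_dep hmeas hα S hd)] at h0
    filter_upwards [h0] with x hx h
    simp [h] at hx
  · intro w _
    by_cases h : cylM μ α S (extPat (cfg α x0) S w) = 0 <;> simp [h]

lemma lintegral_fiber (hmeas : ∀ g : G, Measurable (fun x : X => g • x)) {α : X → Fin k}
    (hα : Measurable α) (μ : Measure X) [IsProbabilityMeasure μ] (T : Finset G) (g : G) (hg : g ∉ T)
    (a : Fin k) {ψ : (G → Fin k) → ℝ≥0∞} (hψ : DependsOn ψ (T : Set G)) :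
    ∫⁻ x in {z | α (g • z) = a}, ψ (cfg α x) ∂μ =
      ∫⁻ x, ψ (cfg α x) * (cylM μ α (insert g T) (Function.update (cfg α x) g a)
        / cylM μ α T (cfg α x)) ∂μ := by
  obtain ⟨x0⟩ : Nonempty X := nonempty_of_isProbabilityMeasure μ
  rw [lintegral_dep hmeas hα _ (cfg α x0) T hψ]
  have hd : DependsOn (fun c : G → Fin k => ψ c * (cylM μ α (insert g T) (Function.update c g a)
        / cylM μ α T c)) (T : Set G) := by
    intro c c' h
    simp only []
    rw [hψ h, cylM_congr μ α T h]
    congr 2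
    refine cylM_congr _ _ _ fun h' hh' => ?_
    by_cases e : h' = g
    · simp [e]
    · simp only [Function.update_of_ne e]
      exact h h' ((Finset.mem_insert.1 hh').resolve_left e)
  rw [lintegral_dep hmeas hα μ (cfg α x0) T hd]
  refine Finset.sum_congr rfl fun w _ => ?_
  have e1 : cylM (μ.restrict {z | α (g • z) = a}) α T (extPat (cfg α x0) T w) =
      cylM μ α (insert g T) (Function.update (extPat (cfg α x0) T w) g a) := by
    unfold cylM
    rw [cyl_insert T g hg, Measure.restrict_apply (measurableSet_cyl hmeas hα _ _)]
  rw [e1, mul_assoc]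
  congr 1
  by_cases h0 : cylM μ α T (extPat (cfg α x0) T w) = 0
  · rw [h0, mul_zero]
    refine le_antisymm ?_ bot_le
    rw [← h0]
    unfold cylM
    rw [cyl_insert T g hg]
    exact measure_mono inter_subset_left
  · rw [ENNReal.div_mul_cancel h0 (cylM_ne_top _ _ _ _)]

lemma update_cfg_eq {α : X → Fin k} {x : X} {g : G} {a : Fin k} (h : α (g • x) = a) :
    Function.update (cfg α x) g a = cfg α x := by
  rw [Function.update_eq_self_iff]; exact h.symm

/-- Supermartingale step. -/
lemma supermart_step (hmeas : ∀ g : G, Measurable (fun x : X => g • x)) {α : X → Fin k}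
    (hα : Measurable α) (μ : Measure X) [IsProbabilityMeasure μ] (T : Finset G) (g : G) (hg : g ∉ T)
    {R u : (G → Fin k) → ℝ≥0∞} (hR : DependsOn R (T : Set G))
    (hu : DependsOn u ((insert g T : Finset G) : Set G))
    (hsum : ∀ c, ∑ a, u (Function.update c g a) ≤ 1) :
    ∫⁻ x, R (cfg α x) * (u (cfg α x) *
      (cylM μ α T (cfg α x) / cylM μ α (insert g T) (cfg α x))) ∂μ ≤ ∫⁻ x, R (cfg α x) ∂μ := by
  have upd : ∀ {c c' : G → Fin k} (a : Fin k), (∀ i ∈ (T : Set G), c i = c' i) →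
      ∀ i ∈ insert g T, Function.update c g a i = Function.update c' g a i := by
    intro c c' a h h' hh'
    by_cases e : h' = g
    · simp [e]
    · simp only [Function.update_of_ne e]
      exact h h' ((Finset.mem_insert.1 hh').resolve_left e)
  set ψ : Fin k → (G → Fin k) → ℝ≥0∞ := fun a c => R c * (u (Function.update c g a) *
      (cylM μ α T c / cylM μ α (insert g T) (Function.update c g a))) with hψ
  have hψd : ∀ a, DependsOn (ψ a) (T : Set G) := by
    intro a c c' h
    simp only [hψ]
    rw [hR h, cylM_congr μ α T h, cylM_congr μ α (insert g T) (upd a h),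
      hu (x := Function.update c g a) (y := Function.update c' g a) (fun i hi => upd a h i hi)]
  set f : X → ℝ≥0∞ := fun x => R (cfg α x) * (u (cfg α x) *
      (cylM μ α T (cfg α x) / cylM μ α (insert g T) (cfg α x)))
  have hms : ∀ a, MeasurableSet {z : X | α (g • z) = a} := fun a =>
    (hα.comp (hmeas g)) (measurableSet_singleton a)
  have e1 : ∫⁻ x, f x ∂μ = ∑ a, ∫⁻ x in {z | α (g • z) = a}, f x ∂μ := by
    have hU : (⋃ a ∈ (Finset.univ : Finset (Fin k)), {z : X | α (g • z) = a}) = univ := by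
      ext z; simp
    rw [← setLIntegral_univ, ← hU, lintegral_biUnion_finset]
    · intro a _ b _ hab
      exact Set.disjoint_left.2 fun z hz hz' => hab (hz.symm.trans hz')
    · exact fun a _ => hms a
  have e2 : ∀ a, ∫⁻ x in {z | α (g • z) = a}, f x ∂μ = ∫⁻ x in {z | α (g • z) = a}, ψ a (cfg α x) ∂μ := by
    intro a
    refine setLIntegral_congr_fun (hms a) fun x hx => ?_
    simp only [f, hψ]
    rw [update_cfg_eq hx]
  rw [e1]
  simp_rw [e2]
  have e3 : ∀ a, ∫⁻ x in {z | α (g • z) = a}, ψ a (cfg α x) ∂μ ≤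
      ∫⁻ x, R (cfg α x) * u (Function.update (cfg α x) g a) ∂μ := by
    intro a
    rw [lintegral_fiber hmeas hα μ T g hg a (hψd a)]
    refine lintegral_mono fun x => ?_
    simp only [hψ]
    set p := cylM μ α T (cfg α x) with hp
    set q := cylM μ α (insert g T) (Function.update (cfg α x) g a) with hq
    have hpq : p / q * (q / p) ≤ 1 := by
      rcases eq_or_ne p 0 with h | h
      · simp [h]
      rcases eq_or_ne q 0 with h' | h'
      · simp [h']
      rw [ENNReal.div_eq_inv_mul, ENNReal.div_eq_inv_mul,
        show q⁻¹ * p * (p⁻¹ * q) = (q⁻¹ * q) * (p * p⁻¹) by ring,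
        ENNReal.mul_inv_cancel h (cylM_ne_top _ _ _ _),
        ENNReal.inv_mul_cancel h' (cylM_ne_top _ _ _ _), one_mul]
    calc _ = R (cfg α x) * u (Function.update (cfg α x) g a) * (p / q * (q / p)) := by ring
      _ ≤ R (cfg α x) * u (Function.update (cfg α x) g a) * 1 := by gcongr
      _ = _ := mul_one _
  refine (Finset.sum_le_sum fun a _ => e3 a).trans ?_
  rw [← lintegral_finsetSum']
  · refine lintegral_mono fun x => ?_
    show ∑ a, R (cfg α x) * u (Function.update (cfg α x) g a) ≤ _
    rw [← Finset.mul_sum]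
    exact mul_le_of_le_one_right' (hsum _)
  · intro a _
    refine (measurable_dep hmeas hα T (ψ := fun c => R c * u (Function.update c g a)) ?_).aemeasurable
    intro c c' h
    simp only []
    rw [hR h, hu (x := Function.update c g a) (y := Function.update c' g a) (fun i hi => upd a h i hi)]

lemma dependsOn_cylM (μ : Measure X) (α : X → Fin k) {S T : Finset G} (h : S ⊆ T) :
    DependsOn (cylM μ α S) (T : Set G) :=
  fun _ _ hc => cylM_congr μ α S fun g hg => hc g (h hg)

/-- Elements of `S` before `g`. -/
def before {Λ : Type*} [LinearOrder Λ] (ω : G → Λ) (S : Finset G) (g : G) : Finset G :=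
  S.filter fun v => ω v < ω g

lemma before_insert_of_le {Λ : Type*} [LinearOrder Λ] (ω : G → Λ) (s : Finset G) {a g : G}
    (h : ω g ≤ ω a) : before ω (insert a s) g = before ω s g := by
  unfold before
  rw [Finset.filter_insert, if_neg (not_lt.2 h)]

lemma before_insert_max {Λ : Type*} [LinearOrder Λ] (ω : G → Λ) (s : Finset G) {a : G}
    (h : ∀ x ∈ s, ω x < ω a) : before ω (insert a s) a = s := by
  rw [before_insert_of_le ω s le_rfl]
  exact Finset.filter_true_of_mem h

lemma lt_of_inj_max {Λ : Type*} [LinearOrder Λ] {ω : G → Λ} (hω : Function.Injective ω)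
    {s : Finset G} {a : G} (ha : a ∉ s) (h : ∀ x ∈ s, ω x ≤ ω a) : ∀ x ∈ s, ω x < ω a := by
  intro x hx
  refine lt_of_le_of_ne (h x hx) fun e => ha ?_
  rw [← hω e]; exact hx

/-- Lower-bound density estimate. -/
lemma lower_density (hmeas : ∀ g : G, Measurable (fun x : X => g • x)) {α : X → Fin k}
    (hα : Measurable α) (μ : Measure X) [IsProbabilityMeasure μ] {Λ : Type*} [LinearOrder Λ]
    (ω : G → Λ) (hω : Function.Injective ω) (F W : Finset G) :
    ∫⁻ x, cylM μ α (F ∩ W) (cfg α x) * ∏ g ∈ F ∩ W, (cylM μ α (before ω W g) (cfg α x) /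
      cylM μ α (insert g (before ω W g)) (cfg α x)) ∂μ ≤ 1 := by
  induction W using Finset.induction_on_max_value ω with
  | empty => simp [cylM_empty]
  | insert a s ha hmax ih =>
    have hlt := lt_of_inj_max hω ha hmax
    by_cases haF : a ∈ F
    · have e1 : F ∩ insert a s = insert a (F ∩ s) := Finset.inter_insert_of_mem haF
      have ha' : a ∉ F ∩ s := fun h => ha (Finset.mem_inter.1 h).2
      refine le_trans ?_ ih
      have hR : DependsOn (fun c => cylM μ α (F ∩ s) c * ∏ g ∈ F ∩ s, (cylM μ α (before ω s g) c /
          cylM μ α (insert g (before ω s g)) c)) (s : Set G) := by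
        intro c c' h
        simp only []
        rw [dependsOn_cylM μ α (Finset.inter_subset_right) h]
        congr 1
        refine Finset.prod_congr rfl fun g hg => ?_
        rw [dependsOn_cylM μ α (S := before ω s g) (T := s) (Finset.filter_subset _ _) h,
          dependsOn_cylM μ α (T := s) (S := insert g (before ω s g)) ?_ h]
        refine Finset.insert_subset (Finset.mem_inter.1 hg).2 (Finset.filter_subset _ _)
      have hu : DependsOn (fun c => cylM μ α (insert a (F ∩ s)) c / cylM μ α (F ∩ s) c)
          ((insert a s : Finset G) : Set G) := by
        intro c c' h
        simp only []
        rw [dependsOn_cylM μ α (Finset.insert_subset_insert _ Finset.inter_subset_right) h,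
          dependsOn_cylM μ α (Finset.inter_subset_right.trans (Finset.subset_insert _ _)) h]
      have := supermart_step hmeas hα μ s a ha hR hu (by
        intro c
        have h1 : ∀ b, cylM μ α (F ∩ s) (Function.update c a b) = cylM μ α (F ∩ s) c := by
          intro b
          refine cylM_congr _ _ _ fun g hg => ?_
          rw [Function.update_of_ne]
          rintro rfl; exact ha' hg
        simp_rw [h1, div_eq_mul_inv]
        rw [← Finset.sum_mul, cylM_sum hmeas hα μ _ a ha', ← div_eq_mul_inv]
        exact ENNReal.div_self_le_one)
      refine le_trans (le_of_eq ?_) this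
      refine lintegral_congr fun x => ?_
      rw [e1, Finset.prod_insert ha', before_insert_max ω s hlt]
      have e2 : ∏ g ∈ F ∩ s, (cylM μ α (before ω (insert a s) g) (cfg α x) /
          cylM μ α (insert g (before ω (insert a s) g)) (cfg α x)) =
          ∏ g ∈ F ∩ s, (cylM μ α (before ω s g) (cfg α x) /
          cylM μ α (insert g (before ω s g)) (cfg α x)) := by
        refine Finset.prod_congr rfl fun g hg => ?_
        rw [before_insert_of_le ω s (hmax g (Finset.mem_inter.1 hg).2)]
      rw [e2]
      have e3 : cylM μ α (insert a (F ∩ s)) (cfg α x) = cylM μ α (F ∩ s) (cfg α x) *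
          (cylM μ α (insert a (F ∩ s)) (cfg α x) / cylM μ α (F ∩ s) (cfg α x)) := by
        by_cases h0 : cylM μ α (F ∩ s) (cfg α x) = 0
        · have := cylM_anti μ α (Finset.subset_insert a (F ∩ s)) (cfg α x)
          rw [h0] at this ⊢
          simpa using this
        · rw [ENNReal.mul_div_cancel h0 (cylM_ne_top _ _ _ _)]
      conv_lhs => rw [e3]
      ring
    · rw [Finset.inter_insert_of_notMem haF]
      refine le_trans (le_of_eq (lintegral_congr fun x => ?_)) ih
      congr 1
      refine Finset.prod_congr rfl fun g hg => ?_
      rw [before_insert_of_le ω s (hmax g (Finset.mem_inter.1 hg).2)]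

/-- Upper-bound density estimate. -/
lemma upper_density [Countable G] (hmeas : ∀ g : G, Measurable (fun x : X => g • x)) {α : X → Fin k}
    (hα : Measurable α) (μ : Measure X) [IsProbabilityMeasure μ] {Λ : Type*} [LinearOrder Λ]
    (ω : G → Λ) (hω : Function.Injective ω) (u : G → (G → Fin k) → ℝ≥0∞)
    (hsum : ∀ g c, ∑ a, u g (Function.update c g a) ≤ 1) (F : Finset G)
    (hu : ∀ g ∈ F, DependsOn (u g) ((insert g (before ω F g) : Finset G) : Set G)) :
    ∫⁻ x, (∏ g ∈ F, u g (cfg α x)) / cylM μ α F (cfg α x) ∂μ ≤ 1 := by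
  induction F using Finset.induction_on_max_value ω with
  | empty => simp [cylM_empty]
  | insert a s ha hmax ih =>
    have hlt := lt_of_inj_max hω ha hmax
    have hus : ∀ g ∈ s, DependsOn (u g) ((insert g (before ω s g) : Finset G) : Set G) := by
      intro g hg
      have := hu g (Finset.mem_insert_of_mem hg)
      rwa [before_insert_of_le ω s (hmax g hg)] at this
    have hua := hu a (Finset.mem_insert_self _ _)
    rw [before_insert_max ω s hlt] at hua
    refine le_trans ?_ (ih hus)
    have hR : DependsOn (fun c => (∏ g ∈ s, u g c) / cylM μ α s c) (s : Set G) := by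
      intro c c' h
      simp only []
      rw [dependsOn_cylM μ α (Finset.Subset.refl s) h]
      congr 1
      refine Finset.prod_congr rfl fun g hg => ?_
      refine hus g hg fun i hi => h i ?_
      have hi' : i ∈ insert g (before ω s g) := hi
      rcases Finset.mem_insert.1 hi' with rfl | hi'
      · exact hg
      · exact Finset.filter_subset _ _ hi'
    have := supermart_step hmeas hα μ s a ha hR hua (hsum a)
    refine le_trans (le_of_eq ?_) this
    refine lintegral_congr_ae ?_
    filter_upwards [ae_cylM_ne_zero hmeas hα μ] with x hx
    rw [Finset.prod_insert ha]
    have h0 := hx s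
    have h1 := cylM_ne_top μ α s (cfg α x)
    set P := ∏ g ∈ s, u g (cfg α x)
    set q := cylM μ α s (cfg α x)
    calc u a (cfg α x) * P / cylM μ α (insert a s) (cfg α x)
        = u a (cfg α x) * P / cylM μ α (insert a s) (cfg α x) * (q⁻¹ * q) := by
          rw [ENNReal.inv_mul_cancel h0 h1, mul_one]
      _ = _ := by
          simp only [div_eq_mul_inv]; ring

end Cyl

section Info

variable {G : Type*} [Group G] [DecidableEq G] {X : Type*} [MeasurableSpace X] [MulAction G X]
  {k : ℕ}

/-- Information function. -/
noncomputable def LF (μ : Measure X) (α : X → Fin k) (S : Finset G) (x : X) : ℝ :=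
  -Real.log (cylM μ α S (cfg α x)).toReal

/-- Conditional information function. -/
noncomputable def cI (μ : Measure X) (α : X → Fin k) (g : G) (S : Finset G) (x : X) : ℝ :=
  LF μ α (insert g S) x - LF μ α S x

/-- Points all of whose cylinders have positive measure. -/
def GoodPt (G : Type*) [Group G] [MulAction G X] (μ : Measure X) (α : X → Fin k) (x : X) : Prop :=
  ∀ S : Finset G, cylM μ α S (cfg α x) ≠ 0

lemma ae_good [Countable G] (hmeas : ∀ g : G, Measurable (fun x : X => g • x))
    {α : X → Fin k} (hα : Measurable α) (μ : Measure X) [IsProbabilityMeasure μ] :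
    ∀ᵐ x ∂μ, GoodPt G μ α x := ae_cylM_ne_zero hmeas hα μ

lemma LF_nonneg (μ : Measure X) [IsProbabilityMeasure μ] (α : X → Fin k) (S : Finset G) (x : X) :
    0 ≤ LF μ α S x := by
  unfold LF
  rw [neg_nonneg]
  exact Real.log_nonpos ENNReal.toReal_nonneg
    (ENNReal.toReal_le_of_le_ofReal zero_le_one (by simpa using cylM_le_one μ α S _))

lemma LF_empty (μ : Measure X) [IsProbabilityMeasure μ] (α : X → Fin k) (x : X) :
    LF μ α (∅ : Finset G) x = 0 := by
  simp [LF, cylM_empty]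

lemma GoodPt.exp_neg_LF {μ : Measure X} [IsProbabilityMeasure μ] {α : X → Fin k} {x : X}
    (hx : GoodPt G μ α x) (S : Finset G) :
    ENNReal.ofReal (Real.exp (-LF μ α S x)) = cylM μ α S (cfg α x) := by
  unfold LF
  rw [neg_neg, Real.exp_log, ENNReal.ofReal_toReal (cylM_ne_top _ _ _ _)]
  exact ENNReal.toReal_pos (hx S) (cylM_ne_top _ _ _ _)

lemma GoodPt.exp_LF {μ : Measure X} [IsProbabilityMeasure μ] {α : X → Fin k} {x : X}
    (hx : GoodPt G μ α x) (S : Finset G) :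
    ENNReal.ofReal (Real.exp (LF μ α S x)) = (cylM μ α S (cfg α x))⁻¹ := by
  rw [← hx.exp_neg_LF S, ← ENNReal.ofReal_inv_of_pos (Real.exp_pos _), ← Real.exp_neg, neg_neg]

lemma GoodPt.exp_cI {μ : Measure X} [IsProbabilityMeasure μ] {α : X → Fin k} {x : X}
    (hx : GoodPt G μ α x) (g : G) (S : Finset G) :
    ENNReal.ofReal (Real.exp (cI μ α g S x)) =
      cylM μ α S (cfg α x) / cylM μ α (insert g S) (cfg α x) := by
  unfold cI
  rw [sub_eq_add_neg, Real.exp_add, ENNReal.ofReal_mul (Real.exp_nonneg _), hx.exp_LF,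
    hx.exp_neg_LF, mul_comm, div_eq_mul_inv]

lemma GoodPt.LF_mono {μ : Measure X} [IsProbabilityMeasure μ] {α : X → Fin k} {x : X}
    (hx : GoodPt G μ α x) {S T : Finset G} (h : S ⊆ T) : LF μ α S x ≤ LF μ α T x := by
  unfold LF
  rw [neg_le_neg_iff]
  exact Real.log_le_log (ENNReal.toReal_pos (hx T) (cylM_ne_top _ _ _ _))
    (ENNReal.toReal_mono (cylM_ne_top _ _ _ _) (cylM_anti μ α h _))

lemma GoodPt.cI_nonneg {μ : Measure X} [IsProbabilityMeasure μ] {α : X → Fin k} {x : X}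
    (hx : GoodPt G μ α x) (g : G) (S : Finset G) : 0 ≤ cI μ α g S x :=
  sub_nonneg.2 (hx.LF_mono (Finset.subset_insert _ _))

lemma LF_chain (μ : Measure X) [IsProbabilityMeasure μ] (α : X → Fin k) {Λ : Type*} [LinearOrder Λ]
    (ω : G → Λ) (hω : Function.Injective ω) (F : Finset G) (x : X) :
    LF μ α F x = ∑ g ∈ F, cI μ α g (before ω F g) x := by
  induction F using Finset.induction_on_max_value ω with
  | empty => simp [LF_empty]
  | insert a s ha hmax ih =>
    have hlt := lt_of_inj_max hω ha hmax
    rw [Finset.sum_insert ha, before_insert_max ω s hlt]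
    have : ∑ g ∈ s, cI μ α g (before ω (insert a s) g) x = ∑ g ∈ s, cI μ α g (before ω s g) x :=
      Finset.sum_congr rfl fun g hg => by rw [before_insert_of_le ω s (hmax g hg)]
    rw [this, ← ih, cI]
    ring

lemma bounded_dep (α : X → Fin k) (T : Finset G) {ψ : (G → Fin k) → ℝ}
    (hψ : DependsOn ψ (T : Set G)) : ∃ M, ∀ x : X, |ψ (cfg α x)| ≤ M := by
  rcases isEmpty_or_nonempty X with hX | ⟨⟨x0⟩⟩
  · exact ⟨0, fun x => (hX.false x).elim⟩
  refine ⟨∑ w : T → Fin k, |ψ (extPat (cfg α x0) T w)|, fun x => ?_⟩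
  have h1 : ψ (cfg α x) = ψ (extPat (cfg α x0) T (fun g => α ((g : G) • x))) := by
    refine hψ fun g hg => ?_
    have hg' : g ∈ T := hg
    simp [extPat, hg', cfg]
  rw [h1]
  exact Finset.single_le_sum (f := fun w : T → Fin k => |ψ (extPat (cfg α x0) T w)|)
    (fun _ _ => abs_nonneg _) (Finset.mem_univ _)

lemma dependsOn_LF (μ : Measure X) (α : X → Fin k) (S : Finset G) :
    DependsOn (fun c : G → Fin k => -Real.log (cylM μ α S c).toReal) (S : Set G) := by
  intro c c' h
  simp only []
  rw [cylM_congr μ α S h]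

lemma measurable_LF (hmeas : ∀ g : G, Measurable (fun x : X => g • x)) {α : X → Fin k}
    (hα : Measurable α) (μ : Measure X) (S : Finset G) : Measurable (LF μ α S) :=
  measurable_dep hmeas hα S (dependsOn_LF μ α S)

lemma measurable_cI (hmeas : ∀ g : G, Measurable (fun x : X => g • x)) {α : X → Fin k}
    (hα : Measurable α) (μ : Measure X) (g : G) (S : Finset G) : Measurable (cI μ α g S) :=
  (measurable_LF hmeas hα μ _).sub (measurable_LF hmeas hα μ _)

lemma bounded_LF (μ : Measure X) (α : X → Fin k) (S : Finset G) :
    ∃ M, ∀ x : X, |LF μ α S x| ≤ M := bounded_dep α S (dependsOn_LF μ α S)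

lemma bounded_cI (μ : Measure X) (α : X → Fin k) (g : G) (S : Finset G) :
    ∃ M, ∀ x : X, |cI μ α g S x| ≤ M := by
  obtain ⟨A, hA⟩ := bounded_LF μ α (insert g S)
  obtain ⟨B, hB⟩ := bounded_LF μ α S
  exact ⟨A + B, fun x => (abs_sub _ _).trans (add_le_add (hA x) (hB x))⟩

lemma integrable_of_bdd {X : Type*} [MeasurableSpace X] {μ : Measure X} [IsProbabilityMeasure μ] {f : X → ℝ} (hf : Measurable f)
    (h : ∃ M, ∀ x, |f x| ≤ M) : Integrable f μ := by
  obtain ⟨M, hM⟩ := h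
  exact Integrable.of_bound hf.aestronglyMeasurable M (ae_of_all _ hM)

lemma integrable_LF (hmeas : ∀ g : G, Measurable (fun x : X => g • x)) {α : X → Fin k}
    (hα : Measurable α) (μ ν : Measure X) [IsProbabilityMeasure ν] (S : Finset G) :
    Integrable (LF μ α S) ν :=
  integrable_of_bdd (measurable_LF hmeas hα μ S) (bounded_LF μ α S)

lemma integrable_cI (hmeas : ∀ g : G, Measurable (fun x : X => g • x)) {α : X → Fin k}
    (hα : Measurable α) (μ ν : Measure X) [IsProbabilityMeasure ν] (g : G) (S : Finset G) :
    Integrable (cI μ α g S) ν :=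
  integrable_of_bdd (measurable_cI hmeas hα μ g S) (bounded_cI μ α g S)

lemma integral_LF (hmeas : ∀ g : G, Measurable (fun x : X => g • x)) {α : X → Fin k}
    (hα : Measurable α) (μ : Measure X) [IsProbabilityMeasure μ] (S : Finset G) :
    ∫ x, LF μ α S x ∂μ = partitionEntropy μ α S := by
  set Φ : X → (S → Fin k) := fun x g => α ((g : G) • x)
  have hΦ : Measurable Φ := by
    rw [measurable_pi_iff]
    exact fun g => hα.comp (hmeas _)
  set q : (S → Fin k) → ℝ := fun f => (μ {x | ∀ g : ↥S, α ((g : G) • x) = f g}).toReal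
  have h1 : ∀ x, LF μ α S x = (fun f => -Real.log (q f)) (Φ x) := by
    intro x
    simp only [LF, cylM, q, Φ, cfg, Subtype.forall]
  simp_rw [h1]
  rw [← integral_map (μ := μ) (f := fun f => -Real.log (q f)) hΦ.aemeasurable
    (measurable_of_countable _).aestronglyMeasurable]
  haveI := Measure.isProbabilityMeasure_map (μ := μ) hΦ.aemeasurable
  rw [integral_fintype (Integrable.of_finite)]
  unfold partitionEntropy
  refine Finset.sum_congr rfl fun f _ => ?_
  rw [map_measureReal_apply hΦ (measurableSet_singleton _), Real.negMulLog]
  have : μ.real (Φ ⁻¹' {f}) = q f := by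
    simp only [Measure.real, q]
    congr 2
    ext z
    simp [Φ, funext_iff]
  rw [this, smul_eq_mul]
  ring

/-- Lower density estimate, exponential form. -/
lemma lower_exp [Countable G] (hmeas : ∀ g : G, Measurable (fun x : X => g • x)) {α : X → Fin k}
    (hα : Measurable α) (μ : Measure X) [IsProbabilityMeasure μ] {Λ : Type*} [LinearOrder Λ]
    (ω : G → Λ) (hω : Function.Injective ω) {F W : Finset G} (hFW : F ⊆ W) :
    ∫⁻ x, ENNReal.ofReal (Real.exp (∑ g ∈ F, cI μ α g (before ω W g) x - LF μ α F x)) ∂μ ≤ 1 := by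
  have h := lower_density hmeas hα μ ω hω F W
  rw [Finset.inter_eq_left.2 hFW] at h
  refine le_trans (le_of_eq ?_) h
  refine lintegral_congr_ae ?_
  filter_upwards [ae_good hmeas hα μ] with x hx
  rw [sub_eq_add_neg, Real.exp_add, ENNReal.ofReal_mul (Real.exp_nonneg _), hx.exp_neg_LF, mul_comm,
    Real.exp_sum, ENNReal.ofReal_prod_of_nonneg (fun _ _ => Real.exp_nonneg _)]
  congr 1
  exact Finset.prod_congr rfl fun g _ => hx.exp_cI g _

/-- Upper density estimate, exponential form. -/
lemma upper_exp [Countable G] (hmeas : ∀ g : G, Measurable (fun x : X => g • x)) {α : X → Fin k}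
    (hα : Measurable α) (μ : Measure X) [IsProbabilityMeasure μ] {Λ : Type*} [LinearOrder Λ]
    (ω : G → Λ) (hω : Function.Injective ω) (cost : G → (G → Fin k) → ℝ)
    (hsum : ∀ g c, ∑ a, Real.exp (-cost g (Function.update c g a)) ≤ 1) (F : Finset G)
    (hu : ∀ g ∈ F, DependsOn (cost g) ((insert g (before ω F g) : Finset G) : Set G)) :
    ∫⁻ x, ENNReal.ofReal (Real.exp (LF μ α F x - ∑ g ∈ F, cost g (cfg α x))) ∂μ ≤ 1 := by
  have h := upper_density hmeas hα μ ω hω (fun g c => ENNReal.ofReal (Real.exp (-cost g c)))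
    (fun g c => by
      rw [← ENNReal.ofReal_sum_of_nonneg (fun _ _ => Real.exp_nonneg _)]
      exact ENNReal.ofReal_le_one.2 (hsum g c)) F
    (fun g hg c c' hc => by simp only []; rw [hu g hg hc])
  refine le_trans (le_of_eq ?_) h
  refine lintegral_congr_ae ?_
  filter_upwards [ae_good hmeas hα μ] with x hx
  rw [sub_eq_add_neg, Real.exp_add, ENNReal.ofReal_mul (Real.exp_nonneg _), hx.exp_LF, mul_comm,
    ← Finset.sum_neg_distrib, Real.exp_sum, ENNReal.ofReal_prod_of_nonneg (fun _ _ => Real.exp_nonneg _),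
    div_eq_mul_inv]

lemma cI_of_mem (μ : Measure X) (α : X → Fin k) {g : G} {S : Finset G} (h : g ∈ S) (x : X) :
    cI μ α g S x = 0 := by
  rw [cI, Finset.insert_eq_of_mem h, sub_self]

/-- Conditional information decreases, exponential form. -/
lemma cI_exp [Countable G] (hmeas : ∀ g : G, Measurable (fun x : X => g • x)) {α : X → Fin k}
    (hα : Measurable α) (μ : Measure X) [IsProbabilityMeasure μ] (g : G) {S S' : Finset G}
    (hS : S ⊆ S') :
    ∫⁻ x, ENNReal.ofReal (Real.exp (cI μ α g S' x - cI μ α g S x)) ∂μ ≤ 1 := by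
  by_cases hg : g ∈ S'
  · calc _ ≤ ∫⁻ x, 1 ∂μ := by
          refine lintegral_mono_ae ?_
          filter_upwards [ae_good hmeas hα μ] with x hx
          rw [cI_of_mem μ α hg]
          refine ENNReal.ofReal_le_one.2 (Real.exp_le_one_iff.2 ?_)
          have := hx.cI_nonneg g S
          linarith
      _ = 1 := by simp
  have hgS : g ∉ S := fun h => hg (hS h)
  have hu : DependsOn (fun c => cylM μ α (insert g S) c / cylM μ α S c)
          ((insert g S' : Finset G) : Set G) := by
    intro c c' h
    simp only []
    rw [dependsOn_cylM μ α (Finset.insert_subset_insert _ hS) h,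
      dependsOn_cylM μ α (hS.trans (Finset.subset_insert _ _)) h]
  have := supermart_step hmeas hα μ S' g hg (R := fun _ => 1) (fun _ _ _ => rfl) hu (by
    intro c
    have h1 : ∀ b, cylM μ α S (Function.update c g b) = cylM μ α S c := by
      intro b
      refine cylM_congr _ _ _ fun g' hg' => ?_
      rw [Function.update_of_ne]
      rintro rfl; exact hgS hg'
    simp_rw [h1, div_eq_mul_inv]
    rw [← Finset.sum_mul, cylM_sum hmeas hα μ _ g hgS, ← div_eq_mul_inv]
    exact ENNReal.div_self_le_one)
  have h1 : ∫⁻ _ : X, (1 : ℝ≥0∞) ∂μ = 1 := by simp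
  rw [h1] at this
  refine le_trans (le_of_eq ?_) this
  refine lintegral_congr_ae ?_
  filter_upwards [ae_good hmeas hα μ] with x hx
  rw [sub_eq_add_neg, Real.exp_add, ENNReal.ofReal_mul (Real.exp_nonneg _), hx.exp_cI, one_mul,
    Real.exp_neg, ENNReal.ofReal_inv_of_pos (Real.exp_pos _), hx.exp_cI, mul_comm,
    ENNReal.inv_div (Or.inl (cylM_ne_top _ _ _ _)) (Or.inl (hx _))]

lemma integral_nonpos_of_exp {X : Type*} [MeasurableSpace X] {μ : Measure X} [IsProbabilityMeasure μ]
    {u : X → ℝ} (hu : Integrable u μ) (hm : Measurable u)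
    (h : ∫⁻ x, ENNReal.ofReal (Real.exp (u x)) ∂μ ≤ 1) :
    Integrable (fun x => Real.exp (u x)) μ ∧ ∫ x, Real.exp (u x) ∂μ ≤ 1 ∧ ∫ x, u x ∂μ ≤ 0 := by
  have hi : Integrable (fun x => Real.exp (u x)) μ := by
    refine ⟨hm.exp.aestronglyMeasurable, ?_⟩
    rw [hasFiniteIntegral_iff_ofReal (ae_of_all _ fun _ => Real.exp_nonneg _)]
    exact h.trans_lt ENNReal.one_lt_top
  have h1 : ∫ x, Real.exp (u x) ∂μ ≤ 1 := by
    rw [integral_eq_lintegral_of_nonneg_ae (ae_of_all _ fun _ => Real.exp_nonneg _)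
      hm.exp.aestronglyMeasurable]
    exact ENNReal.toReal_le_of_le_ofReal zero_le_one (by simpa using h)
  refine ⟨hi, h1, ?_⟩
  have : ∫ x, (u x + 1) ∂μ ≤ ∫ x, Real.exp (u x) ∂μ :=
    integral_mono (hu.add (integrable_const _)) hi fun x => Real.add_one_le_exp _
  rw [integral_add hu (integrable_const _)] at this
  simp at this
  linarith

lemma abs_le_exp_bound (u δ : ℝ) (hδ : 0 < δ) :
    |u| ≤ δ + 2 / δ * (Real.exp u - 1 - u) - u := by
  have h0 : 0 ≤ Real.exp u - 1 - u := by have := Real.add_one_le_exp u; linarith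
  rcases le_or_gt u 0 with h | h
  · rw [abs_of_nonpos h]
    have : 0 ≤ 2 / δ * (Real.exp u - 1 - u) := by positivity
    linarith
  · rw [abs_of_pos h]
    have h1 := Real.quadratic_le_exp_of_nonneg h.le
    have h2 : 2 / δ * (u ^ 2 / 2) ≤ 2 / δ * (Real.exp u - 1 - u) := by
      gcongr; linarith
    have h3 : 2 * u ≤ δ + 2 / δ * (u ^ 2 / 2) := by
      have : 2 / δ * (u ^ 2 / 2) = u ^ 2 / δ := by field_simp
      rw [this]
      have : δ + u ^ 2 / δ - 2 * u = (δ - u) ^ 2 / δ := by field_simp; ring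
      have : 0 ≤ (δ - u) ^ 2 / δ := by positivity
      linarith
    linarith

lemma l1_of_exp {X : Type*} [MeasurableSpace X] {μ : Measure X} [IsProbabilityMeasure μ]
    {u : X → ℝ} (hu : Integrable u μ) (hm : Measurable u)
    (h : ∫⁻ x, ENNReal.ofReal (Real.exp (u x)) ∂μ ≤ 1) (δ : ℝ) (hδ : 0 < δ) :
    ∫ x, |u x| ∂μ ≤ δ + (2 / δ + 1) * (-∫ x, u x ∂μ) := by
  obtain ⟨hi, h1, -⟩ := integral_nonpos_of_exp hu hm h
  have i1 : Integrable (fun x => δ + 2 / δ * (Real.exp (u x) - 1 - u x) - u x) μ := by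
    refine Integrable.sub (Integrable.add (integrable_const _) (Integrable.const_mul ?_ _)) hu
    exact (hi.sub (integrable_const _)).sub hu
  have h2 := integral_mono hu.abs i1 fun x => abs_le_exp_bound (u x) δ hδ
  refine h2.trans ?_
  have i2 : Integrable (fun x => Real.exp (u x) - 1 - u x) μ := (hi.sub (integrable_const _)).sub hu
  have i3 : Integrable (fun x => δ + 2 / δ * (Real.exp (u x) - 1 - u x)) μ :=
    (integrable_const _).add (i2.const_mul _)
  have i4 : Integrable (fun x => Real.exp (u x) - 1) μ := hi.sub (integrable_const _)
  rw [integral_sub i3 hu,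
    integral_add (integrable_const _) (i2.const_mul _), integral_const_mul,
    integral_sub i4 hu, integral_sub hi (integrable_const _)]
  simp only [integral_const, probReal_univ, smul_eq_mul, one_mul]
  have : 2 / δ * (∫ x, Real.exp (u x) ∂μ - 1 - ∫ x, u x ∂μ) ≤ 2 / δ * (- ∫ x, u x ∂μ) := by
    gcongr; linarith
  linarith

lemma integral_cI_le_log [Countable G] (hmeas : ∀ g : G, Measurable (fun x : X => g • x))
    {α : X → Fin k} (hα : Measurable α) (μ : Measure X) [IsProbabilityMeasure μ] (g : G)
    (S : Finset G) : ∫ x, cI μ α g S x ∂μ ≤ Real.log k := by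
  obtain ⟨x0⟩ : Nonempty X := nonempty_of_isProbabilityMeasure μ
  have hk : 0 < k := Fin.pos (α x0)
  have hk' : (0 : ℝ) < k := by exact_mod_cast hk
  by_cases hg : g ∈ S
  · simp_rw [cI_of_mem μ α hg]
    simp only [integral_zero]
    exact Real.log_natCast_nonneg k
  have := supermart_step hmeas hα μ S g hg (R := fun _ => 1) (fun _ _ _ => rfl)
    (u := fun _ => (k : ℝ≥0∞)⁻¹) (fun _ _ _ => rfl) (by
    intro c
    simp only [Finset.sum_const, Finset.card_univ, Fintype.card_fin, nsmul_eq_mul]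
    rw [ENNReal.mul_inv_cancel (by exact_mod_cast hk.ne') (ENNReal.natCast_ne_top k)])
  have h1 : ∫⁻ _ : X, (1 : ℝ≥0∞) ∂μ = 1 := by simp
  rw [h1] at this
  have h2 := (integral_nonpos_of_exp (μ := μ) (u := fun x => cI μ α g S x - Real.log k)
    ((integrable_cI hmeas hα μ μ g S).sub (integrable_const _))
    ((measurable_cI hmeas hα μ g S).sub_const _) (by
      refine le_trans (le_of_eq ?_) this
      refine lintegral_congr_ae ?_
      filter_upwards [ae_good hmeas hα μ] with x hx
      rw [sub_eq_add_neg, Real.exp_add, ENNReal.ofReal_mul (Real.exp_nonneg _), hx.exp_cI, one_mul,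
        Real.exp_neg, Real.exp_log hk', ENNReal.ofReal_inv_of_pos hk', ENNReal.ofReal_natCast,
        mul_comm])).2.2
  rw [integral_sub (integrable_cI hmeas hα μ μ g S) (integrable_const _)] at h2
  simpa using h2

lemma cylM_shift (hmeas : ∀ g : G, Measurable (fun x : X => g • x)) {α : X → Fin k}
    (hα : Measurable α) {μ : Measure X} (hinv : InvariantMeasure G μ) (S : Finset G) (g : G) (x : X) :
    cylM μ α S (cfg α (g • x)) = cylM μ α (S.image (· * g)) (cfg α x) := by
  unfold cylM
  conv_lhs => rw [← hinv g]
  rw [Measure.map_apply (hmeas g) (measurableSet_cyl hmeas hα _ _)]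
  congr 1
  ext z
  simp only [cfg, preimage_setOf_eq, mem_setOf_eq, Finset.forall_mem_image, mul_smul]

lemma LF_shift (hmeas : ∀ g : G, Measurable (fun x : X => g • x)) {α : X → Fin k}
    (hα : Measurable α) {μ : Measure X} (hinv : InvariantMeasure G μ) (S : Finset G) (g : G) (x : X) :
    LF μ α S (g • x) = LF μ α (S.image (· * g)) x := by
  simp only [LF, cylM_shift hmeas hα hinv]

lemma cI_shift (hmeas : ∀ g : G, Measurable (fun x : X => g • x)) {α : X → Fin k}
    (hα : Measurable α) {μ : Measure X} (hinv : InvariantMeasure G μ) (S : Finset G) (h g : G) (x : X) :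
    cI μ α h S (g • x) = cI μ α (h * g) (S.image (· * g)) x := by
  simp only [cI, LF_shift hmeas hα hinv, Finset.image_insert]

end Info

section RandomOrder

variable {G : Type*} [Group G] [DecidableEq G] {X : Type*} [MeasurableSpace X] [MulAction G X]
  {k : ℕ}

/-- Random order measure. -/
noncomputable def ordP (G : Type*) : Measure (G → unitInterval) :=
  Measure.infinitePi (fun _ : G => (volume : Measure unitInterval))

instance (G : Type*) : IsProbabilityMeasure (ordP G) := by
  unfold ordP; infer_instance

lemma ordP_pair {g h : G} (hgh : g ≠ h) : ∀ᵐ ω ∂(ordP G), ω g ≠ ω h := by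
  have hind : ProbabilityTheory.iIndepFun (fun (i : G) (ω : G → unitInterval) => ω i) (ordP G) := by
    have := ProbabilityTheory.iIndepFun_infinitePi (P := fun _ : G => (volume : Measure unitInterval))
      (X := fun _ u => u) (fun _ => measurable_id)
    exact this
  have h2 := hind.indepFun hgh
  rw [ProbabilityTheory.indepFun_iff_map_prod_eq_prod_map_map
    (measurable_pi_apply _).aemeasurable (measurable_pi_apply _).aemeasurable] at h2
  have e : ∀ g : G, (ordP G).map (fun ω => ω g) = (volume : Measure unitInterval) := fun g =>
    Measure.infinitePi_map_eval (fun _ : G => (volume : Measure unitInterval)) g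
  rw [e, e] at h2
  have h3 : (ordP G).map (fun ω => (ω g, ω h)) {q | q.1 = q.2} = 0 := by
    rw [h2, Measure.prod_apply (measurableSet_eq_fun measurable_fst measurable_snd)]
    rw [lintegral_eq_zero_iff' ]
    · refine ae_of_all _ fun u => ?_
      have : (Prod.mk u ⁻¹' {q : unitInterval × unitInterval | q.1 = q.2}) = {u} := by
        ext v; simp [eq_comm]
      show volume (Prod.mk u ⁻¹' {q : unitInterval × unitInterval | q.1 = q.2}) = 0
      rw [this]
      exact measure_singleton u
    · exact (measurable_measure_prodMk_left
        (measurableSet_eq_fun measurable_fst measurable_snd)).aemeasurable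
  have hpm : Measurable (fun ω : G → unitInterval => (ω g, ω h)) :=
    (measurable_pi_apply g).prodMk (measurable_pi_apply h)
  rw [Measure.map_apply hpm
    (measurableSet_eq_fun measurable_fst measurable_snd)] at h3
  rw [ae_iff]
  simpa using h3

lemma ordP_injective [Countable G] : ∀ᵐ ω ∂(ordP G), Function.Injective ω := by
  have : ∀ᵐ ω ∂(ordP G), ∀ g h : G, g ≠ h → ω g ≠ ω h := by
    rw [ae_all_iff]; intro g
    rw [ae_all_iff]; intro h
    by_cases e : g = h
    · exact ae_of_all _ fun _ h' => (h' e).elim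
    · filter_upwards [ordP_pair e] with ω hω _ using hω
  filter_upwards [this] with ω hω g h e
  by_contra hne
  exact hω g h hne e

lemma ordP_shift (g : G) :
    MeasurePreserving (fun (ω : G → unitInterval) (h : G) => ω (h * g)) (ordP G) (ordP G) := by
  have hm : Measurable (fun (ω : G → unitInterval) (h : G) => ω (h * g)) := by
    rw [measurable_pi_iff]; exact fun h => measurable_pi_apply _
  refine ⟨hm, ?_⟩
  refine Measure.eq_infinitePi _ fun s t ht => ?_
  rw [Measure.map_apply hm (MeasurableSet.pi s.countable_toSet fun i _ => ht i)]
  have : (fun (ω : G → unitInterval) (h : G) => ω (h * g)) ⁻¹' (Set.pi s t) =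
      Set.pi ((s.image (· * g) : Finset G) : Set G) (fun i => t (i * g⁻¹)) := by
    ext ω
    simp only [mem_preimage, Set.mem_pi, Finset.mem_coe, Finset.forall_mem_image,
      mul_inv_cancel_right]
  rw [this, ordP, Measure.infinitePi_pi _ (fun i _ => ht _)]
  rw [Finset.prod_image (fun a _ b _ h => mul_right_cancel h)]
  simp

lemma measurableSet_before (W : Finset G) (g : G) (S : Finset G) :
    MeasurableSet {ω : G → unitInterval | before ω W g = S} := by
  have : {ω : G → unitInterval | before ω W g = S} =
      if S ⊆ W then ⋂ v ∈ W, {ω | v ∈ S ↔ ω v < ω g} else ∅ := by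
    ext ω
    split_ifs with h
    · simp only [mem_setOf_eq, mem_iInter, before, Finset.ext_iff, Finset.mem_filter]
      constructor
      · intro h' v hv
        rw [← h' v]; simp [hv]
      · intro h' v
        constructor
        · rintro ⟨h1, h2⟩
          exact (h' v h1).2 h2
        · intro hv
          exact ⟨h hv, (h' v (h hv)).1 hv⟩
    · simp only [mem_setOf_eq, mem_empty_iff_false, iff_false]
      rintro rfl
      exact h (Finset.filter_subset _ _)
  rw [this]
  split_ifs
  · refine Finset.measurableSet_biInter _ fun v _ => ?_
    have : MeasurableSet {ω : G → unitInterval | ω v < ω g} :=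
      measurableSet_lt (measurable_pi_apply _) (measurable_pi_apply _)
    by_cases hv : v ∈ S
    · simpa [hv] using this
    · simpa [hv] using measurableSet_le (measurable_pi_apply (X := fun _ : G => unitInterval) g)
        (measurable_pi_apply v)
  · exact MeasurableSet.empty

lemma before_mem_powerset (ω : G → unitInterval) (W : Finset G) (g : G) :
    before ω W g ∈ W.powerset := Finset.mem_powerset.2 (Finset.filter_subset _ _)

lemma before_sum (f : Finset G → ℝ) (ω : G → unitInterval) (W : Finset G) (g : G) :
    f (before ω W g) = ∑ S ∈ W.powerset, {ω : G → unitInterval | before ω W g = S}.indicator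
      (fun _ => f S) ω := by
  rw [Finset.sum_eq_single (before ω W g)]
  · simp
  · intro S _ hS
    rw [indicator_of_notMem]
    intro h; exact hS h.symm
  · intro h; exact (h (before_mem_powerset ω W g)).elim

lemma measurable_before_fix (f : Finset G → ℝ) (W : Finset G) (g : G) :
    Measurable (fun ω : G → unitInterval => f (before ω W g)) := by
  simp_rw [before_sum f]
  exact Finset.measurable_sum _ fun S _ => measurable_const.indicator (measurableSet_before W g S)

lemma measurable_before_comp {f : Finset G → X → ℝ} (hf : ∀ S, Measurable (f S))
    (W : Finset G) (g : G) :
    Measurable (fun p : (G → unitInterval) × X => f (before p.1 W g) p.2) := by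
  have : (fun p : (G → unitInterval) × X => f (before p.1 W g) p.2) =
      fun p => ∑ S ∈ W.powerset, ({ω : G → unitInterval | before ω W g = S} ×ˢ univ).indicator
      (fun q : (G → unitInterval) × X => f S q.2) p := by
    ext p
    rw [before_sum (fun S => f S p.2)]
    refine Finset.sum_congr rfl fun S _ => ?_
    simp only [indicator, mem_prod, mem_univ, and_true]
  rw [this]
  refine Finset.measurable_sum _ fun S _ => ?_
  exact ((hf S).comp measurable_snd).indicator ((measurableSet_before W g S).prod MeasurableSet.univ)

lemma bounded_before_comp {f : Finset G → X → ℝ} (hf : ∀ S, ∃ M, ∀ x, |f S x| ≤ M)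
    (W : Finset G) (g : G) : ∃ M, ∀ (ω : G → unitInterval) x, |f (before ω W g) x| ≤ M := by
  choose M hM using hf
  refine ⟨∑ S ∈ W.powerset, |M S|, fun ω x => ?_⟩
  refine ((hM _ x).trans (le_abs_self _)).trans ?_
  exact Finset.single_le_sum (f := fun S => |M S|) (fun _ _ => abs_nonneg _)
    (before_mem_powerset ω W g)

/-- Averaging exponential estimates. -/
lemma exp_average {Ω : Type*} [MeasurableSpace Ω] (P : Measure Ω) [IsProbabilityMeasure P]
    (μ : Measure X) [IsProbabilityMeasure μ] (φ : Ω → X → ℝ)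
    (hφ : Measurable (Function.uncurry φ)) (hb : ∃ M, ∀ ω x, |φ ω x| ≤ M)
    (h : ∀ᵐ ω ∂P, ∫⁻ x, ENNReal.ofReal (Real.exp (φ ω x)) ∂μ ≤ 1) :
    ∫⁻ x, ENNReal.ofReal (Real.exp (∫ ω, φ ω x ∂P)) ∂μ ≤ 1 := by
  obtain ⟨M, hM⟩ := hb
  have h1 : ∀ x, ENNReal.ofReal (Real.exp (∫ ω, φ ω x ∂P)) ≤
      ∫⁻ ω, ENNReal.ofReal (Real.exp (φ ω x)) ∂P := by
    intro x
    have hm : Measurable (fun ω => φ ω x) := hφ.comp measurable_prodMk_right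
    have i1 : Integrable (fun ω => φ ω x) P := integrable_of_bdd hm ⟨M, fun ω => hM ω x⟩
    have i2 : Integrable (fun ω => Real.exp (φ ω x)) P := by
      refine integrable_of_bdd hm.exp ⟨Real.exp M, fun ω => ?_⟩
      rw [abs_of_pos (Real.exp_pos _)]
      exact Real.exp_le_exp.2 ((le_abs_self _).trans (hM ω x))
    have := convexOn_exp.map_integral_le Real.continuous_exp.continuousOn isClosed_univ
      (ae_of_all P fun ω => mem_univ (φ ω x)) i1 i2
    refine (ENNReal.ofReal_le_ofReal this).trans ?_
    rw [ofReal_integral_eq_lintegral_ofReal i2 (ae_of_all _ fun _ => Real.exp_nonneg _)]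
  calc _ ≤ ∫⁻ x, ∫⁻ ω, ENNReal.ofReal (Real.exp (φ ω x)) ∂P ∂μ := lintegral_mono h1
    _ = ∫⁻ ω, ∫⁻ x, ENNReal.ofReal (Real.exp (φ ω x)) ∂μ ∂P := by
        rw [lintegral_lintegral_swap]
        refine Measurable.aemeasurable ?_
        exact (hφ.comp measurable_swap).exp.ennreal_ofReal
    _ ≤ ∫⁻ ω, 1 ∂P := lintegral_mono_ae h
    _ = 1 := by simp

/-- Average of a function of the past of the identity. -/
noncomputable def avgOrd (V : Finset G) (f : Finset G → X → ℝ) (x : X) : ℝ :=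
  ∫ ω, f (before ω V 1) x ∂(ordP G)

/-- Averaged conditional information. -/
noncomputable def JV (μ : Measure X) (α : X → Fin k) (V : Finset G) : X → ℝ :=
  avgOrd V (cI μ α 1)

/-- Weight of a past. -/
noncomputable def ordW (V S : Finset G) : ℝ :=
  (ordP G).real {ω : G → unitInterval | before ω V 1 = S}

lemma ordW_nonneg (V S : Finset G) : 0 ≤ ordW V S := measureReal_nonneg

lemma avgOrd_eq_sum (V : Finset G) (f : Finset G → X → ℝ) (x : X) :
    avgOrd V f x = ∑ S ∈ V.powerset, ordW V S * f S x := by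
  unfold avgOrd ordW
  simp_rw [before_sum (fun S => f S x)]
  rw [integral_finsetSum]
  · refine Finset.sum_congr rfl fun S _ => ?_
    rw [integral_indicator_const _ (measurableSet_before V 1 S), smul_eq_mul]
  · intro S _
    exact (integrable_const _).indicator (measurableSet_before V 1 S)

lemma ordW_sum (V : Finset G) : ∑ S ∈ V.powerset, ordW V S = 1 := by
  have := avgOrd_eq_sum V (fun _ (_ : Unit) => (1 : ℝ)) ()
  simp only [mul_one] at this
  rw [← this]
  simp [avgOrd]

lemma measurable_avgOrd {f : Finset G → X → ℝ} (hf : ∀ S, Measurable (f S)) (V : Finset G) :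
    Measurable (avgOrd V f) := by
  have : avgOrd V f = fun x => ∑ S ∈ V.powerset, ordW V S * f S x := by
    ext x; exact avgOrd_eq_sum V f x
  rw [this]
  exact Finset.measurable_sum _ fun S _ => (hf S).const_mul _

lemma bounded_avgOrd {f : Finset G → X → ℝ} (hf : ∀ S, ∃ M, ∀ x, |f S x| ≤ M) (V : Finset G) :
    ∃ M, ∀ x, |avgOrd V f x| ≤ M := by
  choose M hM using hf
  refine ⟨∑ S ∈ V.powerset, |ordW V S| * M S, fun x => ?_⟩
  rw [avgOrd_eq_sum]
  refine (Finset.abs_sum_le_sum_abs _ _).trans (Finset.sum_le_sum fun S _ => ?_)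
  rw [abs_mul]
  exact mul_le_mul_of_nonneg_left (hM S x) (abs_nonneg _)

lemma before_shift (ω : G → unitInterval) (W : Finset G) (g : G) :
    before ω W g = (before (fun h => ω (h * g)) (W.image (· * g⁻¹)) 1).image (· * g) := by
  ext v
  simp only [before, Finset.mem_filter, Finset.mem_image, one_mul]
  constructor
  · rintro ⟨h1, h2⟩
    exact ⟨v * g⁻¹, ⟨⟨v, h1, rfl⟩, by simpa using h2⟩, by simp⟩
  · rintro ⟨w, ⟨⟨u, hu, rfl⟩, h⟩, rfl⟩
    simpa using ⟨hu, by simpa using h⟩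

lemma avg_cI_shift (hmeas : ∀ g : G, Measurable (fun x : X => g • x)) {α : X → Fin k}
    (hα : Measurable α) {μ : Measure X} (hinv : InvariantMeasure G μ) (W : Finset G) (g : G) (x : X) :
    ∫ ω, cI μ α g (before ω W g) x ∂(ordP G) = JV μ α (W.image (· * g⁻¹)) (g • x) := by
  unfold JV avgOrd
  have e : ∀ ω : G → unitInterval, cI μ α g (before ω W g) x =
      (fun ω' => cI μ α 1 (before ω' (W.image (· * g⁻¹)) 1) (g • x)) (fun h => ω (h * g)) := by
    intro ω
    simp only []
    rw [cI_shift hmeas hα hinv, one_mul, ← before_shift]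
  simp_rw [e]
  have hm : Measurable (fun ω' : G → unitInterval =>
      cI μ α 1 (before ω' (W.image (· * g⁻¹)) 1) (g • x)) :=
    measurable_before_fix (fun S => cI μ α 1 S (g • x)) _ 1
  rw [← integral_map (μ := ordP G) (φ := fun (ω : G → unitInterval) h => ω (h * g))
    (ordP_shift g).measurable.aemeasurable hm.aestronglyMeasurable, (ordP_shift g).map_eq]

variable [Countable G]

lemma integrable_before_cI (hmeas : ∀ g : G, Measurable (fun x : X => g • x)) {α : X → Fin k}
    (hα : Measurable α) (μ : Measure X) (W : Finset G) (g : G) (x : X) :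
    Integrable (fun ω : G → unitInterval => cI μ α g (before ω W g) x) (ordP G) := by
  obtain ⟨M, hM⟩ := bounded_before_comp (f := cI μ α g) (fun S => bounded_cI μ α g S) W g
  exact integrable_of_bdd (measurable_before_fix (fun S => cI μ α g S x) W g) ⟨M, fun ω => hM ω x⟩

lemma chain_avg (hmeas : ∀ g : G, Measurable (fun x : X => g • x)) {α : X → Fin k}
    (hα : Measurable α) {μ : Measure X} [IsProbabilityMeasure μ] (hinv : InvariantMeasure G μ)
    (F : Finset G) (x : X) :
    LF μ α F x = ∑ g ∈ F, JV μ α (F.image (· * g⁻¹)) (g • x) := by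
  have h1 : ∫ _ω : G → unitInterval, LF μ α F x ∂(ordP G) = LF μ α F x := by simp
  rw [← h1]
  simp_rw [← avg_cI_shift hmeas hα hinv]
  rw [← integral_finsetSum _ (fun g _ => integrable_before_cI hmeas hα μ F g x)]
  refine integral_congr_ae ?_
  filter_upwards [ordP_injective] with ω hω
  exact LF_chain μ α ω hω F x

lemma lower_avg (hmeas : ∀ g : G, Measurable (fun x : X => g • x)) {α : X → Fin k}
    (hα : Measurable α) {μ : Measure X} [IsProbabilityMeasure μ] (hinv : InvariantMeasure G μ)
    {F W : Finset G} (hFW : F ⊆ W) :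
    ∫⁻ x, ENNReal.ofReal (Real.exp (∑ g ∈ F, JV μ α (W.image (· * g⁻¹)) (g • x) - LF μ α F x)) ∂μ
      ≤ 1 := by
  have hb : ∀ g, ∃ M, ∀ (ω : G → unitInterval) x, |cI μ α g (before ω W g) x| ≤ M := fun g =>
    bounded_before_comp (f := cI μ α g) (fun S => bounded_cI μ α g S) W g
  choose M hM using hb
  obtain ⟨N, hN⟩ := bounded_LF μ α F
  have := exp_average (ordP G) μ (fun ω x => ∑ g ∈ F, cI μ α g (before ω W g) x - LF μ α F x)
    (by
      refine Measurable.sub (Finset.measurable_sum _ fun g _ => ?_)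
        ((measurable_LF hmeas hα μ F).comp measurable_snd)
      exact measurable_before_comp (f := cI μ α g) (measurable_cI hmeas hα μ g) W g)
    ⟨∑ g ∈ F, M g + N, fun ω x => (abs_sub _ _).trans (add_le_add
      ((Finset.abs_sum_le_sum_abs _ _).trans (Finset.sum_le_sum fun g _ => hM g ω x)) (hN x))⟩
    (by
      filter_upwards [ordP_injective] with ω hω
      exact lower_exp hmeas hα μ ω hω hFW)
  refine le_trans (le_of_eq (lintegral_congr fun x => ?_)) this
  rw [integral_sub (integrable_finsetSum _ fun g _ => integrable_before_cI hmeas hα μ W g x)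
    (integrable_const _), integral_finsetSum _ (fun g _ => integrable_before_cI hmeas hα μ W g x)]
  simp_rw [avg_cI_shift hmeas hα hinv]
  simp

lemma before_mono (ω : G → unitInterval) {V V' : Finset G} (h : V ⊆ V') (g : G) :
    before ω V g ⊆ before ω V' g := Finset.filter_subset_filter _ h

lemma measurable_JV (hmeas : ∀ g : G, Measurable (fun x : X => g • x)) {α : X → Fin k}
    (hα : Measurable α) (μ : Measure X) (V : Finset G) : Measurable (JV μ α V) :=
  measurable_avgOrd (measurable_cI hmeas hα μ 1) V

lemma bounded_JV (μ : Measure X) (α : X → Fin k) (V : Finset G) : ∃ M, ∀ x, |JV μ α V x| ≤ M :=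
  bounded_avgOrd (fun S => bounded_cI μ α 1 S) V

lemma integrable_JV (hmeas : ∀ g : G, Measurable (fun x : X => g • x)) {α : X → Fin k}
    (hα : Measurable α) (μ ν : Measure X) [IsProbabilityMeasure ν] (V : Finset G) :
    Integrable (JV μ α V) ν :=
  integrable_of_bdd (measurable_JV hmeas hα μ V) (bounded_JV μ α V)

lemma JV_exp (hmeas : ∀ g : G, Measurable (fun x : X => g • x)) {α : X → Fin k}
    (hα : Measurable α) (μ : Measure X) [IsProbabilityMeasure μ] {V V' : Finset G} (h : V ⊆ V') :
    ∫⁻ x, ENNReal.ofReal (Real.exp (JV μ α V' x - JV μ α V x)) ∂μ ≤ 1 := by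
  obtain ⟨M, hM⟩ := bounded_before_comp (f := cI μ α 1) (fun S => bounded_cI μ α (1 : G) S) V 1
  obtain ⟨M', hM'⟩ := bounded_before_comp (f := cI μ α 1) (fun S => bounded_cI μ α (1 : G) S) V' 1
  have := exp_average (ordP G) μ (fun ω x => cI μ α 1 (before ω V' 1) x - cI μ α 1 (before ω V 1) x)
    ((measurable_before_comp (f := cI μ α 1) (measurable_cI hmeas hα μ 1) V' 1).sub
      (measurable_before_comp (f := cI μ α 1) (measurable_cI hmeas hα μ 1) V 1))
    ⟨M' + M, fun ω x => (abs_sub _ _).trans (add_le_add (hM' ω x) (hM ω x))⟩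
    (ae_of_all _ fun ω => cI_exp hmeas hα μ 1 (before_mono ω h 1))
  refine le_trans (le_of_eq (lintegral_congr fun x => ?_)) this
  rw [integral_sub (integrable_before_cI hmeas hα μ V' 1 x) (integrable_before_cI hmeas hα μ V 1 x)]
  rfl

lemma integral_JV_anti (hmeas : ∀ g : G, Measurable (fun x : X => g • x)) {α : X → Fin k}
    (hα : Measurable α) (μ : Measure X) [IsProbabilityMeasure μ] {V V' : Finset G} (h : V ⊆ V') :
    ∫ x, JV μ α V' x ∂μ ≤ ∫ x, JV μ α V x ∂μ := by
  have := (integral_nonpos_of_exp ((integrable_JV hmeas hα μ μ V').sub (integrable_JV hmeas hα μ μ V))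
    ((measurable_JV hmeas hα μ V').sub (measurable_JV hmeas hα μ V)) (JV_exp hmeas hα μ h)).2.2
  simp only [Pi.sub_apply] at this
  rw [integral_sub (integrable_JV hmeas hα μ μ V') (integrable_JV hmeas hα μ μ V)] at this
  linarith

lemma l1_JV (hmeas : ∀ g : G, Measurable (fun x : X => g • x)) {α : X → Fin k}
    (hα : Measurable α) (μ : Measure X) [IsProbabilityMeasure μ] {V V' : Finset G} (h : V ⊆ V')
    (δ : ℝ) (hδ : 0 < δ) :
    ∫ x, |JV μ α V' x - JV μ α V x| ∂μ ≤
      δ + (2 / δ + 1) * (∫ x, JV μ α V x ∂μ - ∫ x, JV μ α V' x ∂μ) := by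
  have := l1_of_exp ((integrable_JV hmeas hα μ μ V').sub (integrable_JV hmeas hα μ μ V))
    ((measurable_JV hmeas hα μ V').sub (measurable_JV hmeas hα μ V)) (JV_exp hmeas hα μ h) δ hδ
  simp only [Pi.sub_apply] at this
  rwa [integral_sub (integrable_JV hmeas hα μ μ V') (integrable_JV hmeas hα μ μ V), neg_sub] at this

lemma GoodPt.JV_nonneg {μ : Measure X} [IsProbabilityMeasure μ] {α : X → Fin k} {x : X}
    (hx : GoodPt G μ α x) (V : Finset G) : 0 ≤ JV μ α V x :=
  integral_nonneg fun _ => hx.cI_nonneg _ _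

lemma integral_JV_nonneg (hmeas : ∀ g : G, Measurable (fun x : X => g • x)) {α : X → Fin k}
    (hα : Measurable α) (μ : Measure X) [IsProbabilityMeasure μ] (V : Finset G) :
    0 ≤ ∫ x, JV μ α V x ∂μ :=
  integral_nonneg_of_ae ((ae_good hmeas hα μ).mono fun _ hx => hx.JV_nonneg V)

lemma integral_JV_eq (hmeas : ∀ g : G, Measurable (fun x : X => g • x)) {α : X → Fin k}
    (hα : Measurable α) (μ ν : Measure X) [IsProbabilityMeasure ν] (V : Finset G) :
    ∫ x, JV μ α V x ∂ν = ∑ S ∈ V.powerset, ordW V S * ∫ x, cI μ α 1 S x ∂ν := by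
  unfold JV
  simp_rw [avgOrd_eq_sum]
  rw [integral_finsetSum _ fun S _ => (integrable_cI hmeas hα μ ν 1 S).const_mul _]
  simp_rw [integral_const_mul]

lemma integral_JV_le_log (hmeas : ∀ g : G, Measurable (fun x : X => g • x)) {α : X → Fin k}
    (hα : Measurable α) (μ : Measure X) [IsProbabilityMeasure μ] (V : Finset G) :
    ∫ x, JV μ α V x ∂μ ≤ Real.log k := by
  rw [integral_JV_eq hmeas hα μ μ V]
  calc _ ≤ ∑ S ∈ V.powerset, ordW V S * Real.log k := Finset.sum_le_sum fun S _ =>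
        mul_le_mul_of_nonneg_left (integral_cI_le_log hmeas hα μ 1 S) (ordW_nonneg _ _)
    _ = Real.log k := by rw [← Finset.sum_mul, ordW_sum, one_mul]

end RandomOrder

section Lower

variable {G : Type*} [Group G] [DecidableEq G] {X : Type*} [MeasurableSpace X] [MulAction G X]
  {k : ℕ}

/-- The `K`-boundary of `F`. -/
def bdry (K F : Finset G) : Finset G := F.filter fun g => ¬ K.image (· * g) ⊆ F

lemma bdry_card_le (K F : Finset G) :
    ((bdry K F).card : ℝ) ≤ ∑ v ∈ K, ((symmDiff F (F.image (v⁻¹ * ·))).card : ℝ) := by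
  have : bdry K F ⊆ K.biUnion fun v => symmDiff F (F.image (v⁻¹ * ·)) := by
    intro g hg
    obtain ⟨hgF, hg⟩ := Finset.mem_filter.1 hg
    rw [Finset.not_subset] at hg
    obtain ⟨w, hw, hwF⟩ := hg
    obtain ⟨v, hv, rfl⟩ := Finset.mem_image.1 hw
    refine Finset.mem_biUnion.2 ⟨v, hv, Finset.mem_symmDiff.2 (Or.inl ⟨hgF, ?_⟩)⟩
    intro h
    obtain ⟨u, hu, hug⟩ := Finset.mem_image.1 h
    apply hwF
    simp only [← hug, mul_inv_cancel_left]
    exact hu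
  exact_mod_cast (Finset.card_le_card this).trans Finset.card_biUnion_le

lemma bdry_tendsto {F : ℕ → Finset G} (hFol : IsFolnerSeq F) (K : Finset G) :
    Tendsto (fun n => ((bdry K (F n)).card : ℝ) / (F n).card) atTop (𝓝 0) := by
  have h : Tendsto (fun n => ∑ v ∈ K, ((symmDiff (F n) ((F n).image (v⁻¹ * ·))).card : ℝ) / (F n).card)
      atTop (𝓝 (∑ v ∈ K, 0)) := tendsto_finsetSum _ fun v _ => hFol.2 v⁻¹
  rw [Finset.sum_const_zero] at h
  refine squeeze_zero (fun n => by positivity) (fun n => ?_) h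
  rw [← Finset.sum_div]
  exact div_le_div_of_nonneg_right (bdry_card_le K (F n)) (by positivity)

lemma not_bdry {K F : Finset G} {g : G} (hg : g ∈ F) (h : g ∉ bdry K F) : K ⊆ F.image (· * g⁻¹) := by
  have : K.image (· * g) ⊆ F := by
    by_contra h'
    exact h (Finset.mem_filter.2 ⟨hg, h'⟩)
  intro v hv
  exact Finset.mem_image.2 ⟨v * g, this (Finset.mem_image_of_mem _ hv), by simp⟩

lemma InvariantMeasure.mp {μ : Measure X} (hinv : InvariantMeasure G μ)
    (hmeas : ∀ g : G, Measurable (fun x : X => g • x)) (g : G) :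
    MeasurePreserving (fun x => g • x) μ μ := ⟨hmeas g, hinv g⟩

lemma InvariantMeasure.integral_smul {μ : Measure X} (hinv : InvariantMeasure G μ)
    (hmeas : ∀ g : G, Measurable (fun x : X => g • x)) (g : G) {f : X → ℝ} (hf : Measurable f) :
    ∫ x, f (g • x) ∂μ = ∫ x, f x ∂μ := by
  have := integral_map (μ := μ) (hmeas g).aemeasurable (f := f)
    (by rw [hinv g]; exact hf.aestronglyMeasurable)
  rw [hinv g] at this
  exact this.symm

/-- Entropy as an infimum of averaged conditional entropies. -/
noncomputable def hInf (G : Type*) [Group G] [DecidableEq G] [MulAction G X] (μ : Measure X)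
    (α : X → Fin k) : ℝ :=
  ⨅ V : Finset G, ∫ x, JV μ α V x ∂μ

variable [Countable G]

lemma bddBelow_JV (hmeas : ∀ g : G, Measurable (fun x : X => g • x)) {α : X → Fin k}
    (hα : Measurable α) (μ : Measure X) [IsProbabilityMeasure μ] :
    BddBelow (range fun V : Finset G => ∫ x, JV μ α V x ∂μ) := by
  refine ⟨0, ?_⟩
  rintro _ ⟨V, rfl⟩
  exact integral_JV_nonneg hmeas hα μ V

lemma hInf_le (hmeas : ∀ g : G, Measurable (fun x : X => g • x)) {α : X → Fin k}
    (hα : Measurable α) (μ : Measure X) [IsProbabilityMeasure μ] (V : Finset G) :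
    hInf G μ α ≤ ∫ x, JV μ α V x ∂μ := ciInf_le (bddBelow_JV hmeas hα μ) V

lemma exists_lt_hInf {α : X → Fin k} (μ : Measure X) {ε : ℝ} (hε : 0 < ε) :
    ∃ V : Finset G, ∫ x, JV μ α V x ∂μ < hInf G μ α + ε :=
  exists_lt_of_ciInf_lt (lt_add_of_pos_right (hInf G μ α) hε)

lemma partitionEntropy_eq (hmeas : ∀ g : G, Measurable (fun x : X => g • x)) {α : X → Fin k}
    (hα : Measurable α) {μ : Measure X} [IsProbabilityMeasure μ] (hinv : InvariantMeasure G μ)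
    (F : Finset G) :
    partitionEntropy μ α F = ∑ g ∈ F, ∫ x, JV μ α (F.image (· * g⁻¹)) x ∂μ := by
  rw [← integral_LF hmeas hα μ F]
  simp_rw [chain_avg hmeas hα hinv F]
  rw [integral_finsetSum]
  · refine Finset.sum_congr rfl fun g _ => ?_
    exact hinv.integral_smul hmeas g (measurable_JV hmeas hα μ _)
  · intro g _
    obtain ⟨M, hM⟩ := bounded_JV μ α (F.image (· * g⁻¹))
    exact integrable_of_bdd ((measurable_JV hmeas hα μ _).comp (hmeas g)) ⟨M, fun x => hM _⟩

lemma partitionEntropy_nonneg (hmeas : ∀ g : G, Measurable (fun x : X => g • x)) {α : X → Fin k}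
    (hα : Measurable α) {μ : Measure X} [IsProbabilityMeasure μ] (F : Finset G) :
    0 ≤ partitionEntropy μ α F := by
  rw [← integral_LF hmeas hα μ F]
  exact integral_nonneg fun x => LF_nonneg μ α F x

lemma partitionEntropy_le (hmeas : ∀ g : G, Measurable (fun x : X => g • x)) {α : X → Fin k}
    (hα : Measurable α) {μ : Measure X} [IsProbabilityMeasure μ] (hinv : InvariantMeasure G μ)
    (F : Finset G) : partitionEntropy μ α F ≤ F.card * Real.log k := by
  rw [partitionEntropy_eq hmeas hα hinv, ← nsmul_eq_mul]
  exact Finset.sum_le_card_nsmul _ _ _ fun g _ => integral_JV_le_log hmeas hα μ _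

lemma entropy_tendsto (hmeas : ∀ g : G, Measurable (fun x : X => g • x)) {α : X → Fin k}
    (hα : Measurable α) {μ : Measure X} [IsProbabilityMeasure μ] (hinv : InvariantMeasure G μ)
    {F : ℕ → Finset G} (hFol : IsFolnerSeq F) :
    Tendsto (fun n => partitionEntropy μ α (F n) / (F n).card) atTop (𝓝 (hInf G μ α)) := by
  have hpos : ∀ n, (0 : ℝ) < (F n).card := fun n => by exact_mod_cast (hFol.1 n).card_pos
  have hlk : 0 ≤ Real.log k := Real.log_natCast_nonneg k
  have hlow : ∀ n, hInf G μ α ≤ partitionEntropy μ α (F n) / (F n).card := by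
    intro n
    rw [le_div_iff₀ (hpos n), partitionEntropy_eq hmeas hα hinv, mul_comm, ← nsmul_eq_mul]
    exact Finset.card_nsmul_le_sum _ _ _ fun g _ => hInf_le hmeas hα μ _
  have hup : ∀ (K : Finset G) n, partitionEntropy μ α (F n) / (F n).card ≤
      ∫ x, JV μ α K x ∂μ + ((bdry K (F n)).card : ℝ) / (F n).card * Real.log k := by
    intro K n
    rw [div_le_iff₀ (hpos n), partitionEntropy_eq hmeas hα hinv]
    calc _ ≤ ∑ g ∈ F n, (∫ x, JV μ α K x ∂μ + if g ∈ bdry K (F n) then Real.log k else 0) := by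
          refine Finset.sum_le_sum fun g hg => ?_
          split_ifs with h
          · have := integral_JV_le_log hmeas hα μ ((F n).image (· * g⁻¹))
            have := integral_JV_nonneg hmeas hα μ K
            linarith
          · rw [add_zero]
            exact integral_JV_anti hmeas hα μ (not_bdry hg h)
      _ = (F n).card * ∫ x, JV μ α K x ∂μ + (bdry K (F n)).card * Real.log k := by
          rw [Finset.sum_add_distrib, Finset.sum_const, nsmul_eq_mul, ← Finset.sum_filter,
            Finset.sum_const, nsmul_eq_mul]
          congr 4
          exact Finset.filter_mem_eq_inter.trans (Finset.inter_eq_right.2 (Finset.filter_subset _ _))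
      _ = _ := by
          have := (hpos n).ne'
          field_simp
  rw [Metric.tendsto_atTop]
  intro ε hε
  obtain ⟨K, hK⟩ := exists_lt_hInf (G := G) (α := α) μ (half_pos hε)
  have hb := ((bdry_tendsto hFol K).mul_const (Real.log k))
  rw [zero_mul] at hb
  obtain ⟨N, hN⟩ := (hb.eventually (gt_mem_nhds (half_pos hε))).exists_forall_of_atTop
  refine ⟨N, fun n hn => ?_⟩
  rw [Real.dist_eq, abs_of_nonneg (sub_nonneg.2 (hlow n))]
  have := hup K n
  have := hN n hn
  linarith

lemma dynEntropy_eq (hmeas : ∀ g : G, Measurable (fun x : X => g • x)) {α : X → Fin k}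
    (hα : Measurable α) {μ : Measure X} [IsProbabilityMeasure μ] (hinv : InvariantMeasure G μ)
    {F : ℕ → Finset G} (hFol : IsFolnerSeq F) :
    partitionDynEntropy F μ α = hInf G μ α :=
  (entropy_tendsto hmeas hα hinv hFol).limsup_eq

/-- The limit of the averaged conditional information functions. -/
lemma exists_Jinf (hmeas : ∀ g : G, Measurable (fun x : X => g • x)) {α : X → Fin k}
    (hα : Measurable α) (μ : Measure X) [IsProbabilityMeasure μ] :
    ∃ J : X → ℝ, Measurable J ∧ Integrable J μ ∧ (∀ᵐ x ∂μ, 0 ≤ J x) ∧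
      (∀ ε > 0, ∃ V : Finset G, ∀ V', V ⊆ V' → ∫ x, |JV μ α V' x - J x| ∂μ ≤ ε) ∧
      ∫ x, J x ∂μ = hInf G μ α := by
  set u : Finset G → (X →₁[μ] ℝ) := fun V => (integrable_JV hmeas hα μ μ V).toL1 _ with hu
  have hdist : ∀ V V', dist (u V') (u V) = ∫ x, |JV μ α V' x - JV μ α V x| ∂μ := by
    intro V V'
    rw [L1.dist_eq_integral_dist]
    refine integral_congr_ae ?_
    filter_upwards [(integrable_JV hmeas hα μ μ V).coeFn_toL1,
      (integrable_JV hmeas hα μ μ V').coeFn_toL1] with x h1 h2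
    rw [h1, h2, Real.dist_eq]
  have hc : CauchySeq u := by
    rw [Metric.cauchySeq_iff']
    intro ε hε
    have hpos : 0 < 2 / (ε / 3) + 1 := by positivity
    obtain ⟨V, hV⟩ := exists_lt_hInf (G := G) (α := α) μ
      (show 0 < (ε / 3) / (2 / (ε / 3) + 1) by positivity)
    refine ⟨V, fun V' hV' => ?_⟩
    rw [hdist]
    have h1 := l1_JV hmeas hα μ hV' (ε / 3) (by positivity)
    have h2 := hInf_le hmeas hα μ V'
    have h3 : (2 / (ε / 3) + 1) * (∫ x, JV μ α V x ∂μ - ∫ x, JV μ α V' x ∂μ) ≤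
        (2 / (ε / 3) + 1) * ((ε / 3) / (2 / (ε / 3) + 1)) :=
      mul_le_mul_of_nonneg_left (by linarith) hpos.le
    rw [mul_div_cancel₀ _ hpos.ne'] at h3
    linarith
  obtain ⟨J, hJ⟩ := cauchySeq_tendsto_of_complete hc
  have hJi : Integrable (J : X → ℝ) μ := L1.integrable_coeFn J
  have happ : ∀ ε > 0, ∃ V : Finset G, ∀ V', V ⊆ V' → ∫ x, |JV μ α V' x - J x| ∂μ ≤ ε := by
    intro ε hε
    obtain ⟨V, hV⟩ := Metric.tendsto_atTop.1 hJ ε hε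
    refine ⟨V, fun V' hV' => ?_⟩
    have := (hV V' hV').le
    rw [L1.dist_eq_integral_dist] at this
    refine le_trans (le_of_eq (integral_congr_ae ?_)) this
    filter_upwards [(integrable_JV hmeas hα μ μ V').coeFn_toL1] with x h1
    rw [h1, Real.dist_eq]
  refine ⟨J, (Lp.stronglyMeasurable J).measurable, hJi, ?_, happ, ?_⟩
  · have h0 : ∫ x, max (-(J x)) 0 ∂μ = 0 := by
      refine le_antisymm (le_of_forall_pos_le_add fun ε hε => ?_)
        (integral_nonneg fun x => le_max_right _ _)
      obtain ⟨V, hV⟩ := happ ε hε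
      rw [zero_add]
      refine le_trans (integral_mono_ae (hJi.neg.sup (integrable_zero _ _ _))
        ((integrable_JV hmeas hα μ μ V).sub hJi).abs ?_) (hV V subset_rfl)
      filter_upwards [ae_good hmeas hα μ] with x hx
      have := hx.JV_nonneg V
      show max (-(J x)) 0 ≤ |JV μ α V x - J x|
      refine max_le ?_ (abs_nonneg _)
      have := le_abs_self (JV μ α V x - J x)
      linarith
    have hI : Integrable (fun x => max (-(J x)) 0) μ := hJi.neg.sup (integrable_zero _ _ _)
    have h0' := (integral_eq_zero_iff_of_nonneg (μ := μ) (f := fun x => max (-(J x)) 0)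
      (fun x => le_max_right _ _) hI).1 h0
    filter_upwards [h0'] with x hx
    have h1 : max (-(J x)) 0 = 0 := hx
    have := le_max_left (-(J x)) 0
    linarith
  · refine eq_of_forall_dist_le fun ε hε => ?_
    obtain ⟨V, hV⟩ := happ (ε / 2) (half_pos hε)
    obtain ⟨V', hV'⟩ := exists_lt_hInf (G := G) (α := α) μ (half_pos hε)
    have h1 := hV (V ∪ V') Finset.subset_union_left
    have h2 := integral_JV_anti hmeas hα μ (Finset.subset_union_right (s₁ := V) (s₂ := V'))
    have h3 := hInf_le hmeas hα μ (V ∪ V')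
    have h4 : |∫ x, JV μ α (V ∪ V') x ∂μ - ∫ x, J x ∂μ| ≤ ε / 2 := by
      rw [← integral_sub (integrable_JV hmeas hα μ μ _) hJi]
      exact (abs_integral_le_integral_abs).trans h1
    rw [Real.dist_eq, abs_le]
    rw [abs_le] at h4
    constructor <;> linarith [h4.1, h4.2]


lemma summable_exp_growth {F : ℕ → Finset G} (hGrow : GrowthCond F) {ε : ℝ} (hε : 0 < ε) :
    Summable (fun n => Real.exp (-(ε * (F n).card))) := by
  have h2 : Summable (fun n : ℕ => 1 / (n : ℝ) ^ 2) := Real.summable_one_div_nat_pow.2 one_lt_two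
  refine Summable.of_norm_bounded_eventually_nat h2 ?_
  filter_upwards [hGrow.eventually_ge_atTop (2 / ε), eventually_ge_atTop 2] with n hn hn2
  have hlog : 0 < Real.log n := Real.log_pos (by exact_mod_cast hn2)
  rw [Real.norm_of_nonneg (Real.exp_nonneg _)]
  have hn0 : (0 : ℝ) < n := by positivity
  rw [le_div_iff₀ hlog] at hn
  have : 2 * Real.log n ≤ ε * (F n).card := by
    calc 2 * Real.log n = ε * (2 / ε * Real.log n) := by field_simp
      _ ≤ _ := mul_le_mul_of_nonneg_left hn hε.le
  calc Real.exp (-(ε * (F n).card)) ≤ Real.exp (-(2 * Real.log n)) :=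
        Real.exp_le_exp.2 (neg_le_neg this)
    _ = 1 / (n : ℝ) ^ 2 := by
        rw [Real.exp_neg, one_div, mul_comm, Real.exp_mul, Real.exp_log hn0]
        norm_cast


/-- Borel-Cantelli for exponential estimates. -/
lemma exp_BC {X : Type*} [MeasurableSpace X] {F : ℕ → Finset G} (hGrow : GrowthCond F) (μ : Measure X) (U : ℕ → X → ℝ)
    (hm : ∀ n, Measurable (U n)) (h : ∀ n, ∫⁻ x, ENNReal.ofReal (Real.exp (U n x)) ∂μ ≤ 1) :
    ∀ᵐ x ∂μ, ∀ ε > 0, ∀ᶠ n in atTop, U n x ≤ ε * (F n).card := by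
  have key : ∀ j : ℕ, ∀ᵐ x ∂μ, ∀ᶠ n in atTop, U n x ≤ (1 / ((j : ℝ) + 1)) * (F n).card := by
    intro j
    set ε : ℝ := 1 / ((j : ℝ) + 1)
    have hε : 0 < ε := by positivity
    have hs := summable_exp_growth hGrow hε
    have hmm : ∀ n, Measurable (fun x => ENNReal.ofReal (Real.exp (U n x - ε * (F n).card))) :=
      fun n => ((hm n).sub_const _).exp.ennreal_ofReal
    have h1 : ∫⁻ x, ∑' n, ENNReal.ofReal (Real.exp (U n x - ε * (F n).card)) ∂μ ≠ ⊤ := by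
      rw [lintegral_tsum fun n => (hmm n).aemeasurable]
      refine ne_top_of_le_ne_top hs.tsum_ofReal_ne_top (ENNReal.tsum_le_tsum fun n => ?_)
      calc ∫⁻ x, ENNReal.ofReal (Real.exp (U n x - ε * (F n).card)) ∂μ
          = ∫⁻ x, ENNReal.ofReal (Real.exp (-(ε * (F n).card))) *
            ENNReal.ofReal (Real.exp (U n x)) ∂μ := by
            refine lintegral_congr fun x => ?_
            rw [← ENNReal.ofReal_mul (Real.exp_nonneg _), ← Real.exp_add]
            congr 2; ring
        _ ≤ ENNReal.ofReal (Real.exp (-(ε * (F n).card))) * 1 := by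
            rw [lintegral_const_mul' _ _ ENNReal.ofReal_ne_top]
            gcongr
            exact h n
        _ = _ := mul_one _
    filter_upwards [ae_lt_top (Measurable.ennreal_tsum hmm) h1] with x hx
    have h2 := ENNReal.tendsto_atTop_zero_of_tsum_ne_top hx.ne
    filter_upwards [h2.eventually (gt_mem_nhds zero_lt_one)] with n hn
    have : Real.exp (U n x - ε * (F n).card) ≤ 1 := by
      by_contra hc
      push Not at hc
      have := (ENNReal.ofReal_lt_one.1 hn)
      linarith
    have := Real.exp_le_one_iff.1 this
    linarith
  rw [← ae_all_iff] at key
  filter_upwards [key] with x hx ε hε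
  obtain ⟨j, hj⟩ := exists_nat_one_div_lt hε
  filter_upwards [hx j] with n hn
  exact hn.trans (mul_le_mul_of_nonneg_right hj.le (by positivity))

/-- Lower bound. -/
lemma lower_bound (hmeas : ∀ g : G, Measurable (fun x : X => g • x)) {α : X → Fin k}
    (hα : Measurable α) {μ : Measure X} [IsProbabilityMeasure μ] (hinv : InvariantMeasure G μ)
    {F : ℕ → Finset G} (hFol : IsFolnerSeq F) (hGrow : GrowthCond F) {J : X → ℝ}
    (hJm : Measurable J) (hJi : Integrable J μ)
    (happ : ∀ ε > 0, ∃ V : Finset G, ∀ V', V ⊆ V' → ∫ x, |JV μ α V' x - J x| ∂μ ≤ ε) :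
    ∀ᵐ x ∂μ, ∀ ε > 0, ∀ᶠ n in atTop, ergAvg (F n) J x - ε ≤ LF μ α (F n) x / (F n).card := by
  have hpos : ∀ n, (0 : ℝ) < (F n).card := fun n => by exact_mod_cast (hFol.1 n).card_pos
  have hV : ∀ n : ℕ, ∃ V : Finset G, ∀ V', V ⊆ V' →
      ∫ x, |JV μ α V' x - J x| ∂μ ≤ (1 / 2) ^ n / (F n).card := fun n =>
    happ _ (by have := hpos n; positivity)
  choose V hV using hV
  set W : ℕ → Finset G := fun n => F n ∪ (F n).biUnion fun g => (V n).image (· * g)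
  have hFW : ∀ n, F n ⊆ W n := fun n => Finset.subset_union_left
  have hVW : ∀ n, ∀ g ∈ F n, V n ⊆ (W n).image (· * g⁻¹) := by
    intro n g hg v hv
    refine Finset.mem_image.2 ⟨v * g, Finset.mem_union_right _ (Finset.mem_biUnion.2
      ⟨g, hg, Finset.mem_image_of_mem _ hv⟩), by simp⟩
  set D : ℕ → X → ℝ := fun n x => ∑ g ∈ F n, |JV μ α ((W n).image (· * g⁻¹)) (g • x) - J (g • x)|
  have hDm : ∀ n, Measurable (D n) := fun n => Finset.measurable_sum _ fun g _ =>
    (((measurable_JV hmeas hα μ _).comp (hmeas g)).sub (hJm.comp (hmeas g))).abs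
  have hDi0 : ∀ n g, Integrable (fun x => |JV μ α ((W n).image (· * g⁻¹)) (g • x) - J (g • x)|) μ := by
    intro n g
    have := ((integrable_JV hmeas hα μ μ ((W n).image (· * g⁻¹))).sub hJi).abs
    exact ((hinv.mp hmeas g).integrable_comp this.aestronglyMeasurable).2 this
  have hDi : ∀ n, Integrable (D n) μ := fun n => integrable_finsetSum _ fun g _ => hDi0 n g
  have hD0 : ∀ n x, 0 ≤ D n x := fun n x => Finset.sum_nonneg fun _ _ => abs_nonneg _
  have hD : ∀ n, ∫ x, D n x ∂μ ≤ (1 / 2) ^ n := by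
    intro n
    simp only [D]
    rw [integral_finsetSum _ fun g _ => hDi0 n g]
    calc _ ≤ ∑ g ∈ F n, (1 / 2 : ℝ) ^ n / (F n).card := by
          refine Finset.sum_le_sum fun g hg => ?_
          refine le_trans (le_of_eq ?_) (hV n _ (hVW n g hg))
          exact hinv.integral_smul hmeas g (f := fun x => |JV μ α ((W n).image (· * g⁻¹)) x - J x|)
            ((measurable_JV hmeas hα μ _).sub hJm).abs
      _ = (1 / 2) ^ n := by
          rw [Finset.sum_const, nsmul_eq_mul]
          have := (hpos n).ne'
          field_simp
  have hDt : ∀ᵐ x ∂μ, Tendsto (fun n => ENNReal.ofReal (D n x)) atTop (𝓝 0) := by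
    have h1 : ∫⁻ x, ∑' n, ENNReal.ofReal (D n x) ∂μ ≠ ⊤ := by
      rw [lintegral_tsum fun n => (hDm n).ennreal_ofReal.aemeasurable]
      have hs : Summable (fun n : ℕ => (1 / 2 : ℝ) ^ n) := summable_geometric_two
      refine ne_top_of_le_ne_top hs.tsum_ofReal_ne_top (ENNReal.tsum_le_tsum fun n => ?_)
      rw [← ofReal_integral_eq_lintegral_ofReal (hDi n) (ae_of_all _ (hD0 n))]
      exact ENNReal.ofReal_le_ofReal (hD n)
    filter_upwards [ae_lt_top (Measurable.ennreal_tsum fun n => (hDm n).ennreal_ofReal) h1] with x hx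
    exact ENNReal.tendsto_atTop_zero_of_tsum_ne_top hx.ne
  have hU := exp_BC hGrow μ
    (fun n x => ∑ g ∈ F n, JV μ α ((W n).image (· * g⁻¹)) (g • x) - LF μ α (F n) x)
    (fun n => (Finset.measurable_sum _ fun g _ => (measurable_JV hmeas hα μ _).comp (hmeas g)).sub
      (measurable_LF hmeas hα μ _)) (fun n => lower_avg hmeas hα hinv (hFW n))
  filter_upwards [hDt, hU] with x hx1 hx2 ε hε
  filter_upwards [hx2 (ε / 2) (half_pos hε),
    hx1.eventually (gt_mem_nhds (ENNReal.ofReal_pos.2 (half_pos hε)))] with n h1 h2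
  have h3 : D n x < ε / 2 := (ENNReal.ofReal_lt_ofReal_iff (half_pos hε)).1 h2
  have h4 : ∑ g ∈ F n, J (g • x) ≤ ∑ g ∈ F n, JV μ α ((W n).image (· * g⁻¹)) (g • x) + D n x := by
    rw [← Finset.sum_add_distrib]
    refine Finset.sum_le_sum fun g _ => ?_
    have := neg_abs_le (JV μ α ((W n).image (· * g⁻¹)) (g • x) - J (g • x))
    linarith
  have hc1 : (1 : ℝ) ≤ (F n).card := by exact_mod_cast (hFol.1 n).card_pos
  unfold ergAvg
  rw [le_div_iff₀ (hpos n), sub_mul, div_mul_cancel₀ _ (hpos n).ne']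
  have h5 : ε / 2 ≤ ε / 2 * (F n).card := le_mul_of_one_le_right (half_pos hε).le hc1
  linarith

end Lower

section Upper

variable {G : Type*} [Group G] [DecidableEq G] {X : Type*} [MeasurableSpace X] [MulAction G X]
  {k : ℕ}

/-- A cost function depending on the past, read at a point. -/
def costAt (α : X → Fin k) (τ : Finset G → (G → Fin k) → ℝ) (S : Finset G) (x : X) : ℝ :=
  τ S (cfg α x)

lemma one_notMem_before (ω : G → unitInterval) (K : Finset G) (g : G) : g ∉ before ω K g := by
  simp [before]

lemma cfg_smul (α : X → Fin k) (g : G) (x : X) : cfg α (g • x) = fun h => cfg α x (h * g) := by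
  ext h; simp [cfg, mul_smul]

variable [Countable G]

lemma upper_avg (hmeas : ∀ g : G, Measurable (fun x : X => g • x)) {α : X → Fin k}
    (hα : Measurable α) {μ : Measure X} [IsProbabilityMeasure μ] (K F : Finset G)
    (τ : Finset G → (G → Fin k) → ℝ)
    (hdep : ∀ S, DependsOn (τ S) ((insert 1 S : Finset G) : Set G))
    (hsum : ∀ S, (1 : G) ∉ S → ∀ c, ∑ a, Real.exp (-τ S (Function.update c 1 a)) ≤ 1) :
    ∫⁻ x, ENNReal.ofReal (Real.exp (LF μ α F x - ∑ g ∈ F, if g ∈ bdry K F then Real.log k else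
      avgOrd K (costAt α τ) (g • x))) ∂μ ≤ 1 := by
  obtain ⟨x0⟩ : Nonempty X := nonempty_of_isProbabilityMeasure μ
  have hk : 0 < k := Fin.pos (α x0)
  have hk' : (0 : ℝ) < k := by exact_mod_cast hk
  have hcm : ∀ S, Measurable (costAt α τ S) := fun S =>
    measurable_dep hmeas hα (insert 1 S) (hdep S)
  obtain ⟨M, hM⟩ := bounded_before_comp (f := costAt α τ)
    (fun S => bounded_dep α (insert 1 S) (hdep S)) K 1
  obtain ⟨N, hN⟩ := bounded_LF μ α F
  have hm1 : ∀ g : G, Measurable (fun p : (G → unitInterval) × X =>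
      costAt α τ (before (fun h => p.1 (h * g)) K 1) (g • p.2)) := by
    intro g
    have := measurable_before_comp (f := costAt α τ) hcm K 1
    exact this.comp (f := fun p : (G → unitInterval) × X => (fun h => p.1 (h * g), g • p.2))
      (((ordP_shift g).measurable.comp measurable_fst).prodMk ((hmeas g).comp measurable_snd))
  have := exp_average (ordP G) μ (fun ω x => LF μ α F x - ∑ g ∈ F, if g ∈ bdry K F then Real.log k
      else costAt α τ (before (fun h => ω (h * g)) K 1) (g • x))
    (by
      refine Measurable.sub ((measurable_LF hmeas hα μ F).comp measurable_snd)
        (Finset.measurable_sum _ fun g _ => ?_)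
      by_cases h : g ∈ bdry K F
      · simp only [h, if_true]; exact measurable_const
      · simp only [h, if_false]; exact hm1 g)
    ⟨N + ∑ g ∈ F, (|Real.log k| + M), fun ω x => by
      refine (abs_sub _ _).trans (add_le_add (hN x) ?_)
      refine (Finset.abs_sum_le_sum_abs _ _).trans (Finset.sum_le_sum fun g _ => ?_)
      have h1 := hM (fun h => ω (h * g)) (g • x)
      have h2 := abs_nonneg (costAt α τ (before (fun h => ω (h * g)) K 1) (g • x))
      have h3 := abs_nonneg (Real.log k)
      split_ifs <;> linarith⟩
    (by
      filter_upwards [ordP_injective] with ω hω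
      have := upper_exp hmeas hα μ ω hω (fun g c => if g ∈ bdry K F then Real.log k
        else τ (before (fun h => ω (h * g)) K 1) (fun h => c (h * g)))
        (by
          intro g c
          by_cases h : g ∈ bdry K F
          · simp only [h, if_true]
            rw [Real.exp_neg, Real.exp_log hk']
            simp [hk'.ne']
          · simp only [h, if_false]
            have e : ∀ a, (fun h => Function.update c g a (h * g)) =
                Function.update (fun h => c (h * g)) 1 a := by
              intro a
              ext h
              by_cases e : h = 1
              · simp [e]
              · rw [Function.update_of_ne e, Function.update_of_ne]
                simpa using e
            simp_rw [e]
            exact hsum _ (one_notMem_before (fun h => ω (h * g)) K 1) _) F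
        (by
          intro g hg c c' hc
          by_cases h : g ∈ bdry K F
          · simp only [h, if_true]
          · simp only [h, if_false]
            refine hdep _ fun i hi => hc _ ?_
            have hsub : K.image (· * g) ⊆ F := by
              by_contra h'
              exact h (Finset.mem_filter.2 ⟨hg, h'⟩)
            have hi' : i ∈ insert 1 (before (fun h => ω (h * g)) K 1) := hi
            show i * g ∈ insert g (before ω F g)
            rcases Finset.mem_insert.1 hi' with rfl | hi'
            · simp
            · refine Finset.mem_insert_of_mem ?_
              have h2 := Finset.mem_filter.1 hi'
              refine Finset.mem_filter.2 ⟨hsub (Finset.mem_image_of_mem _ h2.1), ?_⟩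
              simpa using h2.2)
      refine le_trans (le_of_eq (lintegral_congr fun x => ?_)) this
      simp only [costAt, cfg_smul])
  refine le_trans (le_of_eq (lintegral_congr fun x => ?_)) this
  have hi : ∀ g ∈ F, Integrable (fun ω : G → unitInterval => if g ∈ bdry K F then Real.log k
      else costAt α τ (before (fun h => ω (h * g)) K 1) (g • x)) (ordP G) := by
    intro g _
    by_cases h : g ∈ bdry K F
    · simp only [h, if_true]; exact integrable_const _
    · simp only [h, if_false]
      refine integrable_of_bdd ?_ ⟨M, fun ω => hM _ _⟩
      exact (measurable_before_fix (fun S => costAt α τ S (g • x)) K 1).comp (ordP_shift g).measurable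
  rw [integral_sub (integrable_const _) (integrable_finsetSum _ hi), integral_finsetSum _ hi]
  congr 2
  simp only [integral_const, probReal_univ, smul_eq_mul, one_mul]
  congr 1
  refine Finset.sum_congr rfl fun g _ => ?_
  by_cases h : g ∈ bdry K F
  · simp [h]
  · simp only [h, if_false]
    unfold avgOrd
    rw [← integral_map (μ := ordP G) (φ := fun (ω : G → unitInterval) h => ω (h * g))
      (f := fun ω => costAt α τ (before ω K 1) (g • x))
      (ordP_shift g).measurable.aemeasurable
      (measurable_before_fix (fun S => costAt α τ S (g • x)) K 1).aestronglyMeasurable,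
      (ordP_shift g).map_eq]

/-- Codes. -/
abbrev Code (k : ℕ) (K : Finset G) : Type _ :=
  ∀ S : K.powerset, (((insert 1 (S : Finset G) : Finset G) : Type _) → Fin k) → ℕ

/-- The cost of a code. -/
noncomputable def codeCost (K : Finset G) (N : ℕ) (t : Code k K) (S : Finset G) (c : G → Fin k) : ℝ :=
  if h : S ∈ K.powerset then (t ⟨S, h⟩ (fun v => c v) : ℝ) / N else Real.log k

lemma dependsOn_codeCost (K : Finset G) (N : ℕ) (t : Code k K) (S : Finset G) :
    DependsOn (codeCost K N t S) ((insert 1 S : Finset G) : Set G) := by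
  intro c c' h
  unfold codeCost
  split_ifs with hS
  · congr 3
    ext v
    rw [h v v.2]
  · rfl

lemma codeCost_nonneg (K : Finset G) (N : ℕ) (t : Code k K) (S : Finset G) (c : G → Fin k) :
    0 ≤ codeCost K N t S c := by
  unfold codeCost
  split_ifs
  · positivity
  · exact Real.log_natCast_nonneg k

/-- Kraft condition. -/
def Kraft (K : Finset G) (N : ℕ) (t : Code k K) : Prop :=
  ∀ S, (1 : G) ∉ S → ∀ c, ∑ a, Real.exp (-codeCost K N t S (Function.update c 1 a)) ≤ 1

lemma avgCost_nonneg (α : X → Fin k) (K : Finset G) (N : ℕ) (t : Code k K) (x : X) :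
    0 ≤ avgOrd K (costAt α (codeCost K N t)) x :=
  integral_nonneg fun _ => codeCost_nonneg _ _ _ _ _

lemma measurable_avgCost (hmeas : ∀ g : G, Measurable (fun x : X => g • x)) {α : X → Fin k}
    (hα : Measurable α) (K : Finset G) (N : ℕ) (t : Code k K) :
    Measurable (avgOrd K (costAt α (codeCost K N t))) :=
  measurable_avgOrd (fun S => measurable_dep hmeas hα _ (dependsOn_codeCost K N t S)) K

lemma bounded_avgCost (α : X → Fin k) (K : Finset G) (N : ℕ) (t : Code k K) :
    ∃ M, ∀ x, |avgOrd K (costAt α (codeCost K N t)) x| ≤ M :=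
  bounded_avgOrd (fun S => bounded_dep α _ (dependsOn_codeCost K N t S)) K

lemma upper_code (hmeas : ∀ g : G, Measurable (fun x : X => g • x)) {α : X → Fin k}
    (hα : Measurable α) {μ : Measure X} [IsProbabilityMeasure μ]
    {F : ℕ → Finset G} (hFol : IsFolnerSeq F) (hGrow : GrowthCond F) :
    ∀ᵐ x ∂μ, ∀ (K : Finset G) (N : ℕ) (t : Code k K), Kraft K N t → ∀ ε > 0, ∀ᶠ n in atTop,
      LF μ α (F n) x / (F n).card ≤ ergAvg (F n) (avgOrd K (costAt α (codeCost K N t))) x + ε := by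
  have hpos : ∀ n, (0 : ℝ) < (F n).card := fun n => by exact_mod_cast (hFol.1 n).card_pos
  have hlk : 0 ≤ Real.log k := Real.log_natCast_nonneg k
  rw [ae_all_iff]; intro K
  rw [ae_all_iff]; intro N
  rw [ae_all_iff]; intro t
  by_cases hK : Kraft K N t
  swap
  · exact ae_of_all _ fun x h => (hK h).elim
  have hU := exp_BC hGrow μ (fun n x => LF μ α (F n) x - ∑ g ∈ F n,
      if g ∈ bdry K (F n) then Real.log k else avgOrd K (costAt α (codeCost K N t)) (g • x))
    (fun n => by
      refine (measurable_LF hmeas hα μ _).sub (Finset.measurable_sum _ fun g _ => ?_)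
      by_cases h : g ∈ bdry K (F n)
      · simp only [h, if_true]; exact measurable_const
      · simp only [h, if_false]; exact (measurable_avgCost hmeas hα K N t).comp (hmeas g))
    (fun n => upper_avg hmeas hα K (F n) _ (dependsOn_codeCost K N t) hK)
  filter_upwards [hU] with x hx _ ε hε
  have hb := ((bdry_tendsto hFol K).mul_const (Real.log k))
  rw [zero_mul] at hb
  filter_upwards [hx (ε / 2) (half_pos hε), hb.eventually (gt_mem_nhds (half_pos hε))] with n h1 h2
  have h3 : ∑ g ∈ F n, (if g ∈ bdry K (F n) then Real.log k else
      avgOrd K (costAt α (codeCost K N t)) (g • x)) ≤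
      ∑ g ∈ F n, avgOrd K (costAt α (codeCost K N t)) (g • x) + (bdry K (F n)).card * Real.log k := by
    calc _ ≤ ∑ g ∈ F n, (avgOrd K (costAt α (codeCost K N t)) (g • x) +
          if g ∈ bdry K (F n) then Real.log k else 0) := by
          refine Finset.sum_le_sum fun g hg => ?_
          have := avgCost_nonneg α K N t (g • x)
          split_ifs <;> linarith
      _ = _ := by
          rw [Finset.sum_add_distrib, ← Finset.sum_filter,
            Finset.sum_const, nsmul_eq_mul]
          congr 4
          exact Finset.filter_mem_eq_inter.trans (Finset.inter_eq_right.2 (Finset.filter_subset _ _))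
  unfold ergAvg
  rw [div_le_iff₀ (hpos n), add_mul, div_mul_cancel₀ _ (hpos n).ne']
  have h4 : ((bdry K (F n)).card : ℝ) * Real.log k ≤ ε / 2 * (F n).card := by
    rw [div_mul_eq_mul_div, div_lt_iff₀ (hpos n)] at h2
    exact h2.le
  linarith

lemma ordW_of_mem {K S : Finset G} (h : (1 : G) ∈ S) : ordW K S = 0 := by
  unfold ordW
  have : {ω : G → unitInterval | before ω K 1 = S} = ∅ := by
    ext ω
    simp only [mem_setOf_eq, mem_empty_iff_false, iff_false]
    rintro rfl
    exact one_notMem_before ω K 1 h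
  rw [this]; simp

/-- Near-optimal codes exist. -/
lemma exists_code (hmeas : ∀ g : G, Measurable (fun x : X => g • x)) {α : X → Fin k}
    (hα : Measurable α) (ν : Measure X) [IsProbabilityMeasure ν] (K : Finset G) {ε : ℝ} (hε : 0 < ε) :
    ∃ (N : ℕ) (t : Code k K), Kraft K N t ∧
      ∫ x, avgOrd K (costAt α (codeCost K N t)) x ∂ν ≤ ∫ x, JV ν α K x ∂ν + ε := by
  obtain ⟨x0⟩ : Nonempty X := nonempty_of_isProbabilityMeasure ν
  have hk : 0 < k := Fin.pos (α x0)
  have hk' : (0 : ℝ) < k := by exact_mod_cast hk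
  have hk1 : (1 : ℝ) ≤ k := by exact_mod_cast hk
  set η : ℝ := ε / (2 * k)
  have hη : 0 < η := by positivity
  obtain ⟨N, hN⟩ := exists_nat_gt (2 / ε)
  have hN0 : (0 : ℝ) < N := lt_trans (by positivity) hN
  have hden : 0 < 1 + k * η := by positivity
  set q : Finset G → (G → Fin k) → ℝ := fun S c => (cylM ν α (insert 1 S) c / cylM ν α S c).toReal
    with hq
  have hq0 : ∀ S c, 0 ≤ q S c := fun S c => ENNReal.toReal_nonneg
  have hqle : ∀ (S : Finset G) (c : G → Fin k), cylM ν α (insert 1 S) c / cylM ν α S c ≤ 1 := fun S c =>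
    ENNReal.div_le_of_le_mul (by rw [one_mul]; exact cylM_anti ν α (Finset.subset_insert _ _) c)
  have hq1 : ∀ S c, q S c ≤ 1 := fun S c =>
    ENNReal.toReal_le_of_le_ofReal zero_le_one (by simpa using hqle S c)
  have hqsum : ∀ S, (1 : G) ∉ S → ∀ c, ∑ a, q S (Function.update c 1 a) ≤ 1 := by
    intro S hS c
    simp only [hq]
    rw [← ENNReal.toReal_sum (fun a _ => ne_top_of_le_ne_top ENNReal.one_ne_top (hqle _ _))]
    refine ENNReal.toReal_le_of_le_ofReal zero_le_one ?_
    rw [ENNReal.ofReal_one]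
    have h1 : ∀ b, cylM ν α S (Function.update c 1 b) = cylM ν α S c := by
      intro b
      refine cylM_congr _ _ _ fun g hg => ?_
      rw [Function.update_of_ne]
      rintro rfl; exact hS hg
    simp_rw [h1, div_eq_mul_inv]
    rw [← Finset.sum_mul, cylM_sum hmeas hα ν _ 1 hS, ← div_eq_mul_inv]
    exact ENNReal.div_self_le_one
  set pt : Finset G → (G → Fin k) → ℝ := fun S c => (q S c + η) / (1 + k * η)
  have hpt0 : ∀ S c, 0 < pt S c := fun S c => div_pos (by have := hq0 S c; linarith) hden
  have hpt1 : ∀ S c, pt S c ≤ 1 := by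
    intro S c
    refine (div_le_one hden).2 ?_
    have := hq1 S c
    nlinarith
  set cext : ∀ S : Finset G, (((insert 1 S : Finset G) : Type _) → Fin k) → (G → Fin k) :=
    fun S w => extPat (cfg α x0) (insert 1 S) w
  set t : Code k K := fun S w => ⌈(N : ℝ) * (-Real.log (pt S (cext S w)))⌉₊
  have hpd : ∀ S c, pt S (cext S (fun v => c v)) = pt S c := by
    intro S c
    have h1 : ∀ g ∈ insert 1 S, cext S (fun v => c v) g = c g := by
      intro g hg
      simp only [cext, extPat, hg, dif_pos]
    simp only [pt, hq]
    rw [cylM_congr ν α (insert 1 S) h1,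
      cylM_congr ν α S fun g hg => h1 g (Finset.mem_insert_of_mem hg)]
  have hcost : ∀ S c, S ∈ K.powerset → codeCost K N t S c =
      (⌈(N : ℝ) * (-Real.log (pt S c))⌉₊ : ℝ) / N := by
    intro S c hS
    simp only [codeCost, hS, dif_pos, t]
    rw [hpd]
  refine ⟨N, t, ?_, ?_⟩
  · intro S hS c
    by_cases hSK : S ∈ K.powerset
    · calc _ ≤ ∑ a, pt S (Function.update c 1 a) := by
            refine Finset.sum_le_sum fun a _ => ?_
            rw [hcost S _ hSK]
            have h1 := Nat.le_ceil ((N : ℝ) * (-Real.log (pt S (Function.update c 1 a))))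
            have h2 : -Real.log (pt S (Function.update c 1 a)) ≤
                (⌈(N : ℝ) * (-Real.log (pt S (Function.update c 1 a)))⌉₊ : ℝ) / N := by
              rw [le_div_iff₀ hN0, mul_comm]; exact h1
            calc _ ≤ Real.exp (Real.log (pt S (Function.update c 1 a))) := by
                  apply Real.exp_le_exp.2; linarith
              _ = _ := Real.exp_log (hpt0 _ _)
        _ ≤ 1 := by
            simp only [pt]
            rw [← Finset.sum_div, div_le_one hden, Finset.sum_add_distrib]
            have := hqsum S hS c
            simp only [Finset.sum_const, Finset.card_univ, Fintype.card_fin, nsmul_eq_mul]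
            linarith
    · simp only [codeCost, hSK, dif_neg, not_false_eq_true]
      rw [Real.exp_neg, Real.exp_log hk']
      simp [hk'.ne']
  · have hb := bounded_avgCost α K N t
    have hi : Integrable (avgOrd K (costAt α (codeCost K N t))) ν :=
      integrable_of_bdd (measurable_avgCost hmeas hα K N t) hb
    have hpt : ∀ᵐ x ∂ν, avgOrd K (costAt α (codeCost K N t)) x ≤ JV ν α K x + ε := by
      filter_upwards [ae_good hmeas hα ν] with x hx
      have e : ε = ∑ S ∈ K.powerset, ordW K S * ε := by rw [← Finset.sum_mul, ordW_sum, one_mul]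
      rw [JV, avgOrd_eq_sum, avgOrd_eq_sum]
      have e2 : ∑ S ∈ K.powerset, ordW K S * cI ν α 1 S x + ε =
          ∑ S ∈ K.powerset, ordW K S * (cI ν α 1 S x + ε) := by
        simp only [mul_add]
        rw [Finset.sum_add_distrib, ← e]
      rw [e2]
      refine Finset.sum_le_sum fun S hS => ?_
      refine mul_le_mul_of_nonneg_left ?_ (ordW_nonneg _ _)
      rw [costAt, hcost S _ hS]
      have hnl : 0 ≤ -Real.log (pt S (cfg α x)) :=
        neg_nonneg.2 (Real.log_nonpos (hpt0 _ _).le (hpt1 _ _))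
      have h1 := (Nat.ceil_lt_add_one (mul_nonneg hN0.le hnl)).le
      have h2 : (⌈(N : ℝ) * (-Real.log (pt S (cfg α x)))⌉₊ : ℝ) / N ≤
          -Real.log (pt S (cfg α x)) + 1 / N := by
        rw [div_le_iff₀ hN0, add_mul, one_div, inv_mul_cancel₀ hN0.ne', mul_comm _ (N : ℝ)]
        exact h1
      have h3 : 1 / (N : ℝ) ≤ ε / 2 := by
        rw [div_le_iff₀ hN0]
        rw [div_lt_iff₀ hε] at hN
        linarith
      have hqexp : q S (cfg α x) = Real.exp (-cI ν α 1 S x) := by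
        simp only [hq]
        rw [← ENNReal.inv_div (Or.inl (cylM_ne_top _ _ _ _)) (Or.inl (hx _)), ← hx.exp_cI,
          ENNReal.toReal_inv, ENNReal.toReal_ofReal (Real.exp_nonneg _), Real.exp_neg]
      have h4 : -Real.log (pt S (cfg α x)) ≤ cI ν α 1 S x + ε / 2 := by
        have hlog : Real.log (1 + k * η) ≤ ε / 2 := by
          have h5 := Real.log_le_sub_one_of_pos hden
          have h6 : k * η = ε / 2 := by simp only [η]; field_simp
          linarith
        have hqp : 0 < q S (cfg α x) + η := by have := hq0 S (cfg α x); linarith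
        simp only [pt]
        rw [Real.log_div hqp.ne' hden.ne']
        have h7 : -cI ν α 1 S x ≤ Real.log (q S (cfg α x) + η) := by
          rw [Real.le_log_iff_exp_le hqp, ← hqexp]; linarith
        linarith
      linarith
    calc _ ≤ ∫ x, (JV ν α K x + ε) ∂ν :=
          integral_mono_ae hi ((integrable_JV hmeas hα ν ν K).add (integrable_const _)) hpt
      _ = _ := by
          rw [integral_add (integrable_JV hmeas hα ν ν K) (integrable_const _)]; simp

end Upper

section Disint

variable {X Y : Type*} [MeasurableSpace X] [MeasurableSpace Y]

lemma disint_aemeasurable_set {μ : Measure X} [IsProbabilityMeasure μ] {π : Measure Y}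
    [IsProbabilityMeasure π] {μy : Y → Measure X} (hprob : ∀ y, IsProbabilityMeasure (μy y))
    (hdecomp : ∀ A : Set X, MeasurableSet A → μ A = ∫⁻ y, μy y A ∂π) {A : Set X}
    (hA : MeasurableSet A) : AEMeasurable (fun y => μy y A) π := by
  obtain ⟨f, hf, hfle, hfe⟩ := exists_measurable_le_lintegral_eq π (fun y => μy y A)
  obtain ⟨g, hg, hgle, hge⟩ := exists_measurable_le_lintegral_eq π (fun y => μy y Aᶜ)
  have hadd : ∀ y, μy y A + μy y Aᶜ = 1 := fun y => by
    have := hprob y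
    rw [measure_add_measure_compl hA, measure_univ]
  have hle : ∀ y, f y + g y ≤ 1 := fun y => (add_le_add (hfle y) (hgle y)).trans (hadd y).le
  have hIntEq : ∫⁻ y, (f y + g y) ∂π = 1 := by
    rw [lintegral_add_left hf, ← hfe, ← hge, ← hdecomp A hA, ← hdecomp _ hA.compl,
      measure_add_measure_compl hA, measure_univ]
  have hz : ∫⁻ y, (1 - (f y + g y)) ∂π = 0 := by
    rw [lintegral_sub (g := fun y => f y + g y) (hf.add hg) (by rw [hIntEq]; exact ENNReal.one_ne_top) (ae_of_all _ hle), hIntEq]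
    simp
  have hmm : Measurable fun y => 1 - (f y + g y) := measurable_const.sub (hf.add hg)
  rw [lintegral_eq_zero_iff hmm] at hz
  refine ⟨f, hf, ?_⟩
  filter_upwards [hz] with y hy
  have h1 : f y + g y = 1 := le_antisymm (hle y) (tsub_eq_zero_iff_le.1 hy)
  refine le_antisymm ?_ (hfle y)
  by_contra hlt
  rw [not_le] at hlt
  have h2 : g y ≠ ⊤ := ne_top_of_le_ne_top ENNReal.one_ne_top (h1 ▸ le_add_self)
  have : f y + g y < μy y A + μy y Aᶜ := ENNReal.add_lt_add_of_lt_of_le h2 hlt (hgle y)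
  rw [h1, hadd] at this
  exact lt_irrefl _ this

lemma disint_aemeasurable_lintegral {μ : Measure X} [IsProbabilityMeasure μ] {π : Measure Y}
    [IsProbabilityMeasure π] {μy : Y → Measure X} (hprob : ∀ y, IsProbabilityMeasure (μy y))
    (hdecomp : ∀ A : Set X, MeasurableSet A → μ A = ∫⁻ y, μy y A ∂π) {f : X → ℝ≥0∞}
    (hf : Measurable f) : AEMeasurable (fun y => ∫⁻ x, f x ∂(μy y)) π := by
  refine Measurable.ennreal_induction (motive := fun f =>
    AEMeasurable (fun y => ∫⁻ x, f x ∂(μy y)) π) ?_ ?_ ?_ hf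
  · intro c s hs
    simp only [lintegral_indicator hs, lintegral_const, Measure.restrict_apply_univ]
    exact (disint_aemeasurable_set hprob hdecomp hs).const_mul c
  · intro f g _ hf hg h1 h2
    have : (fun y => ∫⁻ x, (f + g) x ∂(μy y)) =
        fun y => ∫⁻ x, f x ∂(μy y) + ∫⁻ x, g x ∂(μy y) := by
      ext y; simp only [Pi.add_apply]; exact lintegral_add_left hf _
    rw [this]
    exact h1.add h2
  · intro f hf hm h
    have : (fun y => ∫⁻ x, (⨆ n, f n x) ∂(μy y)) = fun y => ⨆ n, ∫⁻ x, f n x ∂(μy y) := by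
      ext y; exact lintegral_iSup hf hm
    rw [this]
    exact AEMeasurable.iSup h

lemma disint_aemeasurable_integral {μ : Measure X} [IsProbabilityMeasure μ] {π : Measure Y}
    [IsProbabilityMeasure π] {μy : Y → Measure X} (hprob : ∀ y, IsProbabilityMeasure (μy y))
    (hdecomp : ∀ A : Set X, MeasurableSet A → μ A = ∫⁻ y, μy y A ∂π) {f : X → ℝ}
    (hf : Measurable f) (hb : ∃ M, ∀ x, |f x| ≤ M) :
    AEMeasurable (fun y => ∫ x, f x ∂(μy y)) π := by
  have : (fun y => ∫ x, f x ∂(μy y)) = fun y => (∫⁻ x, ENNReal.ofReal (f x) ∂(μy y)).toReal -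
      (∫⁻ x, ENNReal.ofReal (-f x) ∂(μy y)).toReal := by
    ext y
    have := hprob y
    exact integral_eq_lintegral_pos_part_sub_lintegral_neg_part (integrable_of_bdd hf hb)
  rw [this]
  exact (disint_aemeasurable_lintegral hprob hdecomp hf.ennreal_ofReal).ennreal_toReal.sub
    (disint_aemeasurable_lintegral hprob hdecomp hf.neg.ennreal_ofReal).ennreal_toReal

lemma disint_map {μ : Measure X} [IsProbabilityMeasure μ] {π : Measure Y}
    [IsProbabilityMeasure π] {μy : Y → Measure X} (hprob : ∀ y, IsProbabilityMeasure (μy y))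
    (hdecomp : ∀ A : Set X, MeasurableSet A → μ A = ∫⁻ y, μy y A ∂π)
    [MeasurableSingletonClass Y] {p : X → Y} (hp : Measurable p)
    (hfiber : ∀ᵐ y ∂π, μy y (p ⁻¹' {y}) = 1) : Measure.map p μ = π := by
  ext B hB
  rw [Measure.map_apply hp hB, hdecomp _ (hp hB), ← lintegral_indicator_one hB]
  refine lintegral_congr_ae ?_
  filter_upwards [hfiber] with y hy
  have := hprob y
  by_cases h : y ∈ B
  · simp only [h, indicator_of_mem, Pi.one_apply]
    refine le_antisymm prob_le_one ?_
    rw [← hy]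
    refine measure_mono fun x hx => ?_
    simp only [mem_preimage, mem_singleton_iff] at hx ⊢
    rwa [hx]
  · simp only [h, not_false_eq_true, indicator_of_notMem]
    have h1 : μy y (p ⁻¹' {y})ᶜ = 0 := (prob_compl_eq_zero_iff (hp (measurableSet_singleton y))).2 hy
    refine measure_mono_null (t := (p ⁻¹' {y})ᶜ) ?_ h1
    intro x hx hx2
    apply h
    simp only [mem_preimage, mem_singleton_iff] at hx hx2
    rwa [← hx2]

lemma disint_ae {μ : Measure X} {π : Measure Y} {μy : Y → Measure X}
    (hdecomp : ∀ A : Set X, MeasurableSet A → μ A = ∫⁻ y, μy y A ∂π) {B : Set X}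
    (hB : MeasurableSet B) (h : ∀ᵐ y ∂π, ∀ᵐ x ∂(μy y), x ∈ B) : ∀ᵐ x ∂μ, x ∈ B := by
  show μ Bᶜ = 0
  rw [hdecomp _ hB.compl]
  rw [lintegral_congr_ae (g := fun _ => 0)]
  · simp
  · filter_upwards [h] with y hy using hy

end Disint

section Erg

variable {G : Type*} [Group G] [DecidableEq G] {X : Type*} [MeasurableSpace X] [MulAction G X]
  [Countable G] {Y : Type*} [MeasurableSpace Y] [MeasurableSingletonClass Y] {k : ℕ}

lemma measurable_ergAvg (hmeas : ∀ g : G, Measurable (fun x : X => g • x)) (F : Finset G)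
    {f : X → ℝ} (hf : Measurable f) : Measurable (ergAvg F f) := by
  unfold ergAvg
  exact (Finset.measurable_sum _ fun g _ => hf.comp (hmeas g)).div_const _

lemma disint_ergodic (hmeas : ∀ g : G, Measurable (fun x : X => g • x))
    {μ : Measure X} [IsProbabilityMeasure μ] {π : Measure Y}
    [IsProbabilityMeasure π] {μy : Y → Measure X} (hprob : ∀ y, IsProbabilityMeasure (μy y))
    (hdecomp : ∀ A : Set X, MeasurableSet A → μ A = ∫⁻ y, μy y A ∂π)
    {p : X → Y} (hp : Measurable p)
    (hfiber : ∀ᵐ y ∂π, μy y (p ⁻¹' {y}) = 1)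
    (hinv' : ∀ᵐ y ∂π, InvariantMeasure G (μy y))
    (herg : ∀ᵐ y ∂π, ErgodicMeasure G (μy y))
    {F : ℕ → Finset G} (hFol : IsFolnerSeq F) (hTemp : IsTemperedSeq F)
    {f : X → ℝ} (hf : Measurable f) (hb : ∃ M, ∀ x, |f x| ≤ M) :
    ∀ᵐ x ∂μ, Tendsto (fun n => ergAvg (F n) f x) atTop (𝓝 (∫ z, f z ∂(μy (p x)))) := by
  obtain ⟨ψ, hψ, hψe⟩ := disint_aemeasurable_integral hprob hdecomp hf hb
  obtain ⟨M, hM⟩ := hb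
  have hB : MeasurableSet {x | Tendsto (fun n => ergAvg (F n) f x - ψ (p x)) atTop (𝓝 0)} :=
    measurableSet_tendsto (𝓝 (0 : ℝ)) fun n => (measurable_ergAvg hmeas (F n) hf).sub (hψ.comp hp)
  have h1 := disint_ae hdecomp hB (by
    filter_upwards [hfiber, hinv', herg, hψe] with y h1 h2 h3 h4
    have := hprob y
    have h5 := pointwise_ergodic_const (μy y) (h2.mp hmeas) h3 F hFol hTemp f hf M hM
    have h6 : ∀ᵐ x ∂(μy y), p x = y := by
      exact (prob_compl_eq_zero_iff (hp (measurableSet_singleton y))).2 h1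
    filter_upwards [h5, h6] with x h7 h8
    rw [h8, ← h4]
    simpa using h7.sub_const (∫ z, f z ∂(μy y)))
  have hmap := disint_map hprob hdecomp hp hfiber
  rw [← hmap] at hψe
  have h2 := ae_of_ae_map hp.aemeasurable hψe
  filter_upwards [h1, h2] with x h3 h4
  rw [h4]
  have := h3.add_const (ψ (p x))
  simpa using this

lemma disint_upper (hmeas : ∀ g : G, Measurable (fun x : X => g • x)) {α : X → Fin k}
    (hα : Measurable α)
    {μ : Measure X} [IsProbabilityMeasure μ] {π : Measure Y}
    [IsProbabilityMeasure π] {μy : Y → Measure X} (hprob : ∀ y, IsProbabilityMeasure (μy y))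
    (hdecomp : ∀ A : Set X, MeasurableSet A → μ A = ∫⁻ y, μy y A ∂π)
    {p : X → Y} (hp : Measurable p)
    (hfiber : ∀ᵐ y ∂π, μy y (p ⁻¹' {y}) = 1)
    (hinv' : ∀ᵐ y ∂π, InvariantMeasure G (μy y))
    (herg : ∀ᵐ y ∂π, ErgodicMeasure G (μy y))
    {F : ℕ → Finset G} (hFol : IsFolnerSeq F) (hTemp : IsTemperedSeq F) (hGrow : GrowthCond F) :
    ∀ᵐ x ∂μ, ∀ ε > 0, ∀ᶠ n in atTop,
      LF μ α (F n) x / (F n).card ≤ hInf G (μy (p x)) α + ε := by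
  have h1 : ∀ᵐ x ∂μ, ∀ (K : Finset G) (N : ℕ) (t : Code k K),
      Tendsto (fun n => ergAvg (F n) (avgOrd K (costAt α (codeCost K N t))) x) atTop
        (𝓝 (∫ z, avgOrd K (costAt α (codeCost K N t)) z ∂(μy (p x)))) := by
    rw [ae_all_iff]; intro K
    rw [ae_all_iff]; intro N
    rw [ae_all_iff]; intro t
    exact disint_ergodic hmeas hprob hdecomp hp hfiber hinv' herg hFol hTemp
      (measurable_avgCost hmeas hα K N t) (bounded_avgCost α K N t)
  filter_upwards [h1, upper_code hmeas hα (μ := μ) hFol hGrow] with x h2 h3 ε hε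
  have := hprob (p x)
  have hε4 : 0 < ε / 4 := by positivity
  obtain ⟨K, hK⟩ := exists_lt_hInf (G := G) (α := α) (μy (p x)) hε4
  obtain ⟨N, t, hKr, ht⟩ := exists_code hmeas hα (μy (p x)) K hε4
  have h4 := (h2 K N t).eventually (gt_mem_nhds (lt_add_of_pos_right _ hε4))
  filter_upwards [h3 K N t hKr _ hε4, h4] with n h5 h6
  linarith

lemma disint_entropy_integral (hmeas : ∀ g : G, Measurable (fun x : X => g • x)) {α : X → Fin k}
    (hα : Measurable α)
    {μ : Measure X} [IsProbabilityMeasure μ] {π : Measure Y}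
    [IsProbabilityMeasure π] {μy : Y → Measure X} (hprob : ∀ y, IsProbabilityMeasure (μy y))
    (hdecomp : ∀ A : Set X, MeasurableSet A → μ A = ∫⁻ y, μy y A ∂π) (S : Finset G) :
    Integrable (fun y => partitionEntropy (μy y) α S) π ∧
    ∫ y, partitionEntropy (μy y) α S ∂π ≤ partitionEntropy μ α S := by
  have hms : ∀ f : S → Fin k, MeasurableSet {x : X | ∀ g : S, α ((g : G) • x) = f g} := by
    intro f
    rw [setOf_forall]
    exact MeasurableSet.iInter fun g => (hα.comp (hmeas g)) (measurableSet_singleton _)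
  have hm : ∀ f : S → Fin k,
      AEMeasurable (fun y => (μy y {x : X | ∀ g : S, α ((g : G) • x) = f g}).toReal) π :=
    fun f => (disint_aemeasurable_set hprob hdecomp (hms f)).ennreal_toReal
  have hbd : ∀ A : Set X, ∀ y, 0 ≤ (μy y A).toReal ∧ (μy y A).toReal ≤ 1 := fun A y => by
    have := hprob y
    exact ⟨ENNReal.toReal_nonneg, ENNReal.toReal_le_of_le_ofReal zero_le_one (by simpa using prob_le_one)⟩
  have hi1 : ∀ f : S → Fin k,
      Integrable (fun y => (μy y {x : X | ∀ g : S, α ((g : G) • x) = f g}).toReal) π := fun f =>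
    Integrable.of_bound (hm f).aestronglyMeasurable 1 (ae_of_all _ fun y => by
      rw [Real.norm_eq_abs, abs_of_nonneg (hbd _ y).1]; exact (hbd _ y).2)
  have hi2 : ∀ f : S → Fin k, Integrable (fun y =>
      Real.negMulLog (μy y {x : X | ∀ g : S, α ((g : G) • x) = f g}).toReal) π := fun f =>
    Integrable.of_bound (Real.continuous_negMulLog.measurable.comp_aemeasurable
      (hm f)).aestronglyMeasurable 1 (ae_of_all _ fun y => by
        obtain ⟨h0, h1⟩ := hbd {x : X | ∀ g : S, α ((g : G) • x) = f g} y
        rw [Real.norm_eq_abs, abs_of_nonneg (Real.negMulLog_nonneg h0 h1)]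
        rw [Real.negMulLog]
        rcases h0.eq_or_lt with h | h
        · rw [← h]; simp
        · have := Real.one_sub_inv_le_log_of_pos h
          have h2 := mul_le_mul_of_nonneg_left this h0
          rw [mul_sub, mul_inv_cancel₀ h.ne'] at h2
          linarith)
  refine ⟨?_, ?_⟩
  · unfold partitionEntropy
    exact integrable_finsetSum _ fun f _ => hi2 f
  · unfold partitionEntropy
    rw [integral_finsetSum _ fun f _ => hi2 f]
    refine Finset.sum_le_sum fun f _ => ?_
    have := Real.concaveOn_negMulLog.le_map_integral Real.continuous_negMulLog.continuousOn
      isClosed_Ici (ae_of_all _ fun y => (hbd _ y).1) (hi1 f) (hi2 f)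
    refine this.trans (le_of_eq ?_)
    congr 1
    rw [hdecomp _ (hms f), integral_toReal]
    · exact disint_aemeasurable_set hprob hdecomp (hms f)
    · exact ae_of_all _ fun y => by have := hprob y; exact measure_lt_top _ _

lemma disint_hInf (hmeas : ∀ g : G, Measurable (fun x : X => g • x)) {α : X → Fin k}
    (hα : Measurable α)
    {μ : Measure X} [IsProbabilityMeasure μ] (hinv : InvariantMeasure G μ) {π : Measure Y}
    [IsProbabilityMeasure π] {μy : Y → Measure X} (hprob : ∀ y, IsProbabilityMeasure (μy y))
    (hdecomp : ∀ A : Set X, MeasurableSet A → μ A = ∫⁻ y, μy y A ∂π)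
    (hinv' : ∀ᵐ y ∂π, InvariantMeasure G (μy y))
    {F : ℕ → Finset G} (hFol : IsFolnerSeq F) :
    Integrable (fun y => hInf G (μy y) α) π ∧ ∫ y, hInf G (μy y) α ∂π ≤ hInf G μ α := by
  have hpos : ∀ n, (0 : ℝ) < (F n).card := fun n => by exact_mod_cast (hFol.1 n).card_pos
  have hlim : ∀ᵐ y ∂π, Tendsto (fun n => partitionEntropy (μy y) α (F n) / (F n).card) atTop
      (𝓝 (hInf G (μy y) α)) := by
    filter_upwards [hinv'] with y hy
    have := hprob y
    exact entropy_tendsto hmeas hα hy hFol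
  have hE := fun n => disint_entropy_integral hmeas hα hprob hdecomp (μ := μ) (π := π) (F n)
  have hi := fun n => (hE n).1.div_const ((F n).card : ℝ)
  have hbd : ∀ n, ∀ᵐ y ∂π, ‖partitionEntropy (μy y) α (F n) / (F n).card‖ ≤ Real.log k := by
    intro n
    filter_upwards [hinv'] with y hy
    have := hprob y
    rw [Real.norm_eq_abs, abs_of_nonneg (div_nonneg (partitionEntropy_nonneg hmeas hα _) (hpos n).le),
      div_le_iff₀ (hpos n), mul_comm]
    exact partitionEntropy_le hmeas hα hy _
  have hDCT := tendsto_integral_of_dominated_convergence (fun _ => Real.log k)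
    (fun n => (hi n).aestronglyMeasurable) (integrable_const _) hbd hlim
  have hmeasu : AEStronglyMeasurable (fun y => hInf G (μy y) α) π :=
    aestronglyMeasurable_of_tendsto_ae atTop (fun n => (hi n).aestronglyMeasurable) hlim
  refine ⟨?_, ?_⟩
  · refine Integrable.of_bound hmeasu (Real.log k) ?_
    filter_upwards [hlim, ae_all_iff.2 hbd] with y h1 h2
    exact le_of_tendsto h1.norm (Eventually.of_forall h2)
  · refine le_of_tendsto_of_tendsto' hDCT (entropy_tendsto hmeas hα hinv hFol) fun n => ?_
    rw [integral_div]
    exact div_le_div_of_nonneg_right (hE n).2 (hpos n).le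

end Erg
variable {G : Type*} [Group G] [Countable G] [Infinite G] [DecidableEq G]
  {X : Type*} [MeasurableSpace X] [MulAction G X]

theorem shannonMcMillanBreiman_nonergodic
    (hmeas : ∀ g : G, Measurable (fun x : X => g • x))
    (μ : Measure X) [IsProbabilityMeasure μ] (hinv : InvariantMeasure G μ)
    (F : ℕ → Finset G) (hFol : IsFolnerSeq F) (hTemp : IsTemperedSeq F) (hGrow : GrowthCond F)
    {k : ℕ} (α : X → Fin k) (hα : Measurable α)
    {Y : Type*} [MeasurableSpace Y] [MeasurableSingletonClass Y]
    (π : Measure Y) [IsProbabilityMeasure π] (p : X → Y) (hp : Measurable p)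
    (μy : Y → Measure X) (hprob : ∀ y, IsProbabilityMeasure (μy y))
    (hdecomp : ∀ A : Set X, MeasurableSet A → μ A = ∫⁻ y, μy y A ∂π)
    (hfiber : ∀ᵐ y ∂π, μy y (p ⁻¹' {y}) = 1)
    (hinv' : ∀ᵐ y ∂π, InvariantMeasure G (μy y))
    (herg : ∀ᵐ y ∂π, ErgodicMeasure G (μy y))
    (hpinv : ∀ᵐ x ∂μ, ∀ g : G, p (g • x) = p x) :
    (∀ᵐ x ∂μ,
      Tendsto (fun n =>
          -(Real.log ((μ {z | ∀ g ∈ F n, α (g • z) = α (g • x)}).toReal)) / (F n).card)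
        atTop (𝓝 (partitionDynEntropy F (μy (p x)) α))) ∧
    (∀ᵐ x ∂μ, ∀ g : G,
      partitionDynEntropy F (μy (p (g • x))) α = partitionDynEntropy F (μy (p x)) α) ∧
    ∫ x, partitionDynEntropy F (μy (p x)) α ∂μ = partitionDynEntropy F μ α := by
  have hmap := disint_map hprob hdecomp hp hfiber
  have hpos : ∀ n, (0 : ℝ) < (F n).card := fun n => by exact_mod_cast (hFol.1 n).card_pos
  have hdyn : ∀ᵐ x ∂μ, partitionDynEntropy F (μy (p x)) α = hInf G (μy (p x)) α := by
    have h := hinv'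
    rw [← hmap] at h
    filter_upwards [ae_of_ae_map hp.aemeasurable h] with x hx
    have := hprob (p x)
    exact dynEntropy_eq hmeas hα hx hFol
  have hup := disint_upper hmeas hα (μ := μ) hprob hdecomp hp hfiber hinv' herg hFol hTemp hGrow
  obtain ⟨hhi, hhle⟩ := disint_hInf hmeas hα hinv hprob hdecomp hinv' hFol
  obtain ⟨J, hJm, hJi, hJ0, happ, hJint⟩ := exists_Jinf hmeas hα μ
  have hlow := lower_bound hmeas hα hinv hFol hGrow hJm hJi happ
  have hhi2 : Integrable (fun x => hInf G (μy (p x)) α) μ := by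
    rw [← hmap] at hhi
    exact hhi.comp_measurable hp
  have hhIntEq : ∫ x, hInf G (μy (p x)) α ∂μ = ∫ y, hInf G (μy y) α ∂π := by
    have h := hhi.aestronglyMeasurable
    rw [← hmap] at h
    conv_rhs => rw [← hmap]
    exact (integral_map hp.aemeasurable h).symm
  have hmp := hinv.mp hmeas
  have hJorb : ∀ᵐ x ∂μ, ∀ g : G, 0 ≤ J (g • x) := by
    rw [ae_all_iff]
    intro g
    exact (hmp g).quasiMeasurePreserving.ae hJ0
  have hfm : ∀ M : ℕ, Measurable (fun x => max 0 (min (J x) M)) := fun M =>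
    measurable_const.max (hJm.min measurable_const)
  have hpe := fun M : ℕ => pointwise_ergodic μ hmp F hFol hTemp (fun x => max 0 (min (J x) M)) (hfm M)
    (M : ℝ) (fun x => by
      rw [abs_of_nonneg (le_max_left _ _)]
      exact max_le (Nat.cast_nonneg M) (min_le_right _ _))
  choose v hvm hvi _ hvt hvint using hpe
  have hge : ∀ᵐ x ∂μ, ∀ M : ℕ, ∀ ε > 0, ∀ᶠ n in atTop,
      v M x - ε ≤ LF μ α (F n) x / (F n).card := by
    filter_upwards [hlow, hJorb, ae_all_iff.2 hvt] with x h1 h2 h3 M ε hε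
    filter_upwards [h1 (ε / 2) (half_pos hε),
      (h3 M).eventually (lt_mem_nhds (sub_lt_self _ (half_pos hε)))] with n h4 h5
    have h6 : ergAvg (F n) (fun x => max 0 (min (J x) M)) x ≤ ergAvg (F n) J x := by
      unfold ergAvg
      exact div_le_div_of_nonneg_right
        (Finset.sum_le_sum fun g _ => max_le (h2 g) (min_le_left _ _)) (hpos n).le
    linarith
  have hvle : ∀ᵐ x ∂μ, ∀ M : ℕ, v M x ≤ hInf G (μy (p x)) α := by
    filter_upwards [hge, hup] with x h1 h2 M
    refine le_of_forall_pos_le_add fun ε hε => ?_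
    obtain ⟨n, h3, h4⟩ := ((h1 M (ε / 2) (half_pos hε)).and (h2 (ε / 2) (half_pos hε))).exists
    linarith
  have hvlim : Tendsto (fun M => ∫ x, v M x ∂μ) atTop (𝓝 (hInf G μ α)) := by
    rw [← hJint]
    simp_rw [hvint]
    refine tendsto_integral_of_dominated_convergence (fun x => |J x|)
      (fun M => (hfm M).aestronglyMeasurable) hJi.abs (fun M => ?_) ?_
    · refine ae_of_all _ fun x => ?_
      rw [Real.norm_eq_abs, abs_of_nonneg (le_max_left _ _)]
      exact max_le (abs_nonneg _) ((min_le_left _ _).trans (le_abs_self _))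
    · filter_upwards [hJ0] with x hx
      refine tendsto_const_nhds.congr' ?_
      obtain ⟨M0, hM0⟩ := exists_nat_ge (J x)
      filter_upwards [eventually_ge_atTop M0] with M hM
      have : J x ≤ M := hM0.trans (by exact_mod_cast hM)
      rw [min_eq_left this, max_eq_right hx]
  have heq : ∫ x, hInf G (μy (p x)) α ∂μ = hInf G μ α := by
    refine le_antisymm (hhIntEq.trans_le hhle) ?_
    refine le_of_tendsto' hvlim fun M => ?_
    refine integral_mono_ae (hvi M) hhi2 ?_
    filter_upwards [hvle] with x hx using hx M
  have hFat : ∀ᵐ x ∂μ, liminf (fun M => ENNReal.ofReal (hInf G (μy (p x)) α - v M x)) atTop = 0 := by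
    have h1 : ∀ M, AEMeasurable (fun x => ENNReal.ofReal (hInf G (μy (p x)) α - v M x)) μ :=
      fun M => (hhi2.sub (hvi M)).aestronglyMeasurable.aemeasurable.ennreal_ofReal
    have h2 := lintegral_liminf_le' (μ := μ) (u := atTop) h1
    have h3 : ∀ M, ∫⁻ x, ENNReal.ofReal (hInf G (μy (p x)) α - v M x) ∂μ =
        ENNReal.ofReal (hInf G μ α - ∫ x, v M x ∂μ) := by
      intro M
      rw [← heq, ← integral_sub hhi2 (hvi M)]
      refine (ofReal_integral_eq_lintegral_ofReal (hhi2.sub (hvi M)) ?_).symm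
      filter_upwards [hvle] with x hx using sub_nonneg.2 (hx M)
    have h4 : Tendsto (fun M => ∫⁻ x, ENNReal.ofReal (hInf G (μy (p x)) α - v M x) ∂μ) atTop (𝓝 0) := by
      simp_rw [h3]
      have := ENNReal.tendsto_ofReal (hvlim.const_sub (hInf G μ α))
      simpa using this
    rw [h4.liminf_eq] at h2
    have h6 : AEMeasurable (fun x => liminf (fun M =>
        ENNReal.ofReal (hInf G (μy (p x)) α - v M x)) atTop) μ := by
      refine ⟨fun x => liminf (fun M => (h1 M).mk _ x) atTop,
        Measurable.liminf fun M => (h1 M).measurable_mk, ?_⟩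
      filter_upwards [ae_all_iff.2 fun M => (h1 M).ae_eq_mk] with x hx
      simp only [← hx]
    have h5 := (lintegral_eq_zero_iff' h6).1 (le_antisymm h2 bot_le)
    filter_upwards [h5] with x hx using hx
  have hmain : ∀ᵐ x ∂μ, Tendsto (fun n => LF μ α (F n) x / (F n).card) atTop
      (𝓝 (hInf G (μy (p x)) α)) := by
    filter_upwards [hFat, hge, hup] with x h1 h2 h3
    rw [tendsto_order]
    refine ⟨fun a ha => ?_, fun a ha => ?_⟩
    · have hε : 0 < (hInf G (μy (p x)) α - a) / 3 := by linarith
      have h4 : ∃ᶠ M in atTop, ENNReal.ofReal (hInf G (μy (p x)) α - v M x) <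
          ENNReal.ofReal ((hInf G (μy (p x)) α - a) / 3) := by
        refine frequently_lt_of_liminf_lt (by isBoundedDefault) ?_
        rw [h1]
        exact ENNReal.ofReal_pos.2 hε
      obtain ⟨M, hM⟩ := h4.exists
      have h5 := (ENNReal.ofReal_lt_ofReal_iff hε).1 hM
      filter_upwards [h2 M _ hε] with n hn
      linarith
    · filter_upwards [h3 ((a - hInf G (μy (p x)) α) / 2) (by linarith)] with n hn
      linarith
  refine ⟨?_, ?_, ?_⟩
  · filter_upwards [hmain, hdyn] with x h1 h2
    rw [h2]
    exact h1
  · filter_upwards [hpinv] with x hx g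
    rw [hx g]
  · rw [integral_congr_ae hdyn, heq, dynEntropy_eq hmeas hα hinv hFol]
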